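/- Let p ≥ 5 be prime and k a positive integer with p ∤ k and k ≡ 1 (mod 3) (or p = 3 and k = 2), and let φ(x) = x^p + kp·x^{p−1} − kp ∈ ℤ[x]. Let a₀ ∈ ℚ have infinite forward orbit under φ (the values φ^i(a₀), i ≥ 0, are pairwise distinct), and let P(a₀) be the set of primes q ∈ ℤ⁺ such that v_q(φ^i(a₀)) > 0 for at least one i ≥ 0, where v_q is the q-adic valuation on ℚ. Then P(a₀) has natural density zero in the set of all positive primes: the ratio #{q ∈ P(a₀) : q ≤ x} / #{q prime : q ≤ x} tends to 0 as x → ∞. -/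

import Mathlib

open Polynomial

noncomputable section

/-- The `n`-th iterate of a polynomial under composition: `polyIter φ 0 = X`,
`polyIter φ (n+1) = φ ∘ (polyIter φ n)`. -/
def polyIter {R : Type*} [CommRing R] (φ : Polynomial R) : ℕ → Polynomial R
  | 0 => X
  | n + 1 => φ.comp (polyIter φ n)

/-- The splitting field `K_n` of the `n`-th iterate of `φ ∈ ℤ[x]` over `ℚ`, inside a fixed
algebraic closure of `ℚ`. -/
def Kfield (φ : Polynomial ℤ) (n : ℕ) : IntermediateField ℚ (AlgebraicClosure ℚ) :=
  IntermediateField.adjoin ℚ ((polyIter φ n).rootSet (AlgebraicClosure ℚ))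

/-- The order of `Gal(K_n / K_{n-1})`: the number of automorphisms of `K_n` over `ℚ`
fixing every element of `K_{n-1}` pointwise. -/
def relGalCard (φ : Polynomial ℤ) (n : ℕ) : ℕ :=
  Nat.card {σ : Kfield φ n ≃ₐ[ℚ] Kfield φ n //
    ∀ (x : AlgebraicClosure ℚ) (_ : x ∈ Kfield φ (n - 1)) (hx' : x ∈ Kfield φ n),
      σ ⟨x, hx'⟩ = ⟨x, hx'⟩}

end

section

open Finset MeasureTheory

/-- Partial summation with an error term: `∑ g(k) c(k)` when `∑_{k ≤ t} c(k)` is close to `ρ t`. -/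
theorem partial_summation_split {c : ℕ → ℝ} (hc : c 0 = 0) (ρ : ℝ) {g g' : ℝ → ℝ} {y : ℝ}
    (hy : 1 ≤ y) (hg : ∀ t ∈ Set.Icc 1 y, HasDerivAt g (g' t) t)
    (hg' : ContinuousOn g' (Set.Icc 1 y)) :
    IntervalIntegrable (fun t ↦ g' t * ((∑ k ∈ Icc 0 ⌊t⌋₊, c k) - ρ * t)) volume 1 y ∧
    ∑ k ∈ Icc 0 ⌊y⌋₊, g k * c k = g y * (∑ k ∈ Icc 0 ⌊y⌋₊, c k) - ρ * (∫ t in (1 : ℝ)..y, g' t * t)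
      - ∫ t in (1 : ℝ)..y, g' t * ((∑ k ∈ Icc 0 ⌊t⌋₊, c k) - ρ * t) := by
  have hint : IntegrableOn g' (Set.Icc 1 y) := hg'.integrableOn_Icc
  have heq : Set.EqOn (deriv g) g' (Set.Icc 1 y) := fun t ht ↦ (hg t ht).deriv
  have h1 : IntervalIntegrable (fun t ↦ g' t * (∑ k ∈ Icc 0 ⌊t⌋₊, c k)) volume 1 y := by
    rw [intervalIntegrable_iff_integrableOn_Icc_of_le hy]
    exact integrableOn_mul_sum_Icc c zero_le_one hint
  have h2 : IntervalIntegrable (fun t ↦ g' t * t) volume 1 y := by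
    apply ContinuousOn.intervalIntegrable
    rw [Set.uIcc_of_le hy]
    exact hg'.mul continuousOn_id
  have h3 : (fun t ↦ g' t * ((∑ k ∈ Icc 0 ⌊t⌋₊, c k) - ρ * t)) =
      fun t ↦ g' t * (∑ k ∈ Icc 0 ⌊t⌋₊, c k) - ρ * (g' t * t) := by
    ext t; ring
  refine ⟨by rw [h3]; exact h1.sub (h2.const_mul ρ), ?_⟩
  rw [sum_mul_eq_sub_integral_mul₀ c hc y (fun t ht ↦ (hg t ht).differentiableAt)
    (hint.congr_fun (fun t ht ↦ (heq ht).symm) measurableSet_Icc), h3,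
    intervalIntegral.integral_sub h1 (h2.const_mul ρ), intervalIntegral.integral_const_mul,
    ← intervalIntegral.integral_of_le hy, intervalIntegral.integral_congr (g := fun t ↦
      g' t * ∑ k ∈ Icc 0 ⌊t⌋₊, c k) (fun t ht ↦ by
        rw [Set.uIcc_of_le hy] at ht
        simp only [heq ht])]
  ring

theorem abs_integral_rpow_mul_error_le {E : ℝ → ℝ} {C δ a u v : ℝ} (hu : 1 ≤ u) (huv : u ≤ v)
    {g' : ℝ → ℝ} {B : ℝ} (hB : 0 ≤ B) (hg : ∀ t ∈ Set.Icc u v, |g' t| ≤ B * t ^ a)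
    (hE : ∀ t ∈ Set.Icc u v, |E t| ≤ C * t ^ (1 - δ)) (ha : a + 2 - δ ≠ 0) :
    |∫ t in u..v, g' t * E t| ≤
      B * C * ((v ^ (a + 2 - δ) - u ^ (a + 2 - δ)) / (a + 2 - δ)) := by
  have hu0 : 0 < u := by linarith
  have hnot : (0 : ℝ) ∉ Set.uIcc u v := by
    rw [Set.uIcc_of_le huv]; exact fun h ↦ by linarith [h.1]
  have key : ∫ t in u..v, B * C * t ^ (a + 1 - δ) =
      B * C * ((v ^ (a + 2 - δ) - u ^ (a + 2 - δ)) / (a + 2 - δ)) := by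
    rw [intervalIntegral.integral_const_mul, integral_rpow]
    · rw [show a + 1 - δ + 1 = a + 2 - δ by ring]
    · right
      refine ⟨fun h ↦ ha (by linarith), hnot⟩
  rw [← key, ← Real.norm_eq_abs]
  refine intervalIntegral.norm_integral_le_of_norm_le huv ?_ ?_
  · refine Filter.Eventually.of_forall fun t ht ↦ ?_
    have ht' := Set.Ioc_subset_Icc_self ht
    have ht0 : 0 < t := by linarith [ht.1]
    rw [Real.norm_eq_abs, abs_mul]
    calc |g' t| * |E t| ≤ (B * t ^ a) * (C * t ^ (1 - δ)) :=
          mul_le_mul (hg t ht') (hE t ht') (abs_nonneg _) (by positivity)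
      _ = B * C * t ^ (a + 1 - δ) := by
          rw [show a + 1 - δ = a + (1 - δ) by ring, Real.rpow_add ht0]; ring
  · exact (intervalIntegral.intervalIntegrable_rpow (Or.inr hnot)).const_mul _

section Sums

variable {c : ℕ → ℝ} {ρ C δ X : ℝ}

theorem exists_sum_div_approx (hc : c 0 = 0) (hρ : 0 ≤ ρ) (hδ : 0 < δ) (hC : 0 ≤ C) (hX : 1 ≤ X)
    (hS : ∀ t, 1 ≤ t → t ≤ X → |(∑ k ∈ Icc 0 ⌊t⌋₊, c k) - ρ * t| ≤ C * t ^ (1 - δ)) :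
    ∃ γ : ℝ, |γ| ≤ ρ + C / δ ∧ ∀ y, 1 ≤ y → y ≤ X →
      |(∑ k ∈ Icc 0 ⌊y⌋₊, (k : ℝ)⁻¹ * c k) - ρ * Real.log y - γ| ≤ (C + C / δ) * y ^ (-δ) := by
  set E : ℝ → ℝ := fun t ↦ (∑ k ∈ Icc 0 ⌊t⌋₊, c k) - ρ * t with hEdef
  have hsplit : ∀ y, 1 ≤ y →
      IntervalIntegrable (fun t ↦ -(t ^ 2)⁻¹ * E t) volume 1 y ∧
      ∑ k ∈ Icc 0 ⌊y⌋₊, (k : ℝ)⁻¹ * c k = y⁻¹ * (∑ k ∈ Icc 0 ⌊y⌋₊, c k) -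
        ρ * (∫ t in (1 : ℝ)..y, -(t ^ 2)⁻¹ * t) - ∫ t in (1 : ℝ)..y, -(t ^ 2)⁻¹ * E t := by
    intro y hy
    refine partial_summation_split hc ρ hy (g := fun t ↦ t⁻¹) (fun t ht ↦ ?_) ?_
    · exact hasDerivAt_inv (by linarith [ht.1])
    · refine (ContinuousOn.inv₀ (by fun_prop) fun t ht ↦ ?_).neg
      have := ht.1
      positivity
  have hbound : ∀ u v, 1 ≤ u → u ≤ v → v ≤ X →
      |∫ t in u..v, -(t ^ 2)⁻¹ * E t| ≤ C / δ * u ^ (-δ) := by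
    intro u v hu huv hv
    have h := abs_integral_rpow_mul_error_le (E := E) (C := C) (δ := δ) (a := -2) (B := 1) hu huv
      (g' := fun t ↦ -(t ^ 2)⁻¹) zero_le_one (fun t ht ↦ ?_)
      (fun t ht ↦ hS t (hu.trans ht.1) (ht.2.trans hv)) (by linarith)
    · refine h.trans ?_
      have hv0 : 0 ≤ v ^ (-δ) := Real.rpow_nonneg (by linarith) _
      rw [show (-2 + 2 - δ : ℝ) = -δ by ring, one_mul, div_neg, ← neg_div, neg_sub, mul_div_assoc',
        div_mul_eq_mul_div]
      gcongr
      linarith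
    · have : 0 < t := by linarith [ht.1]
      rw [abs_neg, abs_of_nonneg (by positivity), one_mul, Real.rpow_neg this.le]
      norm_num
  have hlog : ∀ y, 1 ≤ y → ∫ t in (1 : ℝ)..y, -(t ^ 2)⁻¹ * t = -Real.log y := by
    intro y hy
    rw [← div_one y, ← integral_inv_of_pos one_pos (by linarith), div_one,
      ← intervalIntegral.integral_neg]
    refine intervalIntegral.integral_congr fun t ht ↦ ?_
    rw [Set.uIcc_of_le hy] at ht
    have : t ≠ 0 := by linarith [ht.1]
    field_simp
  refine ⟨ρ - ∫ t in (1 : ℝ)..X, -(t ^ 2)⁻¹ * E t, ?_, fun y hy hyX ↦ ?_⟩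
  · refine (abs_sub _ _).trans ?_
    rw [abs_of_nonneg hρ]
    have := hbound 1 X le_rfl hX le_rfl
    rw [Real.one_rpow, mul_one] at this
    linarith
  · have hadd := intervalIntegral.integral_add_adjacent_intervals (hsplit y hy).1
      ((hsplit y hy).1.symm.trans (hsplit X hX).1)
    have hSy : (∑ k ∈ Icc 0 ⌊y⌋₊, c k) = ρ * y + E y := by rw [hEdef]; ring
    rw [(hsplit y hy).2, hlog y hy, ← hadd, hSy]
    have hy0 : 0 < y := by linarith
    have h1 : |y⁻¹ * E y| ≤ C * y ^ (-δ) := by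
      rw [abs_mul, abs_of_pos (inv_pos.mpr hy0)]
      calc y⁻¹ * |E y| ≤ y⁻¹ * (C * y ^ (1 - δ)) := by
            gcongr; exact hS y hy hyX
        _ = C * y ^ (-δ) := by
            rw [sub_eq_add_neg, Real.rpow_add hy0, Real.rpow_one]; field_simp
    have h2 := hbound y X hy hyX le_rfl
    have : y⁻¹ * (ρ * y + E y) = ρ + y⁻¹ * E y := by field_simp
    rw [this]
    rw [abs_le] at h1 h2 ⊢
    constructor <;> linarith [h1.1, h1.2, h2.1, h2.2]

theorem abs_sum_log_mul_sub_le (hc : c 0 = 0) (hρ : 0 ≤ ρ) (hδ1 : δ < 1) (hC : 0 ≤ C)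
    (hS : ∀ t, 1 ≤ t → t ≤ X → |(∑ k ∈ Icc 0 ⌊t⌋₊, c k) - ρ * t| ≤ C * t ^ (1 - δ))
    {y : ℝ} (hy : 1 ≤ y) (hyX : y ≤ X) :
    |(∑ k ∈ Icc 0 ⌊y⌋₊, Real.log k * c k) - ρ * y * Real.log y + ρ * y| ≤
      ρ + C * y ^ (1 - δ) * (Real.log y + 1 / (1 - δ)) := by
  set E : ℝ → ℝ := fun t ↦ (∑ k ∈ Icc 0 ⌊t⌋₊, c k) - ρ * t with hEdef
  have hy0 : 0 < y := by linarith
  have hsplit := (partial_summation_split hc ρ hy (g := Real.log) (g' := fun t ↦ t⁻¹)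
    (fun t ht ↦ Real.hasDerivAt_log (by linarith [ht.1])) (continuousOn_inv₀.mono fun t ht ↦ by
      simpa using (by linarith [ht.1] : t ≠ 0))).2
  have h1 : ∫ t in (1 : ℝ)..y, t⁻¹ * t = y - 1 := by
    rw [intervalIntegral.integral_congr (g := fun _ ↦ (1 : ℝ)) fun t ht ↦ ?_]
    · simp
    · rw [Set.uIcc_of_le hy] at ht
      exact inv_mul_cancel₀ (by linarith [ht.1])
  have h2 : |∫ t in (1 : ℝ)..y, t⁻¹ * E t| ≤ C * y ^ (1 - δ) * (1 / (1 - δ)) := by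
    have h := abs_integral_rpow_mul_error_le (E := E) (C := C) (δ := δ) (a := -1) (B := 1) le_rfl hy
      (g' := fun t ↦ t⁻¹) zero_le_one (fun t ht ↦ ?_)
      (fun t ht ↦ hS t ht.1 (ht.2.trans hyX)) (by linarith)
    · refine h.trans ?_
      rw [show (-1 + 2 - δ : ℝ) = 1 - δ by ring, one_mul, Real.one_rpow, mul_assoc]
      have : 0 < 1 - δ := by linarith
      gcongr
      rw [div_eq_mul_one_div]
      gcongr
      linarith
    · have : 0 < t := by linarith [ht.1]
      rw [abs_of_nonneg (by positivity), one_mul, Real.rpow_neg_one]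
  have h3 : |Real.log y * E y| ≤ Real.log y * (C * y ^ (1 - δ)) := by
    rw [abs_mul, abs_of_nonneg (Real.log_nonneg hy)]
    exact mul_le_mul_of_nonneg_left (hS y hy hyX) (Real.log_nonneg hy)
  have hSy : (∑ k ∈ Icc 0 ⌊y⌋₊, c k) = ρ * y + E y := by rw [hEdef]; ring
  rw [hsplit, h1, hSy]
  change |Real.log y * (ρ * y + E y) - ρ * (y - 1) - (∫ t in (1 : ℝ)..y, t⁻¹ * E t)
    - ρ * y * Real.log y + ρ * y| ≤ _
  rw [abs_le] at h2 h3 ⊢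
  constructor <;> nlinarith [h2.1, h2.2, h3.1, h3.2]

theorem sum_mul_div_rpow_le (hc : c 0 = 0) {D θ : ℝ} (hθ : 0 < θ) (hθ1 : θ ≤ 1) (hD : 0 ≤ D)
    {y : ℝ} (hy : 1 ≤ y) (hS : ∀ t, 1 ≤ t → t ≤ y → |∑ k ∈ Icc 0 ⌊t⌋₊, c k| ≤ D * t) :
    ∑ k ∈ Icc 0 ⌊y⌋₊, c k * (y / k) ^ (1 - θ) ≤ D * (1 + 1 / θ) * y := by
  have hy0 : 0 < y := by linarith
  have hsplit := (partial_summation_split hc 0 hy (g := fun t ↦ t ^ (θ - 1))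
    (g' := fun t ↦ (θ - 1) * t ^ (θ - 1 - 1))
    (fun t ht ↦ Real.hasDerivAt_rpow_const (Or.inl (by linarith [ht.1])))
    (continuousOn_const.mul fun t ht ↦ (Real.continuousAt_rpow_const _ _
      (Or.inl (by linarith [ht.1]))).continuousWithinAt)).2
  have h2 := abs_integral_rpow_mul_error_le (E := fun t ↦ (∑ k ∈ Icc 0 ⌊t⌋₊, c k) - 0 * t) (C := D)
    (δ := 0) (a := θ - 1 - 1) (B := 1) le_rfl hy (g' := fun t ↦ (θ - 1) * t ^ (θ - 1 - 1))
    zero_le_one (fun t ht ↦ by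
      have : 0 < t := by linarith [ht.1]
      rw [abs_mul, abs_of_nonneg (Real.rpow_nonneg this.le _)]
      gcongr
      rw [abs_le]; constructor <;> linarith)
    (fun t ht ↦ by simpa using hS t ht.1 ht.2) (by linarith)
  rw [show θ - 1 - 1 + 2 - 0 = θ by ring, Real.one_rpow] at h2
  have h3 : y ^ (θ - 1) * (∑ k ∈ Icc 0 ⌊y⌋₊, c k) ≤ D * y ^ θ := by
    calc y ^ (θ - 1) * (∑ k ∈ Icc 0 ⌊y⌋₊, c k) ≤ y ^ (θ - 1) * (D * y) := by
          gcongr; exact (le_abs_self _).trans (hS y hy le_rfl)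
      _ = D * y ^ θ := by rw [Real.rpow_sub_one hy0.ne']; field_simp
  have h4 : ∑ k ∈ Icc 0 ⌊y⌋₊, (k : ℝ) ^ (θ - 1) * c k ≤ D * (1 + 1 / θ) * y ^ θ := by
    rw [hsplit]
    have h5 : 1 * D * ((y ^ θ - 1) / θ) ≤ D * (1 / θ) * y ^ θ := by
      rw [one_mul, mul_assoc, one_div_mul_eq_div]
      gcongr
      linarith
    have := neg_le_of_abs_le (h2.trans h5)
    rw [zero_mul, sub_zero]
    linarith
  calc ∑ k ∈ Icc 0 ⌊y⌋₊, c k * (y / k) ^ (1 - θ)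
      = y ^ (1 - θ) * ∑ k ∈ Icc 0 ⌊y⌋₊, (k : ℝ) ^ (θ - 1) * c k := by
        rw [mul_sum]
        refine sum_congr rfl fun k _ ↦ ?_
        rw [Real.div_rpow hy0.le k.cast_nonneg, show θ - 1 = -(1 - θ) by ring,
          Real.rpow_neg k.cast_nonneg]
        ring
    _ ≤ y ^ (1 - θ) * (D * (1 + 1 / θ) * y ^ θ) := by gcongr
    _ = D * (1 + 1 / θ) * y := by
        rw [mul_left_comm, ← Real.rpow_add hy0, sub_add_cancel, Real.rpow_one]

end Sums

section DirichletAction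

open ArithmeticFunction (mul_apply pmul_apply log_apply)

/-- The summatory action of an arithmetic function on functions of a real variable,
`y ↦ ∑_{m ≤ y} f(m) H(y / m)`. -/
noncomputable def dirichletAct (f : ArithmeticFunction ℝ) (H : ℝ → ℝ) (y : ℝ) : ℝ :=
  ∑ m ∈ Icc 0 ⌊y⌋₊, f m * H (y / m)

theorem dirichletAct_eq_sum_Ioc (f : ArithmeticFunction ℝ) (H : ℝ → ℝ) (y : ℝ) :
    dirichletAct f H y = ∑ m ∈ Ioc 0 ⌊y⌋₊, f m * H (y / m) := by
  rw [dirichletAct, ← add_sum_Ioc_eq_sum_Icc (Nat.zero_le _)]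
  simp

theorem dirichletAct_mul (f g : ArithmeticFunction ℝ) (H : ℝ → ℝ) (y : ℝ) :
    dirichletAct (f * g) H y = dirichletAct f (dirichletAct g H) y := by
  simp_rw [dirichletAct_eq_sum_Ioc, Nat.floor_div_natCast, mul_apply, sum_mul, mul_sum, sum_sigma']
  refine sum_nbij' (fun z ↦ ⟨z.2.1, z.2.2⟩) (fun z ↦ ⟨z.1 * z.2, (z.1, z.2)⟩) ?_ ?_ ?_ ?_ ?_
  · rintro ⟨n, a, b⟩ h
    simp only [mem_sigma, mem_Ioc, Nat.mem_divisorsAntidiagonal] at h ⊢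
    obtain ⟨⟨h1, h2⟩, rfl, h4⟩ := h
    have ha : 0 < a := Nat.pos_of_ne_zero (by rintro rfl; simp at h4)
    have hb : 0 < b := Nat.pos_of_ne_zero (by rintro rfl; simp at h4)
    exact ⟨⟨ha, (Nat.le_mul_of_pos_right a hb).trans h2⟩, hb,
      (Nat.le_div_iff_mul_le ha).mpr (by rwa [mul_comm])⟩
  · rintro ⟨a, b⟩ h
    simp only [mem_sigma, mem_Ioc, Nat.mem_divisorsAntidiagonal] at h ⊢
    obtain ⟨⟨ha, h2⟩, hb, h4⟩ := h
    rw [Nat.le_div_iff_mul_le ha, mul_comm] at h4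
    exact ⟨⟨by positivity, h4⟩, trivial, by positivity⟩
  · rintro ⟨n, a, b⟩ h
    simp only [mem_sigma, Nat.mem_divisorsAntidiagonal] at h
    obtain ⟨-, rfl, -⟩ := h
    rfl
  · rintro ⟨a, b⟩ h
    rfl
  · rintro ⟨n, a, b⟩ h
    simp only [mem_sigma, Nat.mem_divisorsAntidiagonal] at h
    obtain ⟨-, rfl, -⟩ := h
    simp only [Nat.cast_mul, div_div]
    ring

theorem dirichletAct_one (H : ℝ → ℝ) {y : ℝ} (hy : 1 ≤ y) : dirichletAct 1 H y = H y := by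
  rw [dirichletAct_eq_sum_Ioc, sum_eq_single 1]
  · simp
  · intro b _ hb; simp [ArithmeticFunction.one_apply_ne hb]
  · intro h; exact absurd (mem_Ioc.mpr ⟨one_pos, Nat.one_le_floor_iff y |>.mpr hy⟩) h

theorem dirichletAct_congr (f : ArithmeticFunction ℝ) {H H' : ℝ → ℝ} {y : ℝ}
    (h : ∀ z, 1 ≤ z → z ≤ y → H z = H' z) : dirichletAct f H y = dirichletAct f H' y := by
  rw [dirichletAct_eq_sum_Ioc, dirichletAct_eq_sum_Ioc]
  refine sum_congr rfl fun m hm ↦ ?_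
  rw [mem_Ioc] at hm
  have hm0 : (1 : ℝ) ≤ m := by exact_mod_cast hm.1
  have hmy : (m : ℝ) ≤ y := (Nat.le_floor_iff' (by omega)).mp hm.2
  rw [h _ ((one_le_div (by linarith)).mpr hmy) (div_le_self (by linarith) hm0)]

theorem dirichletAct_add (f : ArithmeticFunction ℝ) (H H' : ℝ → ℝ) (y : ℝ) :
    dirichletAct f (fun z ↦ H z + H' z) y = dirichletAct f H y + dirichletAct f H' y := by
  simp only [dirichletAct, mul_add, sum_add_distrib]

theorem dirichletAct_sub (f : ArithmeticFunction ℝ) (H H' : ℝ → ℝ) (y : ℝ) :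
    dirichletAct f (fun z ↦ H z - H' z) y = dirichletAct f H y - dirichletAct f H' y := by
  simp only [dirichletAct, mul_sub, sum_sub_distrib]

/-- Multiplication by the logarithm is a derivation for the action. -/
theorem log_mul_dirichletAct (f : ArithmeticFunction ℝ) (H : ℝ → ℝ) (y : ℝ) :
    Real.log y * dirichletAct f H y =
      dirichletAct (f.pmul ArithmeticFunction.log) H y +
        dirichletAct f (fun z ↦ Real.log z * H z) y := by
  simp only [dirichletAct_eq_sum_Ioc, mul_sum, ← sum_add_distrib]
  refine sum_congr rfl fun m hm ↦ ?_
  rw [mem_Ioc] at hm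
  have hm0 : (1 : ℝ) ≤ m := by exact_mod_cast hm.1
  have hmy : (m : ℝ) ≤ y := (Nat.le_floor_iff' (by omega)).mp hm.2
  rw [pmul_apply, log_apply, Real.log_div (by linarith) (by linarith)]
  ring

/-- The Tatuzawa–Iseki identity. -/
theorem tatuzawa_iseki {f μ Λ : ArithmeticFunction ℝ} (hμ : μ * f = 1)
    (hΛ : Λ * f = f.pmul ArithmeticFunction.log)
    (H : ℝ → ℝ) {y : ℝ} (hy : 1 ≤ y) :
    dirichletAct μ (fun z ↦ Real.log z * dirichletAct f H z) y =
      dirichletAct Λ H y + Real.log y * H y := by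
  rw [dirichletAct_congr μ (fun z _ _ ↦ log_mul_dirichletAct f H z), dirichletAct_add,
    ← dirichletAct_mul, ← dirichletAct_mul, hμ, dirichletAct_one _ hy, ← hΛ]
  rw [show μ * (Λ * f) = Λ by rw [mul_left_comm, hμ, mul_one]]

end DirichletAction

section Chebyshev

open ArithmeticFunction (mul_apply pmul_apply log_apply)

/-- If the summatory function of `f` is `ρ y` with a power saving error and `L` is the associated
von Mangoldt function, then `log y ∑_{m ≤ y} f(m) (ψ(y/m) - y/m - c)` is small for a suitable
constant `c`. -/
theorem exists_abs_log_mul_dirichletAct_le {ρ δ C : ℝ} (hρ : 0 < ρ) (hδ : 0 < δ) (hδ1 : δ < 1)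
    (hC : 0 ≤ C) : ∃ K : ℝ, 0 ≤ K ∧ ∀ (f L : ArithmeticFunction ℝ) (X : ℝ),
      L * f = f.pmul ArithmeticFunction.log → 1 ≤ X →
      (∀ t, 1 ≤ t → t ≤ X → |(∑ k ∈ Icc 0 ⌊t⌋₊, f k) - ρ * t| ≤ C * t ^ (1 - δ)) →
      ∃ c : ℝ, |c| ≤ K ∧ ∀ y, 1 ≤ y → y ≤ X →
        |Real.log y * dirichletAct f (fun z ↦ dirichletAct L (fun _ ↦ 1) z - z - c) y| ≤
          K * y ^ (1 - δ / 2) := by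
  set c₀ := 1 + (ρ + C / δ) / ρ with hc₀
  have hc₀' : 0 ≤ c₀ := by positivity
  have h1δ : 0 < 1 - δ := by linarith
  set K₀ := ρ + C * (1 + 1 / (1 - δ)) + (C + C / δ) + c₀ * C with hK₀
  have hK₀' : 0 ≤ K₀ := by positivity
  refine ⟨max c₀ (K₀ * (1 + 4 / δ) ^ 2), le_max_of_le_left hc₀', fun f L X hL hX hS ↦ ?_⟩
  obtain ⟨γ, hγ, hγS⟩ := exists_sum_div_approx f.map_zero hρ.le hδ hC hX hS
  refine ⟨-(1 + γ / ρ), le_max_of_le_left ?_, fun y hy hyX ↦ ?_⟩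
  · rw [abs_neg]
    refine (abs_add_le _ _).trans ?_
    rw [abs_one, abs_div, abs_of_pos hρ, hc₀]
    gcongr
  have hy0 : 0 < y := by linarith
  have hlog := Real.log_nonneg hy
  have hyδ : 1 ≤ y ^ (1 - δ) := Real.one_le_rpow hy h1δ.le
  have e1 : dirichletAct f (fun z ↦ dirichletAct L (fun _ ↦ 1) z) y =
      ∑ k ∈ Icc 0 ⌊y⌋₊, Real.log k * f k := by
    rw [← dirichletAct_mul, mul_comm, hL, dirichletAct]
    exact sum_congr rfl fun k _ ↦ by rw [pmul_apply, log_apply]; ring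
  have e2 : dirichletAct f (fun z ↦ z) y = y * ∑ k ∈ Icc 0 ⌊y⌋₊, (k : ℝ)⁻¹ * f k := by
    rw [dirichletAct, mul_sum]
    exact sum_congr rfl fun k _ ↦ by ring
  have e3 : dirichletAct f (fun _ ↦ -(1 + γ / ρ)) y =
      -(1 + γ / ρ) * ∑ k ∈ Icc 0 ⌊y⌋₊, f k := by
    rw [dirichletAct, mul_sum]
    exact sum_congr rfl fun k _ ↦ by ring
  have b1 := abs_sum_log_mul_sub_le f.map_zero hρ.le hδ1 hC hS hy hyX
  have b2 : |y * (∑ k ∈ Icc 0 ⌊y⌋₊, (k : ℝ)⁻¹ * f k) - ρ * y * Real.log y - γ * y| ≤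
      (C + C / δ) * y ^ (1 - δ) := by
    rw [show y * (∑ k ∈ Icc 0 ⌊y⌋₊, (k : ℝ)⁻¹ * f k) - ρ * y * Real.log y - γ * y =
      y * ((∑ k ∈ Icc 0 ⌊y⌋₊, (k : ℝ)⁻¹ * f k) - ρ * Real.log y - γ) by ring, abs_mul,
      abs_of_pos hy0, sub_eq_add_neg 1 δ, Real.rpow_add hy0, Real.rpow_one, mul_left_comm]
    gcongr
    exact hγS y hy hyX
  have b3 : |-(1 + γ / ρ) * ((∑ k ∈ Icc 0 ⌊y⌋₊, f k) - ρ * y)| ≤ c₀ * (C * y ^ (1 - δ)) := by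
    rw [abs_mul]
    refine mul_le_mul ?_ (hS y hy hyX) (abs_nonneg _) hc₀'
    rw [abs_neg]
    refine (abs_add_le _ _).trans ?_
    rw [abs_one, abs_div, abs_of_pos hρ, hc₀]
    gcongr
  have hmain : |dirichletAct f (fun z ↦ dirichletAct L (fun _ ↦ 1) z - z - -(1 + γ / ρ)) y| ≤
      K₀ * (y ^ (1 - δ) * (1 + Real.log y)) := by
    rw [dirichletAct_sub, dirichletAct_sub, e1, e2, e3]
    have e4 : (∑ k ∈ Icc 0 ⌊y⌋₊, Real.log k * f k) -
        (y * ∑ k ∈ Icc 0 ⌊y⌋₊, (k : ℝ)⁻¹ * f k) - -(1 + γ / ρ) * ∑ k ∈ Icc 0 ⌊y⌋₊, f k =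
        ((∑ k ∈ Icc 0 ⌊y⌋₊, Real.log k * f k) - ρ * y * Real.log y + ρ * y) -
        (y * (∑ k ∈ Icc 0 ⌊y⌋₊, (k : ℝ)⁻¹ * f k) - ρ * y * Real.log y - γ * y) -
        (-(1 + γ / ρ) * ((∑ k ∈ Icc 0 ⌊y⌋₊, f k) - ρ * y)) := by
      field_simp
      ring
    rw [e4]
    refine (abs_sub _ _).trans ((add_le_add_left (abs_sub _ _) _).trans ?_)
    refine (add_le_add (add_le_add b1 b2) b3).trans ?_
    set Y := y ^ (1 - δ)
    set l := Real.log y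
    have hi : 0 ≤ 1 / (1 - δ) := by positivity
    have h1 : ρ ≤ ρ * (Y * (1 + l)) := le_mul_of_one_le_right hρ.le (by nlinarith)
    have h2 : C * Y * (l + 1 / (1 - δ)) ≤ C * (1 + 1 / (1 - δ)) * (Y * (1 + l)) := by
      rw [mul_assoc, mul_assoc]
      refine mul_le_mul_of_nonneg_left ?_ hC
      nlinarith [mul_nonneg (by linarith : 0 ≤ Y) (mul_nonneg hi hlog)]
    have h3 : Y ≤ Y * (1 + l) := by nlinarith
    have h4 : (C + C / δ) * Y ≤ (C + C / δ) * (Y * (1 + l)) := by gcongr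
    have h5 : c₀ * (C * Y) ≤ c₀ * C * (Y * (1 + l)) := by rw [← mul_assoc]; gcongr
    rw [hK₀]
    linarith
  rw [abs_mul, abs_of_nonneg hlog]
  have hl : 1 + Real.log y ≤ (1 + 4 / δ) * y ^ (δ / 4) := by
    have := Real.log_le_rpow_div hy0.le (show 0 < δ / 4 by positivity)
    have h1 : 1 ≤ y ^ (δ / 4) := Real.one_le_rpow hy (by positivity)
    calc 1 + Real.log y ≤ y ^ (δ / 4) + y ^ (δ / 4) / (δ / 4) := by linarith
      _ = _ := by field_simp
  calc Real.log y * |dirichletAct f (fun z ↦ dirichletAct L (fun _ ↦ 1) z - z - -(1 + γ / ρ)) y|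
      ≤ (1 + Real.log y) * (K₀ * (y ^ (1 - δ) * (1 + Real.log y))) := by
        gcongr; linarith
    _ = K₀ * (1 + Real.log y) ^ 2 * y ^ (1 - δ) := by ring
    _ ≤ K₀ * ((1 + 4 / δ) * y ^ (δ / 4)) ^ 2 * y ^ (1 - δ) := by gcongr
    _ = K₀ * (1 + 4 / δ) ^ 2 * y ^ (1 - δ / 2) := by
        rw [mul_pow, ← Real.rpow_mul_natCast hy0.le, ← mul_assoc, mul_assoc _ _ (y ^ (1 - δ)),
          ← Real.rpow_add hy0]
        congr 2
        push_cast; ring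
    _ ≤ _ := by gcongr; exact le_max_right _ _

/-- An upper bound for `∑_{l ≤ x} L(l) / l` of Mertens type. -/
theorem exists_sum_vonMangoldt_div_le {ρ δ C : ℝ} (hρ : 0 < ρ) (hδ : 0 < δ) :
    ∃ y₀ : ℝ, 1 ≤ y₀ ∧ ∀ (f L : ArithmeticFunction ℝ) (x : ℝ), 1 ≤ x → (∀ n, 0 ≤ f n) →
      (∀ n, 0 ≤ L n) → L * f = f.pmul ArithmeticFunction.log →
      (∀ t, 1 ≤ t → t ≤ x * y₀ → |(∑ k ∈ Icc 0 ⌊t⌋₊, f k) - ρ * t| ≤ C * t ^ (1 - δ)) →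
      ∑ l ∈ Icc 0 ⌊x⌋₊, L l * (x / l) ≤ 4 * x * Real.log (x * y₀) := by
  obtain ⟨y₀, hy₀, hy₀'⟩ : ∃ y₀ : ℝ, 1 ≤ y₀ ∧ ∀ y, y₀ ≤ y → C * y ^ (-δ) ≤ ρ / 2 := by
    have h := (tendsto_rpow_neg_atTop hδ).const_mul C
    rw [mul_zero] at h
    obtain ⟨y₀, h⟩ := Filter.eventually_atTop.mp (h.eventually_le_const (half_pos hρ))
    exact ⟨max 1 y₀, le_max_left _ _, fun y hy ↦ h y ((le_max_right _ _).trans hy)⟩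
  refine ⟨y₀, hy₀, fun f L x hx hf hL hLf hS ↦ ?_⟩
  have hbd : ∀ y, y₀ ≤ y → y ≤ x * y₀ → ρ / 2 * y ≤ (∑ k ∈ Icc 0 ⌊y⌋₊, f k) ∧
      (∑ k ∈ Icc 0 ⌊y⌋₊, f k) ≤ 2 * ρ * y := by
    intro y hy hyx
    have hy0 : 0 < y := by linarith
    have h1 := hS y (hy₀.trans hy) hyx
    have h2 : C * y ^ (1 - δ) ≤ ρ / 2 * y := by
      rw [sub_eq_add_neg, Real.rpow_add hy0, Real.rpow_one, mul_left_comm, mul_comm]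
      gcongr
      exact hy₀' y hy
    rw [abs_le] at h1
    constructor <;> nlinarith [h1.1, h1.2]
  set X := x * y₀ with hX
  have hX1 : 1 ≤ X := one_le_mul_of_one_le_of_one_le hx hy₀
  have hxX : x ≤ X := le_mul_of_one_le_right (by linarith) hy₀
  have hyX : y₀ ≤ X := le_mul_of_one_le_left (by linarith) hx
  have hT : dirichletAct L (fun z ↦ dirichletAct f (fun _ ↦ 1) z) X ≤
      2 * ρ * X * Real.log X := by
    rw [← dirichletAct_mul, hLf]
    calc dirichletAct (f.pmul ArithmeticFunction.log) (fun _ ↦ 1) X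
        ≤ ∑ k ∈ Icc 0 ⌊X⌋₊, f k * Real.log X := by
          refine sum_le_sum fun k hk ↦ ?_
          rw [pmul_apply, log_apply, mul_one]
          rcases Nat.eq_zero_or_pos k with rfl | hk0
          · simp
          · refine mul_le_mul_of_nonneg_left (Real.log_le_log (by exact_mod_cast hk0) ?_) (hf k)
            exact (Nat.le_floor_iff' hk0.ne').mp (mem_Icc.mp hk).2
      _ = (∑ k ∈ Icc 0 ⌊X⌋₊, f k) * Real.log X := by rw [sum_mul]
      _ ≤ _ := mul_le_mul_of_nonneg_right (hbd X hyX le_rfl).2 (Real.log_nonneg hX1)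
  have hlow : ρ / 2 * y₀ * ∑ l ∈ Icc 0 ⌊x⌋₊, L l * (x / l) ≤
      dirichletAct L (fun z ↦ dirichletAct f (fun _ ↦ 1) z) X := by
    rw [mul_sum, dirichletAct]
    refine (sum_le_sum fun l hl ↦ ?_).trans (sum_le_sum_of_subset_of_nonneg
      (Icc_subset_Icc_right (Nat.floor_le_floor hxX)) fun l _ _ ↦ mul_nonneg (hL l) ?_)
    · rcases Nat.eq_zero_or_pos l with rfl | hl0
      · simp
      have hl1 : (1 : ℝ) ≤ l := by exact_mod_cast hl0
      have hlx : (l : ℝ) ≤ x := (Nat.le_floor_iff' hl0.ne').mp (mem_Icc.mp hl).2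
      have hle : y₀ ≤ X / l := by
        rw [le_div_iff₀ (by linarith), hX, mul_comm]
        gcongr
      have := (hbd (X / l) hle (div_le_self (by linarith) hl1)).1
      calc ρ / 2 * y₀ * (L l * (x / l)) = L l * (ρ / 2 * (X / l)) := by rw [hX]; ring
        _ ≤ _ := by
          refine mul_le_mul_of_nonneg_left ?_ (hL l)
          simpa [dirichletAct] using this
    · exact sum_nonneg fun k _ ↦ mul_nonneg (hf k) zero_le_one
  have h := hlow.trans hT
  have hpos : 0 < ρ / 2 * y₀ := by positivity
  rw [← mul_le_mul_iff_right₀ hpos]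
  refine h.trans (le_of_eq ?_)
  rw [hX]; ring

/-- A Chebyshev upper bound, with an absolute constant, for Beurling-type generalized primes. -/
theorem exists_forall_sum_vonMangoldt_le {ρ δ C : ℝ} (hρ : 0 < ρ) (hδ : 0 < δ) (hδ1 : δ < 1)
    (hC : 0 ≤ C) : ∃ x₀ : ℝ, ∀ x, x₀ ≤ x → ∀ f g L : ArithmeticFunction ℝ,
      (∀ n, 0 ≤ f n) → (∀ n, 0 ≤ L n) → g * f = 1 → (∀ n, |g n| ≤ f n) →
      L * f = f.pmul ArithmeticFunction.log →
      (∀ t, 1 ≤ t → t ≤ x ^ 2 → |(∑ k ∈ Icc 0 ⌊t⌋₊, f k) - ρ * t| ≤ C * t ^ (1 - δ)) →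
      ∑ l ∈ Icc 0 ⌊x⌋₊, L l ≤ 8 * x := by
  obtain ⟨K, hK, hKbd⟩ := exists_abs_log_mul_dirichletAct_le hρ hδ hδ1 hC
  obtain ⟨y₀, hy₀, hM⟩ := exists_sum_vonMangoldt_div_le (C := C) hρ hδ
  set K' := K + K * ((ρ + C) * (1 + 1 / (δ / 2))) + 4 * Real.log y₀ with hK'
  obtain ⟨x₁, hx₁⟩ := Filter.eventually_atTop.mp
    (Real.tendsto_log_atTop.eventually_ge_atTop (8 * K + K' + 1))
  refine ⟨max x₁ y₀, fun x hx f g L hf hL hg hgf hLf hS ↦ ?_⟩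
  have hxl := hx₁ x ((le_max_left _ _).trans hx)
  have hxy : y₀ ≤ x := (le_max_right _ _).trans hx
  have hx1 : 1 ≤ x := hy₀.trans hxy
  have hx0 : 0 < x := by linarith
  have hxx : x ≤ x ^ 2 := by nlinarith
  have hxy2 : x * y₀ ≤ x ^ 2 := by nlinarith
  obtain ⟨c, hc, hcbd⟩ := hKbd f L x hLf hx1 fun t ht ht' ↦ hS t ht (ht'.trans hxx)
  have hMx := hM f L x hx1 hf hL hLf fun t ht ht' ↦ hS t ht (ht'.trans hxy2)
  rw [Real.log_mul (by linarith) (by linarith)] at hMx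
  have hTI := tatuzawa_iseki hg hLf (fun z ↦ dirichletAct L (fun _ ↦ 1) z - z - c) hx1
  have hFD : ∀ t, 1 ≤ t → t ≤ x → |∑ k ∈ Icc 0 ⌊t⌋₊, f k| ≤ (ρ + C) * t := by
    intro t ht htx
    have h1 := hS t ht (htx.trans hxx)
    have h2 : t ^ (1 - δ) ≤ t := by
      simpa using Real.rpow_le_rpow_of_exponent_le ht (by linarith : 1 - δ ≤ 1)
    have h3 : C * t ^ (1 - δ) ≤ C * t := by gcongr
    have h4 := hρ.le
    have h5 : 0 ≤ ρ * t := by positivity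
    rw [abs_le] at h1 ⊢
    constructor <;> nlinarith [h1.1, h1.2]
  have herr : |dirichletAct g (fun z ↦ Real.log z *
      dirichletAct f (fun z ↦ dirichletAct L (fun _ ↦ 1) z - z - c) z) x| ≤
      K * ((ρ + C) * (1 + 1 / (δ / 2))) * x := by
    have h1 := sum_mul_div_rpow_le f.map_zero (half_pos hδ) (by linarith) (by positivity) hx1 hFD
    calc _ ≤ ∑ m ∈ Icc 0 ⌊x⌋₊, f m * (K * (x / m) ^ (1 - δ / 2)) := by
          refine (abs_sum_le_sum_abs _ _).trans (sum_le_sum fun m hm ↦ ?_)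
          rcases Nat.eq_zero_or_pos m with rfl | hm0
          · simp
          have hm1 : (1 : ℝ) ≤ m := by exact_mod_cast hm0
          have hmx : (m : ℝ) ≤ x := (Nat.le_floor_iff' hm0.ne').mp (mem_Icc.mp hm).2
          rw [abs_mul]
          exact mul_le_mul (hgf m) (hcbd _ ((one_le_div (by linarith)).mpr hmx)
            (div_le_self hx0.le hm1)) (abs_nonneg _) (hf m)
      _ = K * ∑ m ∈ Icc 0 ⌊x⌋₊, f m * (x / m) ^ (1 - δ / 2) := by
          rw [mul_sum]; exact sum_congr rfl fun m _ ↦ by ring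
      _ ≤ _ := by rw [mul_assoc]; gcongr
  set ψ := ∑ l ∈ Icc 0 ⌊x⌋₊, L l with hψ
  have hψ0 : 0 ≤ ψ := sum_nonneg fun l _ ↦ hL l
  have hψ' : dirichletAct L (fun _ ↦ 1) x = ψ := by simp [dirichletAct, hψ]
  have hsum : -(∑ l ∈ Icc 0 ⌊x⌋₊, L l * (x / l)) - K * ψ ≤
      dirichletAct L (fun z ↦ dirichletAct L (fun _ ↦ 1) z - z - c) x := by
    rw [hψ, mul_sum, ← sum_neg_distrib, ← sum_sub_distrib, dirichletAct]
    refine sum_le_sum fun l _ ↦ ?_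
    have h1 : 0 ≤ dirichletAct L (fun _ ↦ 1) (x / l) :=
      sum_nonneg fun k _ ↦ mul_nonneg (hL k) zero_le_one
    have h2 := (le_abs_self c).trans hc
    nlinarith [hL l]
  rw [hTI, hψ'] at herr
  have h6 := (le_abs_self _).trans herr
  have hlog : 0 ≤ Real.log x := Real.log_nonneg hx1
  have hly : 0 ≤ Real.log y₀ := Real.log_nonneg hy₀
  have hcl : -(K * Real.log x) ≤ -c * Real.log x := by
    have := (le_abs_self c).trans hc
    nlinarith
  have hKx : K * Real.log x ≤ K * x := by
    gcongr
    exact (Real.log_le_sub_one_of_pos hx0).trans (by linarith)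
  have hfin : ψ * (Real.log x - K) ≤ 5 * x * Real.log x + K' * x := by
    rw [hK']
    nlinarith
  by_contra! hcon
  have hP : 0 ≤ (ρ + C) * (1 + 1 / (δ / 2)) := by positivity
  have hK'0 : 0 ≤ K' := by rw [hK']; positivity
  have h7 : 8 * x * (Real.log x - K) ≤ ψ * (Real.log x - K) := by
    gcongr
    linarith
  have h8 : x * (8 * K + K' + 1) ≤ x * Real.log x := by gcongr
  nlinarith

end Chebyshev

section EulerProduct

open ArithmeticFunction (mul_apply pmul_apply log_apply)

/-- The arithmetic function supported at `q`. -/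
noncomputable def deltaFun (q : ℕ) : ArithmeticFunction ℝ :=
  ⟨fun n ↦ if n = q ∧ n ≠ 0 then 1 else 0, by simp⟩

open Classical in
/-- The indicator function of the powers of `q`. -/
noncomputable def powersFun (q : ℕ) : ArithmeticFunction ℝ :=
  ⟨fun n ↦ if (∃ k, n = q ^ k) ∧ n ≠ 0 then 1 else 0, by simp⟩

theorem mul_deltaFun_apply (f : ArithmeticFunction ℝ) {q : ℕ} (hq : q ≠ 0) (n : ℕ) :
    (f * deltaFun q) n = if q ∣ n then f (n / q) else 0 := by
  rcases Nat.eq_zero_or_pos n with rfl | hn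
  · simp
  rw [mul_apply]
  split_ifs with h
  · obtain ⟨m, rfl⟩ := h
    rw [Nat.mul_div_cancel_left _ (Nat.pos_of_ne_zero hq), sum_eq_single (m, q)]
    · simp [deltaFun, hq]
    · rintro ⟨a, b⟩ h1 h2
      simp only [Nat.mem_divisorsAntidiagonal] at h1
      have : b ≠ q := by
        rintro rfl
        refine h2 ?_
        rw [Nat.eq_of_mul_eq_mul_right (Nat.pos_of_ne_zero hq) (h1.1.trans (mul_comm _ _))]
      simp [deltaFun, this]
    · intro h
      exact absurd (Nat.mem_divisorsAntidiagonal.mpr ⟨mul_comm _ _, hn.ne'⟩) h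
  · refine sum_eq_zero ?_
    rintro ⟨a, b⟩ h1
    simp only [Nat.mem_divisorsAntidiagonal] at h1
    have : b ≠ q := by
      rintro rfl
      exact h ⟨a, by rw [← h1.1, mul_comm]⟩
    simp [deltaFun, this]

theorem powersFun_mul_one_sub_deltaFun {q : ℕ} (hq : 2 ≤ q) :
    powersFun q * (1 - deltaFun q) = 1 := by
  ext n
  rw [mul_sub, mul_one, sub_eq_add_neg, ArithmeticFunction.add_apply, ArithmeticFunction.neg_apply,
    ← sub_eq_add_neg, mul_deltaFun_apply _ (by omega)]
  rcases Nat.eq_zero_or_pos n with rfl | hn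
  · simp
  rcases eq_or_ne n 1 with rfl | hn1
  · have h1 : ∃ k, 1 = q ^ k := ⟨0, by simp⟩
    have h2 : ¬ q ∣ 1 := fun h ↦ by have := Nat.le_of_dvd one_pos h; omega
    simp [powersFun, h1, h2]
  rw [ArithmeticFunction.one_apply_ne hn1, sub_eq_zero]
  by_cases hd : q ∣ n
  · rw [if_pos hd]
    obtain ⟨m, rfl⟩ := hd
    rw [Nat.mul_div_cancel_left _ (by omega)]
    have hm : m ≠ 0 := by rintro rfl; simp at hn
    have : (∃ k, q * m = q ^ k) ↔ ∃ k, m = q ^ k := by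
      constructor
      · rintro ⟨k, hk⟩
        rcases k with - | k
        · exact absurd (by simpa using hk) hn1
        · exact ⟨k, Nat.eq_of_mul_eq_mul_left (by omega) (hk.trans (pow_succ' q k))⟩
      · rintro ⟨k, rfl⟩
        exact ⟨k + 1, (pow_succ' q k).symm⟩
    have hiff : ((∃ k, q * m = q ^ k) ∧ q * m ≠ 0) ↔ ((∃ k, m = q ^ k) ∧ m ≠ 0) := by
      rw [this]
      exact and_congr_right fun _ ↦ ⟨fun _ ↦ hm, fun _ ↦ hn.ne'⟩
    simp only [powersFun, ArithmeticFunction.coe_mk]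
    by_cases h : (∃ k, m = q ^ k) ∧ m ≠ 0
    · rw [if_pos h, if_pos (hiff.mpr h)]
    · rw [if_neg h, if_neg (mt hiff.mp h)]
  · rw [if_neg hd]
    have : ¬ ∃ k, n = q ^ k := by
      rintro ⟨k, rfl⟩
      rcases k with - | k
      · simp at hn1
      · exact hd ⟨q ^ k, pow_succ' q k⟩
    simp [powersFun, this]

theorem pmul_log_mul (f g : ArithmeticFunction ℝ) :
    (f * g).pmul ArithmeticFunction.log =
      f.pmul ArithmeticFunction.log * g + f * g.pmul ArithmeticFunction.log := by
  ext n
  rw [ArithmeticFunction.add_apply, pmul_apply, log_apply, mul_apply, mul_apply, mul_apply, sum_mul,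
    ← sum_add_distrib]
  refine sum_congr rfl ?_
  rintro ⟨a, b⟩ h
  rw [Nat.mem_divisorsAntidiagonal] at h
  obtain ⟨rfl, h⟩ := h
  simp only [pmul_apply, log_apply]
  rw [Nat.cast_mul, Real.log_mul (by rintro h0; simp_all) (by rintro h0; simp_all)]
  ring

theorem log_powersFun {q : ℕ} (hq : 2 ≤ q) :
    (Real.log q • (powersFun q - 1)) * powersFun q =
      (powersFun q).pmul ArithmeticFunction.log := by
  set e := powersFun q
  have hD : (deltaFun q).pmul ArithmeticFunction.log = Real.log q • deltaFun q := by
    ext n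
    rw [pmul_apply, log_apply, ArithmeticFunction.smul_map]
    by_cases h : n = q
    · subst h; simp [mul_comm]
    · simp [deltaFun, h]
  have h1 := powersFun_mul_one_sub_deltaFun hq
  have h2 : e * deltaFun q = e - 1 := by
    rw [← h1]; ring
  have hone : (1 : ArithmeticFunction ℝ).pmul ArithmeticFunction.log = 0 := by
    ext n
    rw [pmul_apply, log_apply]
    by_cases h : n = 1
    · subst h; simp
    · simp [ArithmeticFunction.one_apply_ne h]
  have h3 : e.pmul ArithmeticFunction.log * (1 - deltaFun q) = Real.log q • (e * deltaFun q) := by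
    have h4 := congrArg (fun z ↦ ArithmeticFunction.pmul z ArithmeticFunction.log) h2
    simp only [pmul_log_mul, hD] at h4
    have h5 : (e - 1).pmul ArithmeticFunction.log = e.pmul ArithmeticFunction.log := by
      ext n
      have := congrArg (fun z : ArithmeticFunction ℝ ↦ z n) hone
      simp only [pmul_apply, log_apply, ArithmeticFunction.zero_apply] at this
      rw [sub_eq_add_neg]
      simp only [pmul_apply, ArithmeticFunction.add_apply, ArithmeticFunction.neg_apply, log_apply]
      linarith
    rw [h5, mul_smul_comm] at h4
    rw [mul_sub, mul_one, sub_eq_iff_eq_add']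
    exact h4.symm
  calc (Real.log q • (e - 1)) * e = (Real.log q • (e * deltaFun q)) * e := by rw [h2]
    _ = e.pmul ArithmeticFunction.log * (e * (1 - deltaFun q)) := by rw [← h3]; ring
    _ = _ := by rw [h1, mul_one]

/-- Inverse and von Mangoldt function of a finite Euler product. -/
theorem exists_inverse_vonMangoldt_of_prod {ι : Type*} (S : Finset ι) {N : ι → ℕ}
    (hN : ∀ i ∈ S, 2 ≤ N i) :
    ∃ g L : ArithmeticFunction ℝ,
      (∀ n, 0 ≤ (∏ i ∈ S, powersFun (N i)) n) ∧ (∀ n, 0 ≤ L n) ∧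
      g * ∏ i ∈ S, powersFun (N i) = 1 ∧ (∀ n, |g n| ≤ (∏ i ∈ S, powersFun (N i)) n) ∧
      L * (∏ i ∈ S, powersFun (N i)) = (∏ i ∈ S, powersFun (N i)).pmul ArithmeticFunction.log ∧
      L 1 = 0 ∧ (∏ i ∈ S, powersFun (N i)) 1 = 1 := by
  classical
  induction S using Finset.induction_on with
  | empty =>
    refine ⟨1, 0, fun n ↦ ?_, by simp, by simp, fun n ↦ ?_, ?_, by simp, by simp⟩
    · rw [prod_empty, ArithmeticFunction.one_apply]; split_ifs <;> simp
    · rw [prod_empty, ArithmeticFunction.one_apply]; split_ifs <;> simp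
    · ext n
      rw [prod_empty, zero_mul, pmul_apply, ArithmeticFunction.one_apply, log_apply]
      split_ifs with h <;> simp [h]
  | insert i S hi ih =>
    obtain ⟨g, L, hf, hL, hg, hgf, hLf, hL1, hf1⟩ := ih fun j hj ↦ hN j (mem_insert_of_mem hj)
    have hq := hN i (mem_insert_self _ _)
    simp only [prod_insert hi]
    set f := ∏ i ∈ S, powersFun (N i)
    set e := powersFun (N i) with he
    have he0 : ∀ n, 0 ≤ e n := fun n ↦ by
      simp only [he, powersFun, ArithmeticFunction.coe_mk]
      split_ifs <;> norm_num
    have he1 : e 1 = 1 := by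
      have : ∃ k, 1 = N i ^ k := ⟨0, by simp⟩
      simp [he, powersFun, this]
    have hd : ∀ n, |(1 - deltaFun (N i)) n| ≤ e n := by
      intro n
      have hsub : (1 - deltaFun (N i)) n = (1 : ArithmeticFunction ℝ) n - deltaFun (N i) n := by
        rw [sub_eq_add_neg]; simp [sub_eq_add_neg]
      rw [hsub]
      rcases eq_or_ne n 1 with rfl | h1
      · have : 1 ≠ N i := by omega
        simp [he1, deltaFun, this]
      · rw [ArithmeticFunction.one_apply_ne h1, zero_sub, abs_neg]
        by_cases h2 : n = N i
        · have : ∃ k, n = N i ^ k := ⟨1, by simp [h2]⟩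
          have h3 : n ≠ 0 := by omega
          simp only [he, powersFun, deltaFun, ArithmeticFunction.coe_mk]
          rw [if_pos ⟨h2, h3⟩, if_pos ⟨this, h3⟩, abs_one]
        · simp only [deltaFun, ArithmeticFunction.coe_mk, h2, false_and, if_false, abs_zero]
          exact he0 n
    refine ⟨g * (1 - deltaFun (N i)), L + Real.log (N i) • (e - 1), fun n ↦ ?_, fun n ↦ ?_, ?_,
      fun n ↦ ?_, ?_, ?_, ?_⟩
    · rw [mul_apply]
      exact sum_nonneg fun x _ ↦ mul_nonneg (he0 _) (hf _)
    · rw [ArithmeticFunction.add_apply, ArithmeticFunction.smul_map, sub_eq_add_neg,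
        ArithmeticFunction.add_apply, ArithmeticFunction.neg_apply, smul_eq_mul]
      refine add_nonneg (hL n) (mul_nonneg (Real.log_natCast_nonneg _) ?_)
      rcases eq_or_ne n 1 with rfl | h1
      · simp [he1]
      · rw [ArithmeticFunction.one_apply_ne h1]; linarith [he0 n]
    · calc g * (1 - deltaFun (N i)) * (e * f) = (g * f) * (e * (1 - deltaFun (N i))) := by ring
        _ = 1 := by rw [hg, powersFun_mul_one_sub_deltaFun hq, mul_one]
    · rw [mul_comm e f, mul_apply, mul_apply]
      refine (abs_sum_le_sum_abs _ _).trans (sum_le_sum fun x _ ↦ ?_)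
      rw [abs_mul]
      exact mul_le_mul (hgf _) (hd _) (abs_nonneg _) (hf _)
    · rw [pmul_log_mul, ← log_powersFun hq, ← hLf]
      ring
    · rw [ArithmeticFunction.add_apply, ArithmeticFunction.smul_map, sub_eq_add_neg,
        ArithmeticFunction.add_apply, ArithmeticFunction.neg_apply, hL1, he1]
      simp
    · simp [mul_apply, he1, hf1]

end EulerProduct

section IdealCount

open NumberField Ideal

variable (F : Type*) [Field F] [NumberField F]

/-- The number of integral ideals of norm `n` all of whose prime divisors satisfy `p`. -/
noncomputable def idealCountOn (p : Ideal (𝓞 F) → Prop) : ArithmeticFunction ℝ :=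
  ⟨fun n ↦ if n = 0 then 0 else
    ({I : Ideal (𝓞 F) | absNorm I = n ∧ ∀ P, Prime P → P ∣ I → p P}.ncard : ℝ), by simp⟩

variable {F}

theorem idealCountOn_mul_one_sub_deltaFun {p p' : Ideal (𝓞 F) → Prop} {P : Ideal (𝓞 F)}
    (hP : Prime P) (hpP : ¬ p P) (hp' : ∀ Q, p' Q ↔ Q = P ∨ p Q) :
    idealCountOn F p' * (1 - deltaFun (absNorm P)) = idealCountOn F p := by
  have hP0 : absNorm P ≠ 0 := absNorm_eq_zero_iff.not.mpr hP.ne_zero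
  ext n
  rw [mul_sub, mul_one, sub_eq_add_neg, ArithmeticFunction.add_apply, ArithmeticFunction.neg_apply,
    ← sub_eq_add_neg, mul_deltaFun_apply _ hP0]
  rcases Nat.eq_zero_or_pos n with rfl | hn
  · simp
  have hfin : {I : Ideal (𝓞 F) | absNorm I = n ∧ ∀ Q, Prime Q → Q ∣ I → p' Q}.Finite :=
    (finite_setOfPred_absNorm_eq n).subset fun I hI ↦ hI.1
  have hsplit : {I : Ideal (𝓞 F) | absNorm I = n ∧ ∀ Q, Prime Q → Q ∣ I → p' Q} =
      {I : Ideal (𝓞 F) | absNorm I = n ∧ ∀ Q, Prime Q → Q ∣ I → p Q} ∪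
      {I : Ideal (𝓞 F) | P ∣ I ∧ absNorm I = n ∧ ∀ Q, Prime Q → Q ∣ I → p' Q} := by
    ext I
    simp only [Set.mem_ofPred_eq, Set.mem_union]
    constructor
    · rintro ⟨h1, h2⟩
      by_cases h : P ∣ I
      · exact Or.inr ⟨h, h1, h2⟩
      · refine Or.inl ⟨h1, fun Q hQ hQI ↦ ((hp' Q).mp (h2 Q hQ hQI)).resolve_left ?_⟩
        rintro rfl
        exact h hQI
    · rintro (⟨h1, h2⟩ | ⟨-, h1, h2⟩)
      · exact ⟨h1, fun Q hQ hQI ↦ (hp' Q).mpr (Or.inr (h2 Q hQ hQI))⟩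
      · exact ⟨h1, h2⟩
  have hdisj : Disjoint {I : Ideal (𝓞 F) | absNorm I = n ∧ ∀ Q, Prime Q → Q ∣ I → p Q}
      {I : Ideal (𝓞 F) | P ∣ I ∧ absNorm I = n ∧ ∀ Q, Prime Q → Q ∣ I → p' Q} := by
    rw [Set.disjoint_left]
    rintro I ⟨-, h1⟩ ⟨h2, -⟩
    exact hpP (h1 P hP h2)
  have hcard := Set.ncard_union_eq hdisj (hfin.subset (hsplit ▸ Set.subset_union_left))
    (hfin.subset (hsplit ▸ Set.subset_union_right))
  rw [← hsplit] at hcard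
  have hdvd : (if absNorm P ∣ n then idealCountOn F p' (n / absNorm P) else 0) =
      ({I : Ideal (𝓞 F) | P ∣ I ∧ absNorm I = n ∧ ∀ Q, Prime Q → Q ∣ I → p' Q}.ncard : ℝ) := by
    split_ifs with h
    · obtain ⟨m, rfl⟩ := h
      have hm : m ≠ 0 := by rintro rfl; simp at hn
      rw [Nat.mul_div_cancel_left _ (Nat.pos_of_ne_zero hP0)]
      simp only [idealCountOn, ArithmeticFunction.coe_mk, if_neg hm]
      rw [← Set.ncard_image_of_injective _ (mul_right_injective₀ hP.ne_zero)]
      congr 2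
      ext I
      simp only [Set.mem_image, Set.mem_ofPred_eq]
      constructor
      · rintro ⟨J, ⟨h1, h2⟩, rfl⟩
        refine ⟨dvd_mul_right _ _, by rw [map_mul, h1], fun Q hQ hQI ↦ ?_⟩
        rcases hQ.dvd_or_dvd hQI with h | h
        · rw [hp']
          left
          exact associated_iff_eq.mp (hQ.associated_of_dvd hP h)
        · exact h2 Q hQ h
      · rintro ⟨⟨J, rfl⟩, h1, h2⟩
        rw [map_mul] at h1
        exact ⟨J, ⟨Nat.eq_of_mul_eq_mul_left (Nat.pos_of_ne_zero hP0) h1,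
          fun Q hQ hQJ ↦ h2 Q hQ (hQJ.mul_left P)⟩, rfl⟩
    · rw [eq_comm, Nat.cast_eq_zero, Set.ncard_eq_zero (hfin.subset (hsplit ▸
        Set.subset_union_right)), Set.eq_empty_iff_forall_notMem]
      rintro I ⟨h1, rfl, -⟩
      exact h (map_dvd absNorm h1)
  rw [hdvd, sub_eq_iff_eq_add]
  simp only [idealCountOn, ArithmeticFunction.coe_mk, if_neg hn.ne']
  exact_mod_cast hcard

theorem two_le_absNorm_of_prime {P : Ideal (𝓞 F)} (hP : Prime P) : 2 ≤ absNorm P := by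
  have h0 : absNorm P ≠ 0 := absNorm_eq_zero_iff.not.mpr hP.ne_zero
  have h1 : absNorm P ≠ 1 := fun h ↦ hP.not_isUnit (isUnit_iff.mpr (absNorm_eq_one_iff.mp h))
  omega

theorem idealCountOn_eq_prod (S : Finset (Ideal (𝓞 F))) (hS : ∀ P ∈ S, Prime P) :
    idealCountOn F (· ∈ S) = ∏ P ∈ S, powersFun (absNorm P) := by
  classical
  induction S using Finset.induction_on with
  | empty =>
    ext n
    rw [prod_empty, ArithmeticFunction.one_apply]
    rcases Nat.eq_zero_or_pos n with rfl | hn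
    · simp
    simp only [idealCountOn, ArithmeticFunction.coe_mk, if_neg hn.ne', notMem_empty]
    have hone : ∀ I : Ideal (𝓞 F), absNorm I = n → (∀ P, Prime P → P ∣ I → False) → I = ⊤ := by
      intro I h1 h2
      by_contra hI
      have hI0 : I ≠ 0 := by
        rintro rfl
        rw [map_zero] at h1
        omega
      obtain ⟨P, hP, hPI⟩ := WfDvdMonoid.exists_irreducible_factor (mt isUnit_iff.mp hI) hI0
      exact h2 P hP.prime hPI
    split_ifs with h
    · subst h
      rw [Nat.cast_eq_one, Set.ncard_eq_one]
      refine ⟨⊤, Set.eq_singleton_iff_unique_mem.mpr ⟨⟨absNorm_top, fun P hP hPI ↦ ?_⟩,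
        fun I hI ↦ hone I hI.1 hI.2⟩⟩
      exact hP.not_isUnit (isUnit_of_dvd_unit hPI (isUnit_iff.mpr rfl))
    · rw [Nat.cast_eq_zero]
      rw [Set.ncard_eq_zero ((finite_setOfPred_absNorm_eq n).subset fun I hI ↦ hI.1),
        Set.eq_empty_iff_forall_notMem]
      rintro I ⟨h1, h2⟩
      rw [hone I h1 h2, absNorm_top] at h1
      exact h h1.symm
  | insert P S hPS ih =>
    have hP := hS P (mem_insert_self _ _)
    have h1 := idealCountOn_mul_one_sub_deltaFun (p := (· ∈ S)) (p' := (· ∈ insert P S)) hP hPS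
      fun Q ↦ mem_insert
    rw [prod_insert hPS, ← ih fun Q hQ ↦ hS Q (mem_insert_of_mem hQ), ← h1, mul_comm, mul_assoc,
      mul_comm _ (powersFun _), powersFun_mul_one_sub_deltaFun (two_le_absNorm_of_prime hP),
      mul_one]

/-- The Chebyshev upper bound for number fields with an absolute constant, deduced from a power
saving count of ideals. -/
theorem exists_sum_idealCount_log_le {ρ δ C : ℝ} (hρ : 0 < ρ) (hδ : 0 < δ) (hδ1 : δ < 1)
    (hC : 0 ≤ C) (h : ∀ t, 1 ≤ t →
      |(∑ k ∈ Icc 0 ⌊t⌋₊, idealCountOn F (fun _ ↦ True) k) - ρ * t| ≤ C * t ^ (1 - δ)) :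
    ∃ x₀ : ℝ, ∀ x, x₀ ≤ x → ∑ q ∈ Icc 0 ⌊x⌋₊ with q.Prime,
      idealCountOn F (fun _ ↦ True) q * Real.log q ≤ 8 * x := by
  obtain ⟨x₀, hx₀⟩ := exists_forall_sum_vonMangoldt_le hρ hδ hδ1 hC
  refine ⟨max x₀ 1, fun x hx ↦ ?_⟩
  have hx1 : 1 ≤ x := (le_max_right _ _).trans hx
  have hfin : {P : Ideal (𝓞 F) | Prime P ∧ absNorm P ≤ ⌊x ^ 2⌋₊}.Finite :=
    (finite_setOfPred_absNorm_le ⌊x ^ 2⌋₊).subset fun P hP ↦ hP.2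
  set S := hfin.toFinset with hSdef
  have hSP : ∀ P ∈ S, Prime P := fun P hP ↦ (hfin.mem_toFinset.mp hP).1
  obtain ⟨g, L, hf, hL, hg, hgf, hLf, hL1, hf1⟩ := exists_inverse_vonMangoldt_of_prod S
    (N := fun P ↦ absNorm P) fun P hP ↦ two_le_absNorm_of_prime (hSP P hP)
  rw [← idealCountOn_eq_prod S hSP] at hf hg hgf hLf hf1
  have heq : ∀ n ≤ ⌊x ^ 2⌋₊, idealCountOn F (fun _ ↦ True) n = idealCountOn F (· ∈ S) n := by
    intro n hn
    simp only [idealCountOn, ArithmeticFunction.coe_mk]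
    rcases Nat.eq_zero_or_pos n with rfl | hn0
    · simp
    rw [if_neg hn0.ne', if_neg hn0.ne']
    congr 2
    ext I
    simp only [Set.mem_ofPred_eq, implies_true, and_true]
    refine ⟨fun h1 ↦ ⟨h1, fun P hP hPI ↦ hfin.mem_toFinset.mpr ⟨hP, ?_⟩⟩, fun h1 ↦ h1.1⟩
    have := map_dvd absNorm hPI
    rw [h1] at this
    exact (Nat.le_of_dvd hn0 this).trans hn
  have hbound := hx₀ x ((le_max_left _ _).trans hx) _ g L hf hL hg hgf hLf fun t ht htx ↦ by
    rw [← sum_congr rfl fun k hk ↦ heq k ((mem_Icc.mp hk).2.trans (Nat.floor_le_floor htx))]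
    exact h t ht
  refine le_trans ?_ hbound
  refine (sum_le_sum fun q hq ↦ ?_).trans (sum_le_sum_of_subset_of_nonneg (filter_subset _ _)
    fun q _ _ ↦ hL q)
  rw [mem_filter, mem_Icc] at hq
  have hqp : q.Prime := hq.2
  have hle : ⌊x⌋₊ ≤ ⌊x ^ 2⌋₊ := Nat.floor_le_floor (by nlinarith)
  rw [heq q (hq.1.2.trans hle)]
  have h2 := congrArg (fun z : ArithmeticFunction ℝ ↦ z q) hLf
  simp only [ArithmeticFunction.mul_apply, ArithmeticFunction.pmul_apply,
    ArithmeticFunction.log_apply] at h2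
  rw [Nat.sum_divisorsAntidiagonal (fun a b ↦ L a * idealCountOn F (· ∈ S) b),
    Nat.Prime.sum_divisors hqp, hL1, zero_mul, add_zero, Nat.div_self hqp.pos, hf1, mul_one] at h2
  exact h2.ge

end IdealCount

end

section
open MeasureTheory Module Metric
open scoped Pointwise

theorem exists_abs_tsum_lattice_sub_le {E : Type*} [NormedAddCommGroup E] [NormedSpace ℝ E]
    [FiniteDimensional ℝ E] [MeasurableSpace E] [BorelSpace E] (L : Submodule ℤ E)
    [DiscreteTopology L] [IsZLattice ℝ L] {R : ℝ} (hR : 0 ≤ R) :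
    ∃ C : ℝ, 0 ≤ C ∧ ∀ (κ : ℝ) (h : E → ℝ), 0 ≤ κ → (∀ x y, |h x - h y| ≤ κ * ‖x - y‖) →
      (∀ x, R < ‖x‖ → h x = 0) → ∃ I : ℝ, ∀ t : ℝ, 1 ≤ t →
        |∑' l : L, h (t⁻¹ • (l : E)) - I * t ^ finrank ℝ E| ≤ C * κ * (t ^ finrank ℝ E / t) := by
  classical
  set d := finrank ℝ E with hd
  set μ : Measure E := Measure.addHaar
  have : VAddInvariantMeasure L E μ :=
    inferInstanceAs (VAddInvariantMeasure L.toAddSubgroup E μ)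
  let b := Free.chooseBasis ℤ L
  set D := ZSpan.fundamentalDomain (b.ofZLatticeBasis ℝ L) with hD
  have hFD : IsAddFundamentalDomain L D μ := ZLattice.isAddFundamentalDomain b μ
  have hDb : Bornology.IsBounded D := ZSpan.fundamentalDomain_isBounded _
  obtain ⟨ρ, hρ0, hρ⟩ : ∃ ρ : ℝ, 0 ≤ ρ ∧ ∀ y ∈ D, ‖y‖ ≤ ρ := by
    obtain ⟨ρ, hρ⟩ := hDb.subset_closedBall 0
    exact ⟨max ρ 0, le_max_right _ _, fun y hy ↦ (by simpa using hρ hy : ‖y‖ ≤ ρ).trans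
      (le_max_left _ _)⟩
  have hDfin : μ D ≠ ⊤ := hDb.measure_lt_top.ne
  have hDpos : μ D ≠ 0 := hFD.measure_ne_zero (NeZero.ne μ)
  have hDm : MeasurableSet D := ZSpan.fundamentalDomain_measurableSet _
  set V := μ.real D with hV
  have hVpos : 0 < V := ENNReal.toReal_pos hDpos hDfin
  set B := μ.real (closedBall (0 : E) 1)
  have hLfin (r : ℝ) : {l : L | ‖(l : E)‖ ≤ r}.Finite := by
    have h1 : ((L : Set E) ∩ closedBall 0 r).Finite := by
      rw [Set.inter_comm]
      exact Metric.finite_isBounded_inter_isClosed (s := (L : Set E)) ⟨‹_›⟩ isBounded_closedBall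
        (inferInstanceAs (IsClosed ((L.toAddSubgroup : AddSubgroup E) : Set E)))
    refine (h1.preimage (f := ((↑) : L → E)) Subtype.val_injective.injOn).subset fun l hl ↦ ?_
    exact ⟨l.2, by simpa using hl⟩
  have hcount (t : ℝ) (ht : 1 ≤ t) : ((hLfin (t * R + ρ)).toFinset.card : ℝ) * V ≤
      t ^ d * ((R + 2 * ρ) ^ d * B) := by
    set T := (hLfin (t * R + ρ)).toFinset
    have h0 : 0 ≤ t * R + 2 * ρ := by positivity
    have h1 : (T.card : ENNReal) * μ D ≤ μ (closedBall 0 (t * R + 2 * ρ)) := by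
      rw [hFD.measure_eq_tsum (closedBall _ _)]
      calc (T.card : ENNReal) * μ D = ∑ l ∈ T, μ D := by simp
        _ ≤ ∑ l ∈ T.image (fun l ↦ -l), μ ((l +ᵥ closedBall (0 : E) (t * R + 2 * ρ)) ∩ D) := by
          rw [Finset.sum_image (by simp)]
          refine Finset.sum_le_sum fun l hl ↦ measure_mono fun y hy ↦ ⟨?_, hy⟩
          rw [Set.mem_vadd_set_iff_neg_vadd_mem, neg_neg]
          have hl' : ‖(l : E)‖ ≤ t * R + ρ := by simpa [T] using hl
          rw [mem_closedBall_zero_iff]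
          change ‖(l : E) + y‖ ≤ _
          have := norm_add_le (l : E) y
          have := hρ y hy
          linarith
        _ ≤ _ := ENNReal.sum_le_tsum _
    have h2 : (T.card : ℝ) * V ≤ μ.real (closedBall 0 (t * R + 2 * ρ)) := by
      have := ENNReal.toReal_mono (isBounded_closedBall.measure_lt_top.ne) h1
      simpa [ENNReal.toReal_mul, hV, Measure.real] using this
    rw [Measure.addHaar_real_closedBall' μ _ h0] at h2
    refine h2.trans ?_
    rw [← mul_assoc, ← mul_pow]
    have : 0 ≤ B := measureReal_nonneg
    gcongr
    nlinarith
  refine ⟨ρ * ((R + 2 * ρ) ^ d * B) / V, by positivity, fun κ h hκ hlip hsupp ↦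
    ⟨(∫ x, h x ∂μ) / V, fun t ht ↦ ?_⟩⟩
  have ht0 : 0 < t := by linarith
  have hcont : Continuous h := by
    refine (LipschitzWith.of_dist_le_mul (K := ⟨κ, hκ⟩) fun x y ↦ ?_).continuous
    rw [Real.dist_eq, dist_eq_norm]
    exact hlip x y
  have hcs : HasCompactSupport h :=
    HasCompactSupport.of_support_subset_isCompact (isCompact_closedBall 0 R) fun x hx ↦ by
      rw [mem_closedBall_zero_iff]
      by_contra hc
      exact hx (hsupp x (not_le.mp hc))
  set f : E → ℝ := fun x ↦ h (t⁻¹ • x) with hf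
  have hfcont : Continuous f := by fun_prop
  have hfint : Integrable f μ := (hcont.integrable_of_hasCompactSupport hcs).comp_smul
    (inv_ne_zero ht0.ne')
  set T := (hLfin (t * R + ρ)).toFinset with hT
  have hz (l : L) (hl : l ∉ T) (y : E) (hy : ‖y‖ ≤ ρ) : f (l + y) = 0 := by
    apply hsupp
    have hl' : t * R + ρ < ‖(l : E)‖ := by simpa [hT] using hl
    rw [norm_smul, norm_inv, Real.norm_of_nonneg ht0.le, lt_inv_mul_iff₀ ht0]
    have : ‖(l : E)‖ ≤ ‖(l : E) + y‖ + ‖y‖ := by simpa using norm_sub_le ((l : E) + y) y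
    linarith
  have hsum : ∑' l : L, h (t⁻¹ • (l : E)) = ∑ l ∈ T, f l := by
    refine tsum_eq_sum fun l hl ↦ ?_
    simpa using hz l hl 0 (by simpa using hρ0)
  have hint : t ^ d * ∫ x, h x ∂μ = ∑ l ∈ T, ∫ y in D, f (l + y) ∂μ := by
    have h1 := hFD.integral_eq_tsum'' f hfint
    have h2 : ∫ x, f x ∂μ = t ^ d * ∫ x, h x ∂μ := by
      rw [Measure.integral_comp_inv_smul_of_nonneg μ h ht0.le, smul_eq_mul]
    rw [← h2, h1]
    refine tsum_eq_sum fun l hl ↦ ?_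
    refine (setIntegral_congr_fun hDm fun y hy ↦ hz l hl y (hρ y hy)).trans (by simp)
  have key (l : L) : |f l * V - ∫ y in D, f (l + y) ∂μ| ≤ κ * (t⁻¹ * ρ) * V := by
    have h1 : f l * V = ∫ y in D, f l ∂μ := by
      rw [setIntegral_const, smul_eq_mul, mul_comm]
    have hi : IntegrableOn (fun y ↦ f (l + y)) D μ := (hfint.comp_add_left (l : E)).integrableOn
    have hc : IntegrableOn (fun _ ↦ f l) D μ := integrableOn_const hDfin
    rw [h1, ← integral_sub hc hi, ← Real.norm_eq_abs]
    refine norm_setIntegral_le_of_norm_le_const hDfin.lt_top fun y hy ↦ ?_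
    refine (hlip _ _).trans ?_
    gcongr
    rw [← smul_sub, norm_smul, norm_inv, Real.norm_of_nonneg ht0.le]
    gcongr
    simpa using hρ y hy
  have hmain : |(∑' l : L, h (t⁻¹ • (l : E))) * V - t ^ d * ∫ x, h x ∂μ| ≤
      T.card * (κ * (t⁻¹ * ρ) * V) := by
    rw [hsum, hint, Finset.sum_mul, ← Finset.sum_sub_distrib]
    refine (Finset.abs_sum_le_sum_abs _ _).trans ?_
    exact (Finset.sum_le_sum fun l _ ↦ key l).trans (by simp)
  have h3 : ∑' l : L, h (t⁻¹ • (l : E)) - (∫ x, h x ∂μ) / V * t ^ d =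
      ((∑' l : L, h (t⁻¹ • (l : E))) * V - t ^ d * ∫ x, h x ∂μ) / V := by
    field_simp
  rw [h3, abs_div, abs_of_pos hVpos, div_le_iff₀ hVpos]
  refine hmain.trans ?_
  calc (T.card : ℝ) * (κ * (t⁻¹ * ρ) * V) = (T.card * V) * (κ * (t⁻¹ * ρ)) := by ring
    _ ≤ (t ^ d * ((R + 2 * ρ) ^ d * B)) * (κ * (t⁻¹ * ρ)) := by
      exact mul_le_mul_of_nonneg_right (hcount t ht) (by positivity)
    _ = _ := by field_simp

end

section
open Filter Topology

/-- The trapezoid of height one supported on `[a, b]` with sides of slope `η⁻¹`. -/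
noncomputable def trapezoid (a b η u : ℝ) : ℝ := max 0 (min 1 (min ((u - a) / η) ((b - u) / η)))

theorem trapezoid_nonneg (a b η u : ℝ) : 0 ≤ trapezoid a b η u := le_max_left _ _

theorem trapezoid_le_one (a b η u : ℝ) : trapezoid a b η u ≤ 1 :=
  max_le zero_le_one (min_le_left _ _)

theorem trapezoid_ne_zero {a b η u : ℝ} (hη : 0 < η) (h : trapezoid a b η u ≠ 0) :
    a < u ∧ u < b := by
  have h1 : 0 < trapezoid a b η u := lt_of_le_of_ne (trapezoid_nonneg _ _ _ _) h.symm
  have h2 := (lt_max_iff.mp h1).resolve_left (lt_irrefl _)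
  rw [lt_min_iff, lt_min_iff, lt_div_iff₀ hη, lt_div_iff₀ hη] at h2
  constructor <;> linarith [h2.2.1, h2.2.2]

theorem trapezoid_eq_one {a b η u : ℝ} (hη : 0 < η) (h1 : a + η ≤ u) (h2 : u ≤ b - η) :
    trapezoid a b η u = 1 := by
  refine le_antisymm (trapezoid_le_one _ _ _ _) (le_max_of_le_right ?_)
  refine le_min le_rfl (le_min ?_ ?_) <;> rw [le_div_iff₀ hη] <;> linarith

theorem abs_trapezoid_sub_le {a b η : ℝ} (hη : 0 < η) (u v : ℝ) :
    |trapezoid a b η u - trapezoid a b η v| ≤ η⁻¹ * |u - v| := by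
  have e1 : |(u - a) / η - (v - a) / η| = η⁻¹ * |u - v| := by
    rw [show (u - a) / η - (v - a) / η = η⁻¹ * (u - v) by field_simp; ring, abs_mul,
      abs_of_pos (inv_pos.mpr hη)]
  have e2 : |(b - u) / η - (b - v) / η| = η⁻¹ * |u - v| := by
    rw [show (b - u) / η - (b - v) / η = -(η⁻¹ * (u - v)) by field_simp; ring, abs_neg, abs_mul,
      abs_of_pos (inv_pos.mpr hη)]
  unfold trapezoid
  refine (abs_max_sub_max_le_max _ _ _ _).trans (max_le (by simp; positivity) ?_)
  refine (abs_min_sub_min_le_max _ _ _ _).trans (max_le (by simp; positivity) ?_)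
  exact (abs_min_sub_min_le_max _ _ _ _).trans (max_le e1.le e2.le)

section Counting

variable {X : Type*} {N : X → ℝ}

theorem card_le_sub_card_le (hfin : ∀ s, {β | N β ≤ s}.Finite) {s t : ℝ} (hst : s ≤ t) :
    ({β | s < N β ∧ N β ≤ t}.ncard : ℝ) = {β | N β ≤ t}.ncard - {β | N β ≤ s}.ncard := by
  have h : {β | s < N β ∧ N β ≤ t} = {β | N β ≤ t} \ {β | N β ≤ s} := by
    ext β; simp [and_comm]
  have hsub : {β | N β ≤ s} ⊆ {β | N β ≤ t} := fun β hβ ↦ le_trans (show N β ≤ s from hβ) hst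
  rw [h, Set.ncard_sdiff hsub (hfin s), Nat.cast_sub (Set.ncard_le_ncard hsub (hfin t))]

theorem log_sub_log_mem_iff (hN : ∀ β, 0 < N β) {s : ℝ} (hs : 0 < s) (a b : ℝ) (β : X) :
    (a < Real.log (N β) - Real.log s ∧ Real.log (N β) - Real.log s ≤ b) ↔
      (s * Real.exp a < N β ∧ N β ≤ s * Real.exp b) := by
  rw [← Real.log_div (hN β).ne' hs.ne', Real.lt_log_iff_exp_lt (div_pos (hN β) hs),
    Real.log_le_iff_le_exp (div_pos (hN β) hs), lt_div_iff₀ hs, div_le_iff₀ hs, mul_comm s,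
    mul_comm s]

theorem summable_log_sub_log (hN : ∀ β, 0 < N β) (hfin : ∀ s, {β | N β ≤ s}.Finite) {g : ℝ → ℝ}
    {a b : ℝ} (h : ∀ u, g u ≠ 0 → a < u ∧ u ≤ b) {s : ℝ} (hs : 0 < s) :
    Summable fun β ↦ g (Real.log (N β) - Real.log s) :=
  summable_of_hasFiniteSupport <| (hfin (s * Real.exp b)).subset fun β hβ ↦
    ((log_sub_log_mem_iff hN hs a b β).mp (h _ hβ)).2

theorem tsum_log_le (hN : ∀ β, 0 < N β) (hfin : ∀ s, {β | N β ≤ s}.Finite) {g : ℝ → ℝ}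
    {a b : ℝ} (hab : a ≤ b) (h1 : ∀ u, g u ≤ 1) (h : ∀ u, g u ≠ 0 → a < u ∧ u ≤ b)
    {s : ℝ} (hs : 0 < s) : ∑' β, g (Real.log (N β) - Real.log s) ≤
      {β | N β ≤ s * Real.exp b}.ncard - {β | N β ≤ s * Real.exp a}.ncard := by
  have hst : s * Real.exp a ≤ s * Real.exp b := by gcongr
  rw [← card_le_sub_card_le hfin hst]
  have hf : {β | s * Real.exp a < N β ∧ N β ≤ s * Real.exp b}.Finite :=
    (hfin (s * Real.exp b)).subset fun β hβ ↦ hβ.2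
  rw [tsum_eq_sum (s := hf.toFinset) fun β hβ ↦ ?_, Set.ncard_eq_toFinset_card _ hf]
  · exact (Finset.sum_le_sum fun β _ ↦ h1 _).trans (by simp)
  · by_contra hc
    exact hβ (hf.mem_toFinset.mpr ((log_sub_log_mem_iff hN hs a b β).mp (h _ hc)))

theorem le_tsum_log (hN : ∀ β, 0 < N β) (hfin : ∀ s, {β | N β ≤ s}.Finite) {g : ℝ → ℝ}
    {a b a' b' : ℝ} (hab : a ≤ b) (h0 : ∀ u, 0 ≤ g u) (h1 : ∀ u, a < u → u ≤ b → g u = 1)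
    (h : ∀ u, g u ≠ 0 → a' < u ∧ u ≤ b') {s : ℝ} (hs : 0 < s) :
    ({β | N β ≤ s * Real.exp b}.ncard - {β | N β ≤ s * Real.exp a}.ncard : ℝ) ≤
      ∑' β, g (Real.log (N β) - Real.log s) := by
  have hst : s * Real.exp a ≤ s * Real.exp b := by gcongr
  rw [← card_le_sub_card_le hfin hst]
  have hf : {β | s * Real.exp a < N β ∧ N β ≤ s * Real.exp b}.Finite :=
    (hfin (s * Real.exp b)).subset fun β hβ ↦ hβ.2
  rw [Set.ncard_eq_toFinset_card _ hf]
  refine le_trans (le_of_eq ?_) ((summable_log_sub_log hN hfin h hs).sum_le_tsum hf.toFinset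
    fun β _ ↦ h0 _)
  rw [Finset.sum_congr rfl fun β hβ ↦ h1 _ ((log_sub_log_mem_iff hN hs a b β).mpr
    (hf.mem_toFinset.mp hβ)).1 ((log_sub_log_mem_iff hN hs a b β).mpr (hf.mem_toFinset.mp hβ)).2]
  simp

theorem tendsto_card_sub_card_div {c : ℝ}
    (hlim : Tendsto (fun s : ℝ ↦ ({β | N β ≤ s}.ncard : ℝ) / s) atTop (𝓝 c)) (a b : ℝ) :
    Tendsto (fun s : ℝ ↦ (({β | N β ≤ s * Real.exp b}.ncard : ℝ) -
      {β | N β ≤ s * Real.exp a}.ncard) / s) atTop (𝓝 (c * (Real.exp b - Real.exp a))) := by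
  have key (a : ℝ) : Tendsto (fun s : ℝ ↦ ({β | N β ≤ s * Real.exp a}.ncard : ℝ) / s) atTop
      (𝓝 (c * Real.exp a)) := by
    have h1 : Tendsto (fun s : ℝ ↦ s * Real.exp a) atTop atTop :=
      tendsto_id.atTop_mul_const (Real.exp_pos a)
    refine ((hlim.comp h1).mul_const (Real.exp a)).congr fun s ↦ ?_
    have := (Real.exp_pos a).ne'
    simp only [Function.comp]
    field_simp
  simpa only [sub_div, mul_sub] using (key b).sub (key a)

theorem tendsto_div_of_abs_sub_le {F : ℝ → ℝ} {c E θ : ℝ} (hθ : 0 < θ)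
    (h : ∀ s : ℝ, 1 ≤ s → |F s - c * s| ≤ E * s ^ (1 - θ)) :
    Tendsto (fun s ↦ F s / s) atTop (𝓝 c) := by
  rw [tendsto_iff_norm_sub_tendsto_zero]
  have h0 : Tendsto (fun s : ℝ ↦ E * s ^ (-θ)) atTop (𝓝 0) := by
    simpa using (tendsto_rpow_neg_atTop hθ).const_mul E
  refine squeeze_zero' (.of_forall fun _ ↦ norm_nonneg _) ?_ h0
  filter_upwards [eventually_ge_atTop 1] with s hs
  have hs0 : 0 < s := by linarith
  rw [show F s / s - c = (F s - c * s) / s by field_simp, norm_div, Real.norm_eq_abs,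
    Real.norm_of_nonneg hs0.le, div_le_iff₀ hs0]
  refine (h s hs).trans (le_of_eq ?_)
  rw [mul_assoc, ← Real.rpow_add_one hs0.ne']
  ring_nf

/-- If smoothed dyadic counts have a power saving error term which is uniform in the smoothing,
then so does the sharp count. -/
theorem exists_abs_card_le_sub_le (hN : ∀ β, 0 < N β) (hfin : ∀ s, {β | N β ≤ s}.Finite)
    {c C θ : ℝ} (hθ : 0 < θ) (hθ1 : θ ≤ 1) (hC : 0 ≤ C)
    (hlim : Tendsto (fun s : ℝ ↦ ({β | N β ≤ s}.ncard : ℝ) / s) atTop (𝓝 c))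
    (H : ∀ (κ : ℝ) (g : ℝ → ℝ), 1 ≤ κ → (∀ u v, |g u - g v| ≤ κ * |u - v|) → (∀ u, 0 ≤ g u) →
      (∀ u, g u ≤ 1) → (∀ u, g u ≠ 0 → -2 ≤ u ∧ u ≤ 1) → ∃ c' : ℝ, ∀ s : ℝ, 1 ≤ s →
        |∑' β, g (Real.log (N β) - Real.log s) - c' * s| ≤ C * κ * s ^ (1 - θ)) :
    ∃ K : ℝ, 0 ≤ K ∧ ∀ s : ℝ, 1 ≤ s →
      |({β | N β ≤ s}.ncard : ℝ) - c * s| ≤ K * s ^ (1 - θ / 2) := by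
  have hc : 0 ≤ c := ge_of_tendsto hlim <| by
    filter_upwards [eventually_ge_atTop 0] with s hs
    positivity
  have hl2 := Real.log_two_gt_d9
  have hl2' := Real.log_two_lt_d9
  have e2 : Real.exp (-Real.log 2) = 1 / 2 := by
    rw [Real.exp_neg, Real.exp_log two_pos]; norm_num
  have step (s : ℝ) (hs : 1 ≤ s) : |(({β | N β ≤ s}.ncard : ℝ) - {β | N β ≤ s / 2}.ncard) -
      c * s / 2| ≤ (4 * C + 3 * c) * s ^ (1 - θ / 2) := by
    have hs0 : 0 < s := by linarith
    set η : ℝ := s ^ (-(θ / 2)) / 4 with hη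
    have hr1 : s ^ (-(θ / 2)) ≤ 1 := Real.rpow_le_one_of_one_le_of_nonpos hs (by linarith)
    have hr0 : 0 < s ^ (-(θ / 2)) := Real.rpow_pos_of_pos hs0 _
    have hη0 : 0 < η := by positivity
    have hη4 : η ≤ 1 / 4 := by rw [hη]; linarith
    have hκ : 1 ≤ η⁻¹ := by
      rw [one_le_inv₀ hη0]; linarith
    have hexp1 : Real.exp η - 1 ≤ 2 * η := by
      have := Real.abs_exp_sub_one_le (x := η) (by rw [abs_of_pos hη0]; linarith)
      rw [abs_of_pos hη0] at this
      exact (le_abs_self _).trans this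
    have hexp2 : 1 - Real.exp (-η) ≤ η := by linarith [Real.add_one_le_exp (-η)]
    have herr : C * η⁻¹ * s ^ (1 - θ) = 4 * C * s ^ (1 - θ / 2) := by
      have h1 : s ^ (1 - θ) = s ^ (1 - θ / 2) * s ^ (-(θ / 2)) := by
        rw [← Real.rpow_add hs0]; ring_nf
      rw [h1, hη]; field_simp
    have hmain : 3 * η * s ≤ 3 * s ^ (1 - θ / 2) := by
      have h1 : s ^ (1 - θ / 2) = s ^ (-(θ / 2)) * s := by
        rw [← Real.rpow_add_one hs0.ne']; ring_nf
      rw [h1, hη]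
      nlinarith [mul_pos hr0 hs0]
    have hmain' := mul_le_mul_of_nonneg_left hmain hc
    rw [abs_le]
    constructor
    · obtain ⟨c', hc'⟩ := H η⁻¹ (trapezoid (-Real.log 2) 0 η) hκ (abs_trapezoid_sub_le hη0)
        (trapezoid_nonneg _ _ _) (trapezoid_le_one _ _ _) fun u hu ↦ by
          obtain ⟨h1, h2⟩ := trapezoid_ne_zero hη0 hu
          constructor <;> linarith
      have hlow : c * (Real.exp (-η) - Real.exp (-Real.log 2 + η)) ≤ c' := by
        refine le_of_tendsto_of_tendsto (tendsto_card_sub_card_div hlim _ _)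
          (tendsto_div_of_abs_sub_le hθ hc') ?_
        filter_upwards [eventually_gt_atTop 0] with x hx
        gcongr
        refine le_tsum_log hN hfin (by linarith) (trapezoid_nonneg _ _ _)
          (fun u h1 h2 ↦ trapezoid_eq_one hη0 h1.le (by linarith))
          (a' := -Real.log 2) (b' := 0) (fun u hu ↦ ?_) hx
        exact ⟨(trapezoid_ne_zero hη0 hu).1, (trapezoid_ne_zero hη0 hu).2.le⟩
      have hup := tsum_log_le (N := N) hN hfin (g := trapezoid (-Real.log 2) 0 η)
        (a := -Real.log 2) (b := 0) (by linarith) (trapezoid_le_one _ _ _)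
        (fun u hu ↦ ⟨(trapezoid_ne_zero hη0 hu).1, (trapezoid_ne_zero hη0 hu).2.le⟩) hs0
      rw [Real.exp_zero, mul_one, e2, mul_one_div] at hup
      have h3 := (abs_le.mp (hc' s hs)).1
      rw [herr] at h3
      rw [Real.exp_add, e2] at hlow
      have h4 : c * (1 / 2 - 3 * η) ≤ c' := by
        refine le_trans (mul_le_mul_of_nonneg_left ?_ hc) hlow
        linarith
      have h5 := mul_le_mul_of_nonneg_right h4 hs0.le
      nlinarith
    · obtain ⟨c', hc'⟩ := H η⁻¹ (trapezoid (-Real.log 2 - η) η η) hκ (abs_trapezoid_sub_le hη0)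
        (trapezoid_nonneg _ _ _) (trapezoid_le_one _ _ _) fun u hu ↦ by
          obtain ⟨h1, h2⟩ := trapezoid_ne_zero hη0 hu
          constructor <;> linarith
      have hsupp (u : ℝ) (hu : trapezoid (-Real.log 2 - η) η η u ≠ 0) :
          -Real.log 2 - η < u ∧ u ≤ η :=
        ⟨(trapezoid_ne_zero hη0 hu).1, (trapezoid_ne_zero hη0 hu).2.le⟩
      have hup : c' ≤ c * (Real.exp η - Real.exp (-Real.log 2 - η)) := by
        refine le_of_tendsto_of_tendsto (tendsto_div_of_abs_sub_le hθ hc')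
          (tendsto_card_sub_card_div hlim _ _) ?_
        filter_upwards [eventually_gt_atTop 0] with x hx
        gcongr
        exact tsum_log_le hN hfin (by linarith) (trapezoid_le_one _ _ _) hsupp hx
      have hlow := le_tsum_log (N := N) hN hfin (g := trapezoid (-Real.log 2 - η) η η)
        (a := -Real.log 2) (b := 0) (by linarith) (trapezoid_nonneg _ _ _)
        (fun u h1 h2 ↦ trapezoid_eq_one hη0 (by linarith) (by linarith)) hsupp hs0
      rw [Real.exp_zero, mul_one, e2, mul_one_div] at hlow
      have h3 := (abs_le.mp (hc' s hs)).2
      rw [herr] at h3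
      rw [sub_eq_add_neg (-Real.log 2), Real.exp_add, e2] at hup
      have h4 : c' ≤ c * (1 / 2 + 3 * η) := by
        refine hup.trans (mul_le_mul_of_nonneg_left ?_ hc)
        linarith
      have h5 := mul_le_mul_of_nonneg_right h4 hs0.le
      nlinarith
  set E := 4 * C + 3 * c with hE
  have hE0 : 0 ≤ E := by positivity
  set K := 4 * E + {β | N β ≤ 2}.ncard + 2 * c with hK
  have hK0 : 0 ≤ K := by positivity
  refine ⟨K, hK0, ?_⟩
  have hind (n : ℕ) : ∀ s : ℝ, 1 ≤ s → s ≤ 2 ^ (n + 1) →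
      |({β | N β ≤ s}.ncard : ℝ) - c * s| ≤ K * s ^ (1 - θ / 2) := by
    induction n with
    | zero =>
      intro s hs hs2
      rw [zero_add, pow_one] at hs2
      have h1 : ({β | N β ≤ s}.ncard : ℝ) ≤ {β | N β ≤ 2}.ncard := by
        exact_mod_cast Set.ncard_le_ncard (fun β hβ ↦ le_trans (show N β ≤ s from hβ) hs2) (hfin 2)
      have h2 : (1 : ℝ) ≤ s ^ (1 - θ / 2) := Real.one_le_rpow hs (by linarith)
      have h3 : K ≤ K * s ^ (1 - θ / 2) := le_mul_of_one_le_right hK0 h2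
      refine le_trans ?_ h3
      have h4 : c * s ≤ 2 * c := by nlinarith
      have h5 : 0 ≤ c * s := by positivity
      have h6 : (0 : ℝ) ≤ {β | N β ≤ s}.ncard := by positivity
      rw [abs_le]
      constructor <;> linarith
    | succ n ih =>
      intro s hs hs2
      rcases le_total s 2 with h2 | h2
      · exact ih s hs (h2.trans (le_self_pow₀ one_le_two n.succ_ne_zero))
      have h3 := ih (s / 2) (by linarith) (by rw [pow_succ] at hs2; linarith)
      have h4 := step s hs
      have h5 : (s / 2) ^ (1 - θ / 2) ≤ 3 / 4 * s ^ (1 - θ / 2) := by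
        rw [Real.div_rpow (by linarith) two_pos.le, div_le_iff₀ (by positivity)]
        have h6 : (4 / 3 : ℝ) ≤ 2 ^ (1 - θ / 2) := by
          refine le_trans ?_ (Real.rpow_le_rpow_of_exponent_le one_le_two
            (show (1 / 2 : ℝ) ≤ 1 - θ / 2 by linarith))
          rw [← Real.sqrt_eq_rpow]
          exact Real.le_sqrt_of_sq_le (by norm_num)
        have h7 : 0 ≤ s ^ (1 - θ / 2) := by positivity
        nlinarith
      have h8 := mul_le_mul_of_nonneg_left h5 hK0
      have h9 : 0 ≤ s ^ (1 - θ / 2) := by positivity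
      have h10 : (E + K * (3 / 4)) * s ^ (1 - θ / 2) ≤ K * s ^ (1 - θ / 2) := by
        gcongr
        have : (0 : ℝ) ≤ {β | N β ≤ 2}.ncard := by positivity
        linarith
      rw [abs_le] at h3 h4 ⊢
      constructor <;> linarith [h3.1, h3.2, h4.1, h4.2]
  intro s hs
  obtain ⟨n, hn⟩ := pow_unbounded_of_one_lt s (one_lt_two (α := ℝ))
  exact hind n s hs (hn.le.trans (pow_le_pow_right₀ one_le_two n.le_succ))

end Counting

end

section
open Finset

/-- The function `c ↦ max 0 (1 - |c|)`. -/
noncomputable def tent (c : ℝ) : ℝ := max 0 (1 - |c|)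

theorem tent_nonneg (c : ℝ) : 0 ≤ tent c := le_max_left _ _

theorem tent_le_one (c : ℝ) : tent c ≤ 1 := max_le zero_le_one (by linarith [abs_nonneg c])

theorem abs_le_one_of_tent_ne_zero {c : ℝ} (h : tent c ≠ 0) : |c| ≤ 1 := by
  by_contra hc
  exact h (max_eq_left (by linarith))

theorem abs_tent_sub_le (c d : ℝ) : |tent c - tent d| ≤ |c - d| := by
  unfold tent
  refine (abs_max_sub_max_le_max _ _ _ _).trans (max_le (by simp) ?_)
  rw [show 1 - |c| - (1 - |d|) = -(|c| - |d|) by ring, abs_neg]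
  exact abs_abs_sub_abs_le _ _

theorem tent_add_int_eq_zero (c : ℝ) {n : ℤ} (hn : n ∉ ({-⌊c⌋, -⌊c⌋ - 1} : Finset ℤ)) :
    tent (c + n) = 0 := by
  by_contra h
  have h1 : |c + n| < 1 := by
    by_contra h2
    exact h (max_eq_left (by linarith))
  rw [abs_lt] at h1
  have h2 := Int.floor_le c
  have h3 := Int.lt_floor_add_one c
  have h4 : ((⌊c⌋ + n : ℤ) : ℝ) < (1 : ℤ) := by push_cast; linarith
  have h5 : ((-2 : ℤ) : ℝ) < (⌊c⌋ + n : ℤ) := by push_cast; linarith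
  rw [Int.cast_lt] at h4 h5
  apply hn
  simp only [mem_insert, mem_singleton]
  omega

theorem sum_tent_add_int (c : ℝ) : ∑ n ∈ ({-⌊c⌋, -⌊c⌋ - 1} : Finset ℤ), tent (c + n) = 1 := by
  have h2 := Int.floor_le c
  have h3 := Int.lt_floor_add_one c
  rw [sum_pair (by omega)]
  unfold tent
  push_cast
  rw [abs_of_nonneg (by linarith), abs_of_nonpos (by linarith), max_eq_right (by linarith),
    max_eq_right (by linarith)]
  ring

variable {ι : Type*} [Fintype ι]

/-- The product over the coordinates of the function `tent`. -/
noncomputable def tentProd (c : ι → ℝ) : ℝ := ∏ i, tent (c i)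

theorem tentProd_nonneg (c : ι → ℝ) : 0 ≤ tentProd c := prod_nonneg fun _ _ ↦ tent_nonneg _

theorem tentProd_le_one (c : ι → ℝ) : tentProd c ≤ 1 :=
  prod_le_one (fun _ _ ↦ tent_nonneg _) fun _ _ ↦ tent_le_one _

theorem norm_le_one_of_tentProd_ne_zero {c : ι → ℝ} (h : tentProd c ≠ 0) : ‖c‖ ≤ 1 :=
  (pi_norm_le_iff_of_nonneg zero_le_one).mpr fun i ↦
    abs_le_one_of_tent_ne_zero (prod_ne_zero_iff.mp h i (mem_univ i))

theorem abs_tentProd_sub_le (c d : ι → ℝ) :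
    |tentProd c - tentProd d| ≤ Fintype.card ι * ‖c - d‖ := by
  classical
  have key (s : Finset ι) : |∏ i ∈ s, tent (c i) - ∏ i ∈ s, tent (d i)| ≤ #s * ‖c - d‖ := by
    induction s using Finset.induction_on with
    | empty => simp
    | insert i s hi ih =>
      rw [prod_insert hi, prod_insert hi, card_insert_of_notMem hi]
      have h1 : |tent (c i) - tent (d i)| ≤ ‖c - d‖ :=
        (abs_tent_sub_le _ _).trans (norm_le_pi_norm (c - d) i)
      have h2 : |∏ j ∈ s, tent (c j)| ≤ 1 := by
        rw [abs_of_nonneg (prod_nonneg fun _ _ ↦ tent_nonneg _)]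
        exact prod_le_one (fun _ _ ↦ tent_nonneg _) fun _ _ ↦ tent_le_one _
      have h3 : |tent (d i)| ≤ 1 := by
        rw [abs_of_nonneg (tent_nonneg _)]; exact tent_le_one _
      calc |tent (c i) * ∏ j ∈ s, tent (c j) - tent (d i) * ∏ j ∈ s, tent (d j)|
          = |(tent (c i) - tent (d i)) * ∏ j ∈ s, tent (c j) +
              tent (d i) * (∏ j ∈ s, tent (c j) - ∏ j ∈ s, tent (d j))| := by ring_nf
        _ ≤ |tent (c i) - tent (d i)| * |∏ j ∈ s, tent (c j)| +
              |tent (d i)| * |∏ j ∈ s, tent (c j) - ∏ j ∈ s, tent (d j)| := by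
            rw [← abs_mul, ← abs_mul]; exact abs_add_le _ _
        _ ≤ ‖c - d‖ * 1 + 1 * (#s * ‖c - d‖) := by gcongr
        _ = _ := by push_cast; ring
  exact key univ

theorem hasSum_tentProd_add_int (c : ι → ℝ) :
    HasSum (fun n : ι → ℤ ↦ tentProd fun i ↦ c i + n i) 1 := by
  classical
  have h1 : ∏ i, ∑ n ∈ ({-⌊c i⌋, -⌊c i⌋ - 1} : Finset ℤ), tent (c i + n) = 1 :=
    prod_eq_one fun i _ ↦ sum_tent_add_int _
  rw [prod_univ_sum] at h1
  rw [← h1]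
  refine hasSum_sum_of_ne_finset_zero fun n hn ↦ ?_
  rw [Fintype.mem_piFinset, not_forall] at hn
  obtain ⟨i, hi⟩ := hn
  exact prod_eq_zero (mem_univ i) (tent_add_int_eq_zero _ hi)

end

namespace NumberField.mixedEmbedding

open NumberField.InfinitePlace NumberField.Units NumberField.Units.dirichletUnitTheorem Module
  Finset

noncomputable section

variable (K : Type*) [Field K] [NumberField K]

open scoped Classical in
/-- The linear map sending `(log |x_w|)_w` to the logarithm of the norm of `x` together with the
coordinates of `logMap x` in the basis of the unit lattice. -/
def logCoord : (InfinitePlace K → ℝ) →ₗ[ℝ] ℝ × (Fin (rank K) → ℝ) :=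
  let S : (InfinitePlace K → ℝ) →ₗ[ℝ] ℝ := ∑ w, (mult w : ℝ) • LinearMap.proj w
  let T : (InfinitePlace K → ℝ) →ₗ[ℝ] logSpace K := LinearMap.pi fun w ↦
    (mult w.val : ℝ) • (LinearMap.proj w.val - (finrank ℚ K : ℝ)⁻¹ • S)
  S.prod (((basisUnitLattice K).ofZLatticeBasis ℝ
    (unitLattice K)).equivFun.toLinearMap ∘ₗ T)

theorem logCoord_fst (v : InfinitePlace K → ℝ) : (logCoord K v).1 = ∑ w, mult w * v w := by
  simp [logCoord]

open scoped Classical in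
theorem logCoord_snd (v : InfinitePlace K → ℝ) : (logCoord K v).2 =
    ((basisUnitLattice K).ofZLatticeBasis ℝ (unitLattice K)).equivFun
      fun w ↦ mult w.val * (v w.val - (finrank ℚ K : ℝ)⁻¹ * ∑ w, mult w * v w) := by
  simp only [logCoord, LinearMap.prod_apply, Function.prod_apply, LinearMap.coe_comp,
    Function.comp_apply, LinearEquiv.coe_coe]
  congr 1
  ext w
  simp

theorem logCoord_injective : Function.Injective (logCoord K) := by
  classical
  rw [injective_iff_map_eq_zero]
  intro v hv
  have h1 : ∑ w, (mult w : ℝ) * v w = 0 := by rw [← logCoord_fst, hv]; rfl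
  have h2 : (logCoord K v).2 = 0 := by rw [hv]; rfl
  rw [logCoord_snd, LinearEquiv.map_eq_zero_iff, h1] at h2
  have hm (w : InfinitePlace K) : (mult w : ℝ) ≠ 0 := Nat.cast_ne_zero.mpr mult_pos.ne'
  have h3 (w : InfinitePlace K) (hw : w ≠ w₀) : v w = 0 := by
    have := congrFun h2 ⟨w, hw⟩
    simpa [hm w] using this
  ext w
  by_cases hw : w = w₀
  · rw [Finset.sum_eq_single w₀ (fun w _ hw ↦ by rw [h3 w hw, mul_zero]) (by simp)] at h1
    rw [hw]
    exact (mul_eq_zero.mp h1).resolve_left (hm _)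
  · exact h3 w hw

open scoped Classical in
theorem logCoord_log (x : mixedSpace K) (hx : mixedEmbedding.norm x ≠ 0) :
    logCoord K (fun w ↦ Real.log (normAtPlace w x)) = (Real.log (mixedEmbedding.norm x),
      ((basisUnitLattice K).ofZLatticeBasis ℝ (unitLattice K)).equivFun (logMap x)) := by
  have h1 : ∑ w, (mult w : ℝ) * Real.log (normAtPlace w x) =
      Real.log (mixedEmbedding.norm x) := by
    rw [mixedEmbedding.norm_apply, Real.log_prod fun w _ ↦
      pow_ne_zero _ (mixedEmbedding.norm_ne_zero_iff.mp hx w)]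
    simp [Real.log_pow]
  refine Prod.ext ?_ ?_
  · rw [logCoord_fst, h1]
  · rw [logCoord_snd, h1]
    congr 1
    ext w
    rw [logMap_apply, mul_comm (finrank ℚ K : ℝ)⁻¹]

end

end NumberField.mixedEmbedding

namespace NumberField.mixedEmbedding

open NumberField.InfinitePlace NumberField.Units NumberField.Units.dirichletUnitTheorem Module
  Finset

noncomputable section

variable (K : Type*) [Field K] [NumberField K]

variable {K} in
open scoped Classical in
/-- A function on the mixed space which, summed over the translates by the fundamental units,
gives a function of the norm only. -/
def logTest (g : ℝ → ℝ) (x : mixedSpace K) : ℝ :=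
  if mixedEmbedding.norm x = 0 then 0 else
    g (logCoord K fun w ↦ Real.log (normAtPlace w x)).1 *
      tentProd (logCoord K fun w ↦ Real.log (normAtPlace w x)).2

theorem abs_log_max_sub_log_max_le {a : ℝ} (ha : 0 < a) (u v : ℝ) :
    |Real.log (max a u) - Real.log (max a v)| ≤ a⁻¹ * |u - v| := by
  wlog h : max a v ≤ max a u generalizing u v
  · rw [abs_sub_comm, abs_sub_comm u]
    exact this v u (le_of_not_ge h)
  have hv : 0 < max a v := lt_max_of_lt_left ha
  have hu : 0 < max a u := lt_max_of_lt_left ha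
  rw [abs_of_nonneg (sub_nonneg.mpr (Real.log_le_log hv h)), ← Real.log_div hu.ne' hv.ne']
  refine (Real.log_le_sub_one_of_pos (div_pos hu hv)).trans ?_
  rw [div_sub_one hv.ne', div_eq_inv_mul]
  have h2 : max a u - max a v ≤ |u - v| :=
    (le_abs_self _).trans ((abs_max_sub_max_le_max _ _ _ _).trans (by simp))
  exact mul_le_mul (inv_anti₀ ha (le_max_left _ _)) h2 (sub_nonneg.mpr h) (inv_nonneg.mpr ha.le)

open scoped Classical in
theorem abs_normAtPlace_sub_le (w : InfinitePlace K) (x y : mixedSpace K) :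
    |normAtPlace w x - normAtPlace w y| ≤ ‖x - y‖ := by
  have h (z : mixedSpace K) : normAtPlace w z ≤ ‖z‖ := by
    rw [norm_eq_sup'_normAtPlace]
    exact le_sup' (fun w ↦ normAtPlace w z) (mem_univ w)
  refine abs_sub_le_iff.mpr ⟨?_, ?_⟩
  · have := normAtPlace_add_le w (x - y) y
    rw [sub_add_cancel] at this
    linarith [h (x - y)]
  · have := normAtPlace_add_le w (y - x) x
    rw [sub_add_cancel] at this
    linarith [h (y - x), norm_sub_rev x y]

open scoped Classical in
theorem exists_logTest_lipschitz : ∃ R C : ℝ, 0 ≤ R ∧ 0 ≤ C ∧ ∀ (κ : ℝ) (g : ℝ → ℝ), 1 ≤ κ →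
    (∀ u v, |g u - g v| ≤ κ * |u - v|) → (∀ u, 0 ≤ g u) → (∀ u, g u ≤ 1) →
    (∀ u, g u ≠ 0 → -2 ≤ u ∧ u ≤ 1) →
    (∀ x y : mixedSpace K, |logTest g x - logTest g y| ≤ C * κ * ‖x - y‖) ∧
    ∀ x : mixedSpace K, R < ‖x‖ → logTest g x = 0 := by
  obtain ⟨A, -, hA⟩ := (logCoord K).exists_antilipschitzWith
    (LinearMap.ker_eq_bot.mpr (logCoord_injective K))
  set M := ‖LinearMap.toContinuousLinearMap (logCoord K)‖
  set B : ℝ := 2 * A + 1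
  have hB : 0 < B := by positivity
  refine ⟨Real.exp B, (1 + rank K) * M * Real.exp B, by positivity, by positivity,
    fun κ g hκ hg hg0 hg1 hsupp ↦ ?_⟩
  set H : (InfinitePlace K → ℝ) → ℝ := fun v ↦ g (logCoord K v).1 * tentProd (logCoord K v).2
  have hH0 (v) (hv : H v ≠ 0) : ‖v‖ < B := by
    have h1 := hsupp _ (left_ne_zero_of_mul hv)
    have h2 := norm_le_one_of_tentProd_ne_zero (right_ne_zero_of_mul hv)
    have h3 : ‖logCoord K v‖ ≤ 2 := by
      rw [Prod.norm_def]
      refine max_le ?_ (h2.trans one_le_two)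
      rw [Real.norm_eq_abs, abs_le]
      exact ⟨h1.1, h1.2.trans one_le_two⟩
    have h4 := hA.le_mul_dist v 0
    rw [map_zero, dist_zero_right, dist_zero_right] at h4
    have : A * ‖logCoord K v‖ ≤ A * 2 := by gcongr
    simp only [B]
    linarith
  have hHlip (v v') : |H v - H v'| ≤ (1 + rank K) * M * κ * ‖v - v'‖ := by
    have h0 : ‖logCoord K v - logCoord K v'‖ ≤ M * ‖v - v'‖ := by
      rw [← map_sub]
      exact (LinearMap.toContinuousLinearMap (logCoord K)).le_opNorm _
    have h1 : |(logCoord K v).1 - (logCoord K v').1| ≤ M * ‖v - v'‖ :=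
      (norm_fst_le (logCoord K v - logCoord K v')).trans h0
    have h2 : ‖(logCoord K v).2 - (logCoord K v').2‖ ≤ M * ‖v - v'‖ :=
      (norm_snd_le (logCoord K v - logCoord K v')).trans h0
    have h3 := abs_tentProd_sub_le (logCoord K v).2 (logCoord K v').2
    rw [Fintype.card_fin] at h3
    have h4 := hg (logCoord K v).1 (logCoord K v').1
    have h5 : 0 ≤ M * ‖v - v'‖ := by positivity
    calc |H v - H v'| = |(g (logCoord K v).1 - g (logCoord K v').1) * tentProd (logCoord K v).2 +
          g (logCoord K v').1 * (tentProd (logCoord K v).2 - tentProd (logCoord K v').2)| := by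
          simp only [H]; ring_nf
      _ ≤ |g (logCoord K v).1 - g (logCoord K v').1| * tentProd (logCoord K v).2 +
          g (logCoord K v').1 * |tentProd (logCoord K v).2 - tentProd (logCoord K v').2| := by
          refine (abs_add_le _ _).trans (le_of_eq ?_)
          rw [abs_mul, abs_mul, abs_of_nonneg (tentProd_nonneg _), abs_of_nonneg (hg0 _)]
      _ ≤ (κ * (M * ‖v - v'‖)) * 1 + 1 * (rank K * (M * ‖v - v'‖)) := by
          refine add_le_add (mul_le_mul (h4.trans (by gcongr)) (tentProd_le_one _)
            (tentProd_nonneg _) (by positivity)) (mul_le_mul (hg1 _) (h3.trans (by gcongr))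
            (abs_nonneg _) zero_le_one)
      _ ≤ (κ * (M * ‖v - v'‖)) * 1 + 1 * (rank K * (κ * (M * ‖v - v'‖))) := by
          gcongr κ * (M * ‖v - v'‖) * 1 + 1 * (rank K * ?_)
          exact le_mul_of_one_le_left h5 hκ
      _ = _ := by ring
  set l : mixedSpace K → InfinitePlace K → ℝ := fun x w ↦
    Real.log (max (Real.exp (-B)) (normAtPlace w x))
  have hl (x y) : ‖l x - l y‖ ≤ Real.exp B * ‖x - y‖ := by
    refine (pi_norm_le_iff_of_nonneg (by positivity)).mpr fun w ↦ ?_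
    refine (abs_log_max_sub_log_max_le (Real.exp_pos (-B)) _ _).trans ?_
    rw [← Real.exp_neg, neg_neg]
    gcongr
    exact abs_normAtPlace_sub_le K w x y
  have htest (x : mixedSpace K) : logTest g x = H (l x) := by
    by_cases h : ∃ w, normAtPlace w x ≤ Real.exp (-B)
    · obtain ⟨w, hw⟩ := h
      have h1 : H (l x) = 0 := by
        by_contra h1
        have h2 := (norm_le_pi_norm (l x) w).trans_lt (hH0 _ h1)
        simp only [l, max_eq_left hw, Real.log_exp, norm_neg, Real.norm_of_nonneg hB.le] at h2
        exact h2.false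
      rw [h1, logTest]
      split_ifs with h0
      · rfl
      · by_contra h3
        have h2 := (norm_le_pi_norm _ w).trans_lt (hH0 _ h3)
        have h4 : 0 < normAtPlace w x := (normAtPlace_nonneg w x).lt_of_ne'
          (mixedEmbedding.norm_ne_zero_iff.mp h0 w)
        have h5 := (Real.log_le_log h4 hw).trans_eq (Real.log_exp _)
        rw [Real.norm_eq_abs] at h2
        linarith [(abs_lt.mp h2).1]
    · push Not at h
      rw [logTest, if_neg (mixedEmbedding.norm_ne_zero_iff.mpr fun w ↦
        ((Real.exp_pos _).trans (h w)).ne')]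
      have : l x = fun w ↦ Real.log (normAtPlace w x) := by
        ext w
        simp only [l, max_eq_right (h w).le]
      rw [this]
  refine ⟨fun x y ↦ ?_, fun x hx ↦ ?_⟩
  · rw [htest, htest]
    refine (hHlip _ _).trans ((mul_le_mul_of_nonneg_left (hl x y) (by positivity)).trans
      (le_of_eq (by ring)))
  · by_contra h0
    rw [htest] at h0
    rw [norm_eq_sup'_normAtPlace] at hx
    obtain ⟨w, -, hw⟩ := (lt_sup'_iff _).mp hx
    have h2 := (norm_le_pi_norm (l x) w).trans_lt (hH0 _ h0)
    have h3 : B ≤ l x w := by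
      rw [← Real.log_exp B]
      exact Real.log_le_log (Real.exp_pos _) (hw.le.trans (le_max_right _ _))
    rw [Real.norm_eq_abs] at h2
    linarith [(abs_lt.mp h2).2]

end

end NumberField.mixedEmbedding

namespace NumberField.mixedEmbedding

open NumberField.InfinitePlace NumberField.Units NumberField.Units.dirichletUnitTheorem Module
  Finset fundamentalCone
open scoped nonZeroDivisors

noncomputable section

variable {K : Type*} [Field K] [NumberField K]

open scoped Classical in
theorem equivFun_logEmbedding_prod_fundSystem (n : Fin (rank K) → ℤ) :
    ((basisUnitLattice K).ofZLatticeBasis ℝ (unitLattice K)).equivFun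
      (logEmbedding K (Additive.ofMul (∏ i, fundSystem K i ^ n i))) = fun i ↦ (n i : ℝ) := by
  have h : logEmbedding K (Additive.ofMul (∏ i, fundSystem K i ^ n i)) =
      ∑ i, (n i : ℝ) • (basisUnitLattice K).ofZLatticeBasis ℝ (unitLattice K) i := by
    rw [ofMul_prod, map_sum]
    refine sum_congr rfl fun i _ ↦ ?_
    rw [ofMul_zpow, map_zsmul, logEmbedding_fundSystem, Basis.ofZLatticeBasis_apply,
      Int.cast_smul_eq_zsmul]
  rw [h, map_sum]
  ext j
  simp [Finsupp.single_apply]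

open scoped Classical in
theorem logTest_smul (g : ℝ → ℝ) {x : mixedSpace K} (hx : mixedEmbedding.norm x ≠ 0)
    {t : ℝ} (ht : 0 < t) (n : Fin (rank K) → ℤ) :
    logTest g (t⁻¹ • ((∏ i, fundSystem K i ^ n i) • x)) =
      g (Real.log (mixedEmbedding.norm x) - Real.log (t ^ finrank ℚ K)) *
      tentProd fun i ↦ ((basisUnitLattice K).ofZLatticeBasis ℝ
        (unitLattice K)).equivFun (logMap x) i + n i := by
  set u := ∏ i, fundSystem K i ^ n i with hu
  have h1 : mixedEmbedding.norm (u • x) ≠ 0 := by rwa [norm_unit_smul]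
  have h2 : mixedEmbedding.norm (t⁻¹ • (u • x)) =
      (t ^ finrank ℚ K)⁻¹ * mixedEmbedding.norm x := by
    rw [mixedEmbedding.norm_smul, norm_unit_smul, abs_of_pos (inv_pos.mpr ht), inv_pow]
  have h3 : mixedEmbedding.norm (t⁻¹ • (u • x)) ≠ 0 := by
    rw [h2]; positivity
  rw [logTest, if_neg h3, logCoord_log K _ h3, logMap_real_smul h1 (by positivity),
    logMap_unit_smul u hx, h2, Real.log_mul (by positivity) hx, Real.log_inv, map_add,
    hu, equivFun_logEmbedding_prod_fundSystem]
  congr 2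
  · ring
  · ext i
    exact add_comm _ _

theorem finite_idealSet_norm_le (J : (Ideal (𝓞 K))⁰) (s : ℝ) :
    {β : idealSet K J | mixedEmbedding.norm (β : mixedSpace K) ≤ s}.Finite := by
  have hfin : {I : {I : (Ideal (𝓞 K))⁰ // Submodule.IsPrincipal I.val} |
      Ideal.absNorm (I.1 : Ideal (𝓞 K)) ≤ ⌊s⌋₊}.Finite :=
    (Ideal.finite_setOfPred_absNorm_le ⌊s⌋₊).preimage
      (Subtype.val_injective.comp Subtype.val_injective).injOn
  have hfin2 := (hfin.prod (Set.finite_univ (α := torsion K))).preimage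
    (f := fun β : idealSet K J ↦ integerSetEquiv K (idealSetEquiv K J β).1)
    ((integerSetEquiv K).injective.comp (Subtype.val_injective.comp
      (idealSetEquiv K J).injective)).injOn
  refine hfin2.subset fun β (hβ : mixedEmbedding.norm (β : mixedSpace K) ≤ s) ↦ ?_
  refine ⟨?_, Set.mem_univ _⟩
  show Ideal.absNorm ((integerSetEquiv K (idealSetEquiv K J β).1).1 : Ideal (𝓞 K)) ≤ ⌊s⌋₊
  rw [integerSetEquiv_apply_fst, Ideal.absNorm_span_singleton]
  refine Nat.le_floor ?_
  rwa [← intNorm_idealSetEquiv_apply] at hβ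

/-- The multiples of elements of `idealSet K J` by products of powers of the fundamental units. -/
def unitMul (J : (Ideal (𝓞 K))⁰) (y : idealSet K J × (Fin (rank K) → ℤ)) :
    idealLattice K (FractionalIdeal.mk0 K J) :=
  ⟨(∏ i, fundSystem K i ^ y.2 i) • (y.1 : mixedSpace K), by
    obtain ⟨a, ha, h⟩ := (mem_idealSet.mp y.1.2).2
    rw [mem_idealLattice]
    refine ⟨algebraMap (𝓞 K) K ((∏ i, fundSystem K i ^ y.2 i : (𝓞 K)ˣ) * a), ?_, ?_⟩
    · exact (FractionalIdeal.mem_coeIdeal _).mpr ⟨_, Ideal.mul_mem_left _ _ ha, rfl⟩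
    · rw [map_mul, map_mul, unitSMul_smul, ← h]⟩

theorem unitMul_injective (J : (Ideal (𝓞 K))⁰) : Function.Injective (unitMul J) := by
  rintro ⟨β, n⟩ ⟨β', n'⟩ h
  have h0 : (∏ i, fundSystem K i ^ n i) • (β : mixedSpace K) =
      (∏ i, fundSystem K i ^ n' i) • (β' : mixedSpace K) := congrArg Subtype.val h
  set u := ∏ i, fundSystem K i ^ n i with hu
  set u' := ∏ i, fundSystem K i ^ n' i with hu'
  have h1 : (u'⁻¹ * u) • (β : mixedSpace K) = β' := by
    rw [mul_smul, h0, inv_smul_smul]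
  have h2 : u'⁻¹ * u ∈ torsion K := by
    rw [← unit_smul_mem_iff_mem_torsion (mem_idealSet.mp β.2).1, h1]
    exact (mem_idealSet.mp β'.2).1
  have h3 : n = n' := by
    rw [fun_eq_repr K h2 (x := u) (f := n') (by rw [← hu', mul_right_comm, inv_mul_cancel,
      one_mul])]
    exact fun_eq_repr K (one_mem _) (by rw [hu, one_mul])
  subst h3
  rw [show u' = u from rfl, inv_mul_cancel, one_smul] at h1
  exact Prod.ext (Subtype.ext h1) rfl

theorem mem_range_unitMul (J : (Ideal (𝓞 K))⁰) {x : idealLattice K (FractionalIdeal.mk0 K J)}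
    (hx : mixedEmbedding.norm (x : mixedSpace K) ≠ 0) : x ∈ Set.range (unitMul J) := by
  obtain ⟨u, hu⟩ := exists_unit_smul_mem hx
  obtain ⟨⟨ζ, n⟩, hζ, -⟩ := exist_unique_eq_mul_prod K u⁻¹
  have h1 : ((ζ : (𝓞 K)ˣ) * u) • (x : mixedSpace K) ∈ fundamentalCone K := by
    rw [mul_smul]
    exact torsion_smul_mem_of_mem hu ζ.2
  obtain ⟨y, hy, hxy⟩ := (mem_idealLattice K _).mp x.2
  obtain ⟨a, ha, rfl⟩ := (FractionalIdeal.mem_coeIdeal _).mp hy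
  have h2 : ((ζ : (𝓞 K)ˣ) * u) • (x : mixedSpace K) ∈ idealSet K J := by
    refine mem_idealSet.mpr ⟨h1, ((ζ : (𝓞 K)ˣ) * u : (𝓞 K)ˣ) * a, Ideal.mul_mem_left _ _ ha, ?_⟩
    rw [unitSMul_smul, ← hxy, ← map_mul, ← map_mul]
  refine ⟨⟨⟨_, h2⟩, n⟩, Subtype.ext ?_⟩
  show (∏ i, fundSystem K i ^ n i) • ((ζ : (𝓞 K)ˣ) * u) • (x : mixedSpace K) = x
  rw [← mul_smul, ← mul_assoc, mul_comm (∏ i, _), ← hζ, inv_mul_cancel, one_smul]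

theorem tsum_logTest (J : (Ideal (𝓞 K))⁰) {g : ℝ → ℝ} (hg : ∀ u, 0 ≤ g u)
    (hsupp : ∀ u, g u ≠ 0 → u ≤ 1) {t : ℝ} (ht : 0 < t) :
    ∑' x : idealLattice K (FractionalIdeal.mk0 K J), logTest g (t⁻¹ • (x : mixedSpace K)) =
      ∑' β : idealSet K J, g (Real.log (mixedEmbedding.norm (β : mixedSpace K)) -
        Real.log (t ^ finrank ℚ K)) := by
  classical
  rw [← (unitMul_injective J).tsum_eq]
  · set F : idealSet K J → ℝ := fun β ↦ g (Real.log (mixedEmbedding.norm (β : mixedSpace K)) -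
        Real.log (t ^ finrank ℚ K)) with hF
    set c : idealSet K J → Fin (rank K) → ℝ := fun β ↦ ((basisUnitLattice K).ofZLatticeBasis ℝ
        (unitLattice K)).equivFun (logMap (β : mixedSpace K))
    have hpos (β : idealSet K J) : 0 < mixedEmbedding.norm (β : mixedSpace K) :=
      norm_pos_of_mem (mem_idealSet.mp β.2).1
    have h1 (y : idealSet K J × (Fin (rank K) → ℤ)) :
        logTest g (t⁻¹ • (unitMul J y : mixedSpace K)) =
          F y.1 * tentProd fun i ↦ c y.1 i + y.2 i :=
      logTest_smul g (hpos _).ne' ht y.2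
    have h2 (β : idealSet K J) : HasSum (fun n : Fin (rank K) → ℤ ↦
        F β * tentProd fun i ↦ c β i + n i) (F β) := by
      simpa using (hasSum_tentProd_add_int (c β)).mul_left (F β)
    have hF : Summable F := by
      refine summable_of_hasFiniteSupport ((finite_idealSet_norm_le J
        (t ^ finrank ℚ K * Real.exp 1)).subset fun β hβ ↦ ?_)
      have := hsupp _ hβ
      rw [← Real.log_div (hpos β).ne' (by positivity),
        Real.log_le_iff_le_exp (div_pos (hpos β) (by positivity)), div_le_iff₀' (by positivity)]
        at this
      exact this
    simp_rw [h1]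
    rw [Summable.tsum_prod]
    · exact tsum_congr fun β ↦ (h2 β).tsum_eq
    · rw [summable_prod_of_nonneg fun y ↦ mul_nonneg (hg _) (tentProd_nonneg _)]
      exact ⟨fun β ↦ (h2 β).summable, (summable_congr fun β ↦ (h2 β).tsum_eq).mpr hF⟩
  · intro x hx
    refine mem_range_unitMul J fun h ↦ hx ?_
    simp only [logTest]
    rw [if_pos (by rw [mixedEmbedding.norm_smul, h, mul_zero])]

theorem exists_abs_tsum_idealSet_sub_le (J : (Ideal (𝓞 K))⁰) :
    ∃ C : ℝ, 0 ≤ C ∧ ∀ (κ : ℝ) (g : ℝ → ℝ), 1 ≤ κ →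
    (∀ u v, |g u - g v| ≤ κ * |u - v|) → (∀ u, 0 ≤ g u) → (∀ u, g u ≤ 1) →
    (∀ u, g u ≠ 0 → -2 ≤ u ∧ u ≤ 1) → ∃ c : ℝ, ∀ s : ℝ, 1 ≤ s →
      |∑' β : idealSet K J, g (Real.log (mixedEmbedding.norm (β : mixedSpace K)) - Real.log s) -
        c * s| ≤ C * κ * s ^ (1 - (finrank ℚ K : ℝ)⁻¹) := by
  classical
  obtain ⟨R, C₁, hR, hC₁, h₁⟩ := exists_logTest_lipschitz K
  obtain ⟨C₂, hC₂, h₂⟩ := exists_abs_tsum_lattice_sub_le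
    (idealLattice K (FractionalIdeal.mk0 K J)) hR
  refine ⟨C₂ * C₁, by positivity, fun κ g hκ hg hg0 hg1 hsupp ↦ ?_⟩
  obtain ⟨hlip, hzero⟩ := h₁ κ g hκ hg hg0 hg1 hsupp
  obtain ⟨I, hI⟩ := h₂ (C₁ * κ) (logTest g) (by positivity) hlip hzero
  refine ⟨I, fun s hs ↦ ?_⟩
  have hs0 : 0 < s := by linarith
  have hd : 0 < (finrank ℚ K : ℝ) := Nat.cast_pos.mpr finrank_pos
  set t := s ^ (finrank ℚ K : ℝ)⁻¹ with ht
  have ht1 : 1 ≤ t := Real.one_le_rpow hs (by positivity)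
  have hts : t ^ finrank ℚ K = s := Real.rpow_inv_natCast_pow hs0.le finrank_pos.ne'
  have h := hI t ht1
  rw [tsum_logTest J hg0 (fun u hu ↦ (hsupp u hu).2) (by positivity), mixedEmbedding.finrank,
    hts] at h
  rw [Real.rpow_sub hs0, Real.rpow_one, ← ht]
  exact h.trans_eq (by ring)

end

end NumberField.mixedEmbedding

section

open NumberField Ideal Module Filter Topology NumberField.mixedEmbedding Submodule
  NumberField.mixedEmbedding.fundamentalCone NumberField.Units
open scoped nonZeroDivisors

variable (K : Type*) [Field K] [NumberField K]

variable {K} in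
theorem card_mk0_eq_mul_torsionOrder {J : (Ideal (𝓞 K))⁰} {c : ClassGroup (𝓞 K)}
    (hJ : ClassGroup.mk0 J = c⁻¹) (s : ℝ) :
    Nat.card {I : (Ideal (𝓞 K))⁰ // absNorm (I : Ideal (𝓞 K)) ≤ s ∧ ClassGroup.mk0 I = c} *
      torsionOrder K = Nat.card {a : idealSet K J //
        mixedEmbedding.norm (a : mixedSpace K) ≤ s * absNorm (J : Ideal (𝓞 K))} := by
  rw [← card_isPrincipal_dvd_norm_le]
  congr 1
  simp_rw [← nonZeroDivisors_dvd_iff_dvd_coe]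
  refine Nat.card_congr ?_
  refine ((Equiv.dvd J).subtypeEquiv fun I ↦ ?_).trans
    (Equiv.subtypeSubtypeEquivSubtypeInter (fun I : (Ideal (𝓞 K))⁰ ↦ J ∣ I) _)
  rw [← ClassGroup.mk0_eq_one_iff (SetLike.coe_mem _)]
  simp_rw [Equiv.dvd_apply, Submonoid.coe_mul, ← Submonoid.mul_def, _root_.map_mul, hJ,
    inv_mul_eq_one, Nat.cast_mul, mul_comm s, eq_comm, and_comm, and_congr_left_iff]
  exact fun _ ↦
    (mul_le_mul_iff_of_pos_left (Nat.cast_pos.mpr (absNorm_pos_of_nonZeroDivisors J))).symm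

theorem exists_abs_card_mk0_sub_le (c : ClassGroup (𝓞 K)) : ∃ C : ℝ, 0 ≤ C ∧ ∀ t : ℝ, 1 ≤ t →
    |(Nat.card {I : (Ideal (𝓞 K))⁰ //
        absNorm (I : Ideal (𝓞 K)) ≤ t ∧ ClassGroup.mk0 I = c} : ℝ) -
      (2 ^ InfinitePlace.nrRealPlaces K * (2 * Real.pi) ^ InfinitePlace.nrComplexPlaces K *
        regulator K) / (torsionOrder K * Real.sqrt |discr K|) * t| ≤
      C * t ^ (1 - (finrank ℚ K : ℝ)⁻¹ / 2) := by
  obtain ⟨J, hJ⟩ := ClassGroup.mk0_surjective c⁻¹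
  set ρ := (2 ^ InfinitePlace.nrRealPlaces K * (2 * Real.pi) ^ InfinitePlace.nrComplexPlaces K *
    regulator K) / (torsionOrder K * Real.sqrt |discr K|)
  set m : ℝ := (absNorm (J : Ideal (𝓞 K)) : ℝ) with hm
  have hm1 : 1 ≤ m := Nat.one_le_cast.mpr (absNorm_pos_of_nonZeroDivisors J)
  have hm0 : 0 < m := by linarith
  set T : ℝ := (torsionOrder K : ℝ) with hT
  have hT1 : 1 ≤ T := Nat.one_le_cast.mpr (torsionOrder_pos K)
  have hT0 : 0 < T := by linarith
  have hcard (s : ℝ) : (Nat.card {I : (Ideal (𝓞 K))⁰ //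
      absNorm (I : Ideal (𝓞 K)) ≤ s ∧ ClassGroup.mk0 I = c} : ℝ) * T =
      ({a : idealSet K J | mixedEmbedding.norm (a : mixedSpace K) ≤ s * m}.ncard : ℝ) := by
    rw [hT, ← Nat.cast_mul, card_mk0_eq_mul_torsionOrder hJ, ← Nat.card_coe_set_eq]
    rfl
  have hlim : Tendsto (fun s : ℝ ↦
      ({a : idealSet K J | mixedEmbedding.norm (a : mixedSpace K) ≤ s}.ncard : ℝ) / s) atTop
      (𝓝 (ρ * (T / m))) := by
    have h := ((NumberField.Ideal.tendsto_norm_le_and_mk_eq_div_atTop K c).comp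
      (tendsto_id.atTop_mul_const (inv_pos.mpr hm0))).mul_const (T / m)
    refine h.congr fun s ↦ ?_
    have := hcard (s * m⁻¹)
    rw [inv_mul_cancel_right₀ hm0.ne'] at this
    rw [← this]
    simp only [Function.comp_apply, id]
    generalize (Nat.card _ : ℝ) = N
    field_simp
  have hd : 0 < (finrank ℚ K : ℝ) := Nat.cast_pos.mpr finrank_pos
  have hd1 : 1 ≤ (finrank ℚ K : ℝ) := Nat.one_le_cast.mpr finrank_pos
  obtain ⟨C₁, hC₁, h₁⟩ := exists_abs_tsum_idealSet_sub_le J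
  obtain ⟨C₂, hC₂, h₂⟩ := exists_abs_card_le_sub_le
    (N := fun a : idealSet K J ↦ mixedEmbedding.norm (a : mixedSpace K))
    (fun a ↦ norm_pos_of_mem (mem_idealSet.mp a.2).1) (finite_idealSet_norm_le J)
    (inv_pos.mpr hd) (inv_le_one_of_one_le₀ hd1) hC₁ hlim h₁
  refine ⟨C₂ * m, by positivity, fun t ht ↦ ?_⟩
  have ht0 : 0 < t := by linarith
  have h := h₂ (t * m) (one_le_mul_of_one_le_of_one_le ht hm1)
  rw [← hcard, show ρ * (T / m) * (t * m) = ρ * t * T by field_simp, ← sub_mul, abs_mul,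
    abs_of_pos hT0] at h
  refine (le_mul_of_one_le_right (abs_nonneg _) hT1).trans (h.trans ?_)
  rw [Real.mul_rpow ht0.le hm0.le, mul_assoc, mul_comm m]
  gcongr
  have : 0 < (finrank ℚ K : ℝ)⁻¹ := inv_pos.mpr hd
  exact Real.rpow_le_self_of_one_le hm1 (by linarith)

open Finset in
theorem sum_idealCountOn_true (n : ℕ) : ∑ k ∈ Icc 0 n, idealCountOn K (fun _ ↦ True) k =
    Nat.card {I : (Ideal (𝓞 K))⁰ // absNorm (I : Ideal (𝓞 K)) ≤ n} := by
  classical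
  have hfin := finite_setOfPred_absNorm_le₀ (S := 𝓞 K) n
  rw [show Nat.card {I : (Ideal (𝓞 K))⁰ // absNorm (I : Ideal (𝓞 K)) ≤ n} =
    {I : (Ideal (𝓞 K))⁰ | absNorm (I : Ideal (𝓞 K)) ≤ n}.ncard from Nat.card_coe_set_eq _,
    Set.ncard_eq_toFinset_card _ hfin, card_eq_sum_card_fiberwise
    (f := fun I : (Ideal (𝓞 K))⁰ ↦ absNorm (I : Ideal (𝓞 K))) (t := Icc 0 n)
    (fun I hI ↦ by simpa using hI), Nat.cast_sum]
  refine sum_congr rfl fun k hk ↦ ?_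
  change (if k = 0 then 0 else _) = _
  split_ifs with h0
  · rw [eq_comm, Nat.cast_eq_zero, card_eq_zero, filter_eq_empty_iff]
    intro I _ hI
    exact (absNorm_ne_zero_of_nonZeroDivisors I) (hI.trans h0)
  · rw [Nat.cast_inj, ← Set.ncard_coe_finset]
    symm
    refine Set.ncard_congr (fun I _ ↦ (I : Ideal (𝓞 K))) (fun I hI ↦ ?_)
      (fun I I' _ _ h ↦ Subtype.ext h) fun I hI ↦ ?_
    · rw [mem_coe, mem_filter] at hI
      exact ⟨hI.2, fun _ _ _ ↦ trivial⟩
    · have hI0 : I ∈ (Ideal (𝓞 K))⁰ := mem_nonZeroDivisors_of_ne_zero fun h ↦ h0 <| by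
        rw [← hI.1, h, Ideal.zero_eq_bot, absNorm_bot]
      refine ⟨⟨I, hI0⟩, ?_, rfl⟩
      rw [mem_coe, mem_filter, Set.Finite.mem_toFinset]
      exact ⟨(le_of_eq hI.1).trans (mem_Icc.mp hk).2, hI.1⟩

theorem card_le_eq_sum_card_mk0 (t : ℝ) (ht : 0 ≤ t) :
    Nat.card {I : (Ideal (𝓞 K))⁰ // absNorm (I : Ideal (𝓞 K)) ≤ t} =
      ∑ c : ClassGroup (𝓞 K), Nat.card {I : (Ideal (𝓞 K))⁰ //
        absNorm (I : Ideal (𝓞 K)) ≤ t ∧ ClassGroup.mk0 I = c} := by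
  classical
  have : Fintype {I : (Ideal (𝓞 K))⁰ // absNorm (I : Ideal (𝓞 K)) ≤ t} := by
    simp_rw [← Nat.le_floor_iff ht]
    refine @Fintype.ofFinite _ (finite_setOfPred_absNorm_le₀ ⌊t⌋₊)
  let e := fun c : ClassGroup (𝓞 K) ↦ Equiv.subtypeSubtypeEquivSubtypeInter
    (fun I : (Ideal (𝓞 K))⁰ ↦ absNorm I.1 ≤ t) (fun I ↦ ClassGroup.mk0 I = c)
  simp_rw [← Nat.card_congr (e _), Nat.card_eq_fintype_card, Fintype.subtype_card]
  rw [Fintype.card, Finset.card_eq_sum_card_fiberwise (f := fun I ↦ ClassGroup.mk0 I.1)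
    (t := Finset.univ) (fun _ _ ↦ Finset.mem_univ _)]

theorem exists_abs_sum_idealCountOn_sub_le : ∃ ρ δ C : ℝ, 0 < ρ ∧ 0 < δ ∧ δ < 1 ∧ 0 ≤ C ∧
    ∀ t : ℝ, 1 ≤ t →
      |(∑ k ∈ Finset.Icc 0 ⌊t⌋₊, idealCountOn K (fun _ ↦ True) k) - ρ * t| ≤
        C * t ^ (1 - δ) := by
  choose C hC h using exists_abs_card_mk0_sub_le K
  set ρ := (2 ^ InfinitePlace.nrRealPlaces K * (2 * Real.pi) ^ InfinitePlace.nrComplexPlaces K *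
    regulator K) / (torsionOrder K * Real.sqrt |discr K|)
  have hd : 0 < (finrank ℚ K : ℝ) := Nat.cast_pos.mpr finrank_pos
  have hd1 : (finrank ℚ K : ℝ)⁻¹ ≤ 1 := inv_le_one_of_one_le₀ (Nat.one_le_cast.mpr finrank_pos)
  have hρ : 0 < ρ := by
    have := regulator_pos K
    have := torsionOrder_pos K
    have : 0 < |(discr K : ℝ)| := abs_pos.mpr (Int.cast_ne_zero.mpr (discr_ne_zero K))
    positivity
  have hcl : 0 < Fintype.card (ClassGroup (𝓞 K)) := Fintype.card_pos
  refine ⟨Fintype.card (ClassGroup (𝓞 K)) * ρ, (finrank ℚ K : ℝ)⁻¹ / 2, ∑ c, C c, by positivity,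
    by positivity, by linarith, Finset.sum_nonneg fun c _ ↦ hC c, fun t ht ↦ ?_⟩
  have ht0 : 0 ≤ t := by linarith
  rw [sum_idealCountOn_true]
  simp_rw [Nat.le_floor_iff ht0]
  rw [card_le_eq_sum_card_mk0 K t ht0, Nat.cast_sum, Finset.sum_mul,
    show (Fintype.card (ClassGroup (𝓞 K)) : ℝ) * ρ * t = ∑ c : ClassGroup (𝓞 K), ρ * t by
      simp [mul_assoc], ← Finset.sum_sub_distrib]
  exact (Finset.abs_sum_le_sum_abs _ _).trans (Finset.sum_le_sum fun c _ ↦ h c t ht)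

theorem exists_sum_prime_idealCountOn_log_le : ∃ x₀ : ℝ, ∀ x, x₀ ≤ x →
    ∑ q ∈ Finset.Icc 0 ⌊x⌋₊ with q.Prime, idealCountOn K (fun _ ↦ True) q * Real.log q ≤
      8 * x := by
  obtain ⟨ρ, δ, C, hρ, hδ, hδ1, hC, h⟩ := exists_abs_sum_idealCountOn_sub_le K
  exact exists_sum_idealCount_log_le hρ hδ hδ1 hC h

end

section

open NumberField Ideal Module Finset

section

variable {F : Type*} [Field F] [NumberField F] {P : Ideal (𝓞 F)} {q : ℕ}

theorem exists_intCast_sub_mem (hP : P.IsPrime) (hq : q.Prime) (hqP : (q : 𝓞 F) ∈ P)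
    (h : ∀ y : 𝓞 F, y ^ q - y ∈ P) (y : 𝓞 F) : ∃ n : ℤ, y - n ∈ P := by
  have hP0 : P ≠ ⊥ := fun h0 ↦ hq.ne_zero (by simpa [h0] using hqP)
  have := hP.isMaximal hP0
  have : Fact q.Prime := ⟨hq⟩
  let := Ideal.Quotient.field P
  have : CharP (𝓞 F ⧸ P) q := by
    refine (CharP.charP_iff_prime_eq_zero hq).mpr ?_
    rw [← map_natCast (Ideal.Quotient.mk P), Ideal.Quotient.eq_zero_iff_mem]
    exact hqP
  have h1 : (Ideal.Quotient.mk P y) ∈ (⊥ : Subfield (𝓞 F ⧸ P)) := by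
    rw [Subfield.mem_bot_iff_pow_eq_self _ q, ← map_pow, Ideal.Quotient.eq]
    exact h y
  obtain ⟨n, hn⟩ := (mem_bot_iff_intCast q _).mp h1
  exact ⟨n, by rw [← Ideal.Quotient.eq, ← hn, map_intCast]⟩

theorem absNorm_eq_of_forall_pow_sub_mem (hP : P.IsPrime) (hq : q.Prime) (hqP : (q : 𝓞 F) ∈ P)
    (h : ∀ y : 𝓞 F, y ^ q - y ∈ P) : absNorm P = q := by
  have hP0 : P ≠ ⊥ := fun h0 ↦ hq.ne_zero (by simpa [h0] using hqP)
  have := hP.isMaximal hP0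
  have : Fact q.Prime := ⟨hq⟩
  have : CharP (𝓞 F ⧸ P) q := by
    refine (CharP.charP_iff_prime_eq_zero hq).mpr ?_
    rw [← map_natCast (Ideal.Quotient.mk P), Ideal.Quotient.eq_zero_iff_mem]
    exact hqP
  rw [absNorm_apply, Submodule.cardQuot_apply, ← Nat.card_zmod q]
  refine (Nat.card_eq_of_bijective (ZMod.castHom dvd_rfl (𝓞 F ⧸ P)) ⟨RingHom.injective _, ?_⟩).symm
  intro z
  obtain ⟨y, rfl⟩ := Ideal.Quotient.mk_surjective z
  obtain ⟨n, hn⟩ := exists_intCast_sub_mem hP hq hqP h y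
  exact ⟨n, by rw [map_intCast, ← map_intCast (Ideal.Quotient.mk P), eq_comm, Ideal.Quotient.eq]
               exact hn⟩

end

variable {K : Type*} [Field K] [NumberField K]

/-- The automorphism `τ` induces the `q`-th power map modulo `Q`. -/
def IsFrobeniusAt (q : ℕ) (Q : Ideal (𝓞 K)) (τ : Gal(K/ℚ)) : Prop :=
  ∀ y : 𝓞 K, τ • y - y ^ q ∈ Q

open Classical in
theorem exists_card_conj_mem_le [IsGalois ℚ K] (σ : Gal(K/ℚ)) : ∃ B : ℕ, ∀ (q : ℕ)
    (Q : Ideal (𝓞 K)) (τ : Gal(K/ℚ)), q.Prime → B < q → Q.IsPrime → (q : 𝓞 K) ∈ Q →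
    IsFrobeniusAt q Q τ →
    (#{x : Gal(K/ℚ) | x⁻¹ * τ * x ∈ Subgroup.zpowers σ} : ℝ) ≤ orderOf σ *
      idealCountOn (IntermediateField.fixedField (Subgroup.zpowers σ)) (fun _ ↦ True) q := by
  set F := IntermediateField.fixedField (Subgroup.zpowers σ) with hF
  set b := RingOfIntegers.basis F
  set d : Gal(K/ℚ) × Gal(K/ℚ) × Free.ChooseBasisIndex ℤ (𝓞 F) → 𝓞 K := fun y ↦
    y.1 • algebraMap (𝓞 F) (𝓞 K) (b y.2.2) - y.2.1 • algebraMap (𝓞 F) (𝓞 K) (b y.2.2) with hd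
  refine ⟨univ.sup fun y ↦ absNorm (span {d y}), fun q Q τ hq hB hQ hqQ hτ ↦ ?_⟩
  set P : Gal(K/ℚ) → Ideal (𝓞 F) := fun x ↦ Q.comap
    ((MulSemiringAction.toRingHom Gal(K/ℚ) (𝓞 K) x).comp (algebraMap (𝓞 F) (𝓞 K))) with hPdef
  have hmem (x : Gal(K/ℚ)) (y : 𝓞 F) : y ∈ P x ↔ x • algebraMap (𝓞 F) (𝓞 K) y ∈ Q := Iff.rfl
  have hPprime (x) : (P x).IsPrime := hQ.comap _
  have hPq (x) : (q : 𝓞 F) ∈ P x := by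
    rw [hmem, map_natCast, ← MulSemiringAction.toRingHom_apply, map_natCast]
    exact hqQ
  have hfix (h : Gal(K/ℚ)) (hh : h ∈ Subgroup.zpowers σ) (y : 𝓞 F) :
      h • algebraMap (𝓞 F) (𝓞 K) y = algebraMap (𝓞 F) (𝓞 K) y :=
    RingOfIntegers.ext (y.1.2 ⟨h, hh⟩)
  have hpow (x : Gal(K/ℚ)) (hx : x⁻¹ * τ * x ∈ Subgroup.zpowers σ) (y : 𝓞 F) :
      y ^ q - y ∈ P x := by
    have h1 := hτ (x • algebraMap (𝓞 F) (𝓞 K) y)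
    rw [← mul_smul, show τ * x = x * (x⁻¹ * τ * x) by group, mul_smul, hfix _ hx] at h1
    rw [hmem, map_sub, map_pow, smul_sub, smul_pow', ← neg_sub]
    exact neg_mem h1
  have hcard : idealCountOn F (fun _ ↦ True) q = ({I : Ideal (𝓞 F) | absNorm I = q}.ncard : ℝ) := by
    change (if q = 0 then 0 else _) = _
    rw [if_neg hq.ne_zero]
    simp
  rw [hcard, Set.ncard_eq_toFinset_card _ (finite_setOfPred_absNorm_eq q), ← Nat.cast_mul,
    Nat.cast_le]
  refine card_le_mul_card_image_of_maps_to (f := P) (fun x hx ↦ ?_) _ fun I hI ↦ ?_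
  · rw [Set.Finite.mem_toFinset]
    exact absNorm_eq_of_forall_pow_sub_mem (hPprime x) hq (hPq x)
      (hpow x (by simpa using hx))
  · rcases eq_empty_or_nonempty {x ∈ {x : Gal(K/ℚ) | x⁻¹ * τ * x ∈ Subgroup.zpowers σ} | P x = I}
      with he | ⟨x₀, hx₀⟩
    · rw [he, card_empty]; exact Nat.zero_le _
    rw [← Nat.card_zpowers, Nat.card_eq_fintype_card, ← Fintype.card_coe]
    refine (Fintype.card_le_of_injective (fun x ↦ (⟨x₀⁻¹ * x.1, ?_⟩ : Subgroup.zpowers σ)) ?_)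
    · obtain ⟨x, hx⟩ := x
      simp only [mem_filter, mem_univ, true_and] at hx hx₀
      suffices x₀⁻¹ * x ∈ F.fixingSubgroup by
        rwa [hF, IntermediateField.fixingSubgroup_fixedField] at this
      have hb (i) : x • algebraMap (𝓞 F) (𝓞 K) (b i) = x₀ • algebraMap (𝓞 F) (𝓞 K) (b i) := by
        obtain ⟨n, hn⟩ := exists_intCast_sub_mem (hPprime x) hq (hPq x) (hpow x hx.1) (b i)
        have hn' := hn
        rw [hx.2, ← hx₀.2] at hn'
        rw [hmem, map_sub, map_intCast, smul_sub] at hn hn'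
        have hint (z : Gal(K/ℚ)) : z • (n : 𝓞 K) = n := by
          rw [← MulSemiringAction.toRingHom_apply, map_intCast]
        rw [hint] at hn hn'
        have hmemQ : d (x, x₀, i) ∈ Q := by
          have := sub_mem hn hn'
          rwa [sub_sub_sub_cancel_right] at this
        by_contra hne
        have h0 : d (x, x₀, i) ≠ 0 := sub_ne_zero.mpr hne
        have h1 : ((absNorm (span {d (x, x₀, i)}) : ℕ) : 𝓞 K) ∈ Q :=
          (span_singleton_le_iff_mem _).mpr hmemQ (absNorm_mem _)
        have h2 : 0 < absNorm (span {d (x, x₀, i)}) := by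
          rw [Nat.pos_iff_ne_zero, Ne, absNorm_eq_zero_iff, span_singleton_eq_bot]
          exact h0
        have h3 : absNorm (span {d (x, x₀, i)}) < q :=
          (le_sup (f := fun y ↦ absNorm (span {d y})) (mem_univ _)).trans_lt hB
        have h4 : Nat.Coprime (absNorm (span {d (x, x₀, i)})) q :=
          ((Nat.Prime.coprime_iff_not_dvd hq).mpr (Nat.not_dvd_of_pos_of_lt h2 h3)).symm
        obtain ⟨u, v, huv⟩ := Nat.isCoprime_iff_coprime.mpr h4
        refine hQ.one_notMem ?_
        have h5 : (u : 𝓞 K) * ((absNorm (span {d (x, x₀, i)}) : ℕ) : 𝓞 K) +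
            v * ((q : ℕ) : 𝓞 K) = 1 := by exact_mod_cast congrArg (Int.cast (R := 𝓞 K)) huv
        rw [← h5]
        exact add_mem (Q.mul_mem_left _ h1) (Q.mul_mem_left _ hqQ)
      have hall (y : 𝓞 F) : x • algebraMap (𝓞 F) (𝓞 K) y = x₀ • algebraMap (𝓞 F) (𝓞 K) y := by
        have h6 : ((MulSemiringAction.toRingHom Gal(K/ℚ) (𝓞 K) x).comp
            (algebraMap (𝓞 F) (𝓞 K))).toIntAlgHom.toLinearMap =
            ((MulSemiringAction.toRingHom Gal(K/ℚ) (𝓞 K) x₀).comp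
            (algebraMap (𝓞 F) (𝓞 K))).toIntAlgHom.toLinearMap := b.ext hb
        exact LinearMap.congr_fun h6 y
      rw [IntermediateField.mem_fixingSubgroup_iff]
      intro z hz
      obtain ⟨y, m, hm, hym⟩ := IsFractionRing.div_surjective (A := 𝓞 F) (⟨z, hz⟩ : F)
      have h7 (w : 𝓞 F) : (x₀⁻¹ * x) (algebraMap F K (algebraMap (𝓞 F) F w)) =
          algebraMap F K (algebraMap (𝓞 F) F w) := by
        have := congrArg (fun t ↦ algebraMap (𝓞 K) K (x₀⁻¹ • t)) (hall w)
        simp only [← mul_smul, inv_mul_cancel, one_smul] at this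
        exact this
      have h8 : z = algebraMap F K (algebraMap (𝓞 F) F y) /
          algebraMap F K (algebraMap (𝓞 F) F m) := by
        rw [← map_div₀, hym]; rfl
      rw [h8, map_div₀, h7, h7]
    · intro x x' h
      exact Subtype.ext (mul_left_cancel (Subtype.ext_iff.mp h))

end

section

open NumberField Ideal Module Finset

section

variable {G : Type*} [Group G] [Finite G]

theorem zpowers_pow_eq_of_coprime {τ : G} {i : ℕ} (h : (orderOf τ).Coprime i) :
    Subgroup.zpowers (τ ^ i) = Subgroup.zpowers τ := by
  refine Subgroup.eq_of_le_of_card_ge ?_ ?_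
  · rw [Subgroup.zpowers_le]
    exact Subgroup.pow_mem _ (Subgroup.mem_zpowers τ) i
  · rw [Nat.card_zpowers, Nat.card_zpowers, h.orderOf_pow]

theorem card_le_mul_sum_card_conj_mem_zpowers [Fintype G] [DecidableEq G] {S : Finset G}
    (hconj : ∀ x, ∀ τ ∈ S, x⁻¹ * τ * x ∈ S)
    (hgen : ∀ τ ∈ S, ∀ σ, Subgroup.zpowers σ = Subgroup.zpowers τ → σ ∈ S) {M : ℝ}
    (hM : ∀ σ ∈ S, (orderOf σ : ℝ) ≤ M * (orderOf σ).totient) {τ : G} (hτ : τ ∈ S)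
    [∀ σ : G, DecidablePred (· ∈ Subgroup.zpowers σ)] :
    (Fintype.card G : ℝ) ≤
      M * ∑ σ ∈ S, (#{x : G | x⁻¹ * τ * x ∈ Subgroup.zpowers σ} : ℝ) / orderOf σ := by
  have key (x : G) : 1 ≤ M * ∑ σ ∈ S,
      if x⁻¹ * τ * x ∈ Subgroup.zpowers σ then (1 : ℝ) / orderOf σ else 0 := by
    have hx := hconj x τ hτ
    set t := x⁻¹ * τ * x
    have hpos : (0 : ℝ) < orderOf t := by exact_mod_cast orderOf_pos t
    have hM0 : 0 ≤ M := by
      by_contra! h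
      have h1 := (hM t hx).trans (mul_nonpos_of_nonpos_of_nonneg h.le (Nat.cast_nonneg _))
      exact absurd h1 (not_le.mpr hpos)
    have h2 : ((orderOf t).totient : ℝ) / orderOf t ≤ ∑ σ ∈ S,
        if t ∈ Subgroup.zpowers σ then (1 : ℝ) / orderOf σ else 0 := by
      have hsub : ({i ∈ range (orderOf t) | (orderOf t).Coprime i}).image (t ^ ·) ⊆ S := by
        intro σ hσ
        obtain ⟨i, hi, rfl⟩ := mem_image.mp hσ
        exact hgen t hx _ (zpowers_pow_eq_of_coprime (mem_filter.mp hi).2)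
      refine le_trans (le_of_eq ?_) (sum_le_sum_of_subset_of_nonneg hsub fun σ _ _ ↦ ?_)
      · rw [sum_image]
        · rw [sum_congr rfl (g := fun _ ↦ (1 : ℝ) / orderOf t), sum_const, nsmul_eq_mul,
            ← Nat.totient_eq_card_coprime, mul_one_div]
          intro i hi
          have hc := (mem_filter.mp hi).2
          rw [if_pos (by rw [zpowers_pow_eq_of_coprime hc]; exact Subgroup.mem_zpowers t),
            hc.orderOf_pow]
        · intro i hi j hj hij
          refine pow_injOn_Iio_orderOf ?_ ?_ hij
          · simpa using (mem_filter.mp hi).1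
          · simpa using (mem_filter.mp hj).1
      · split_ifs <;> positivity
    refine le_trans ?_ (mul_le_mul_of_nonneg_left h2 hM0)
    rw [← mul_div_assoc, le_div_iff₀ hpos, one_mul]
    exact hM t hx
  calc (Fintype.card G : ℝ) = ∑ x : G, 1 := by simp
    _ ≤ ∑ x : G, M * ∑ σ ∈ S,
        if x⁻¹ * τ * x ∈ Subgroup.zpowers σ then (1 : ℝ) / orderOf σ else 0 :=
      sum_le_sum fun x _ ↦ key x
    _ = _ := by
      rw [← mul_sum, sum_comm]
      congr 1
      refine sum_congr rfl fun σ _ ↦ ?_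
      rw [← sum_filter, sum_const, nsmul_eq_mul, mul_one_div]

end

variable {K : Type*} [Field K] [NumberField K]

/-- Some prime of `𝓞 K` above `q` has a Frobenius element in `S`. -/
def HasFrobeniusIn (S : Finset Gal(K/ℚ)) (q : ℕ) : Prop :=
  ∃ Q : Ideal (𝓞 K), Q.IsPrime ∧ (q : 𝓞 K) ∈ Q ∧ ∃ τ ∈ S, IsFrobeniusAt q Q τ

open Classical in
theorem exists_sum_log_hasFrobeniusIn_le [IsGalois ℚ K] {S : Finset Gal(K/ℚ)}
    (hconj : ∀ x, ∀ τ ∈ S, x⁻¹ * τ * x ∈ S)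
    (hgen : ∀ τ ∈ S, ∀ σ, Subgroup.zpowers σ = Subgroup.zpowers τ → σ ∈ S) {M : ℝ} (hM0 : 0 ≤ M)
    (hM : ∀ σ ∈ S, (orderOf σ : ℝ) ≤ M * (orderOf σ).totient) :
    ∃ (B : ℕ) (x₀ : ℝ), ∀ x, x₀ ≤ x →
      ∑ q ∈ Icc 0 ⌊x⌋₊ with q.Prime ∧ B < q ∧ HasFrobeniusIn S q, Real.log q ≤
        8 * M * (#S / Fintype.card Gal(K/ℚ)) * x := by
  choose B hB using fun σ : Gal(K/ℚ) ↦ exists_card_conj_mem_le σ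
  choose x₀ hx₀ using fun σ : Gal(K/ℚ) ↦
    exists_sum_prime_idealCountOn_log_le (IntermediateField.fixedField (Subgroup.zpowers σ))
  set r : Gal(K/ℚ) → ℕ → ℝ := fun σ ↦
    idealCountOn (IntermediateField.fixedField (Subgroup.zpowers σ)) (fun _ ↦ True) with hr
  have hr0 (σ q) : 0 ≤ r σ q := by
    change 0 ≤ (if q = 0 then 0 else _ : ℝ)
    split_ifs <;> positivity
  have hG : (0 : ℝ) < Fintype.card Gal(K/ℚ) := by exact_mod_cast Fintype.card_pos
  refine ⟨univ.sup B, ∑ σ, |x₀ σ|, fun x hx ↦ ?_⟩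
  have hx' (σ) : x₀ σ ≤ x :=
    (le_abs_self _).trans ((single_le_sum (fun σ _ ↦ abs_nonneg (x₀ σ)) (mem_univ σ)).trans hx)
  have hone (q : ℕ) (hq : q.Prime) (hBq : univ.sup B < q) (h : HasFrobeniusIn S q) :
      1 ≤ M / Fintype.card Gal(K/ℚ) * ∑ σ ∈ S, r σ q := by
    obtain ⟨Q, hQ, hqQ, τ, hτ, hF⟩ := h
    rw [div_mul_eq_mul_div, le_div_iff₀ hG, one_mul]
    refine (card_le_mul_sum_card_conj_mem_zpowers hconj hgen hM hτ).trans ?_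
    refine mul_le_mul_of_nonneg_left (sum_le_sum fun σ _ ↦ ?_) hM0
    rw [div_le_iff₀' (by exact_mod_cast orderOf_pos σ)]
    convert hB σ q Q τ hq ((le_sup (mem_univ σ)).trans_lt hBq) hQ hqQ hF
  calc ∑ q ∈ Icc 0 ⌊x⌋₊ with q.Prime ∧ univ.sup B < q ∧ HasFrobeniusIn S q, Real.log q
      ≤ ∑ q ∈ Icc 0 ⌊x⌋₊ with q.Prime ∧ univ.sup B < q ∧ HasFrobeniusIn S q,
        M / Fintype.card Gal(K/ℚ) * (∑ σ ∈ S, r σ q) * Real.log q := by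
        refine sum_le_sum fun q hq ↦ ?_
        obtain ⟨h1, h2, h3⟩ := (mem_filter.mp hq).2
        exact le_mul_of_one_le_left (Real.log_natCast_nonneg q) (hone q h1 h2 h3)
    _ ≤ ∑ q ∈ Icc 0 ⌊x⌋₊ with q.Prime,
        M / Fintype.card Gal(K/ℚ) * (∑ σ ∈ S, r σ q) * Real.log q := by
        refine sum_le_sum_of_subset_of_nonneg
          (monotone_filter_right _ fun q _ h ↦ h.1) fun q _ _ ↦ ?_
        have := sum_nonneg fun σ (_ : σ ∈ S) ↦ hr0 σ q
        have := Real.log_natCast_nonneg q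
        positivity
    _ = M / Fintype.card Gal(K/ℚ) * ∑ σ ∈ S, ∑ q ∈ Icc 0 ⌊x⌋₊ with q.Prime,
        r σ q * Real.log q := by
        rw [sum_comm, mul_sum]
        simp_rw [← sum_mul, mul_assoc]
    _ ≤ M / Fintype.card Gal(K/ℚ) * ∑ σ ∈ S, 8 * x := by
        gcongr with σ
        exact hx₀ σ x (hx' σ)
    _ = _ := by
        rw [sum_const, nsmul_eq_mul]
        ring

end

section

open Finset Filter

theorem eventually_mul_sqrt_le_ncard_prime (C : ℝ) :
    ∀ᶠ n : ℕ in atTop, C * √n ≤ ({q : ℕ | q.Prime ∧ q ≤ n}.ncard : ℝ) ∧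
      (n : ℝ) / (2 * Real.log n) ≤ ({q : ℕ | q.Prime ∧ q ≤ n}.ncard : ℝ) := by
  have hpi (n : ℕ) : {q : ℕ | q.Prime ∧ q ≤ n}.ncard = Nat.primeCounting n := by
    rw [Nat.primeCounting, Nat.primeCounting', Nat.count_eq_card_filter_range,
      ← Set.ncard_coe_finset]
    congr 1
    ext q
    simp [and_comm]
  have h1 : ∀ᶠ x : ℝ in atTop, Real.log (x + 1) ≤ 0.1 * x := by
    have h := (Real.isLittleO_log_id_atTop.comp_tendsto
      (tendsto_atTop_add_const_right atTop (1 : ℝ) tendsto_id)).bound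
      (show (0 : ℝ) < 0.05 by norm_num)
    filter_upwards [h, eventually_ge_atTop 1] with x hx hx1
    simp only [Function.comp_apply, id, Real.norm_eq_abs] at hx
    rw [abs_of_nonneg (by linarith : 0 ≤ x + 1)] at hx
    linarith [le_abs_self (Real.log (x + 1))]
  have h2 : ∀ᶠ x : ℝ in atTop, |C| * √x * (2 * Real.log x) ≤ x := by
    have h := (isLittleO_log_rpow_atTop (show (0 : ℝ) < 1 / 2 by norm_num)).bound
      (show (0 : ℝ) < 1 / (2 * (|C| + 1)) by positivity)
    filter_upwards [h, eventually_ge_atTop 1] with x hx hx1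
    rw [← Real.sqrt_eq_rpow, Real.norm_of_nonneg (Real.log_nonneg hx1),
      Real.norm_of_nonneg (Real.sqrt_nonneg _)] at hx
    have hs := Real.mul_self_sqrt (by linarith : 0 ≤ x)
    rw [one_div_mul_eq_div, le_div_iff₀ (by positivity)] at hx
    have h0 := Real.log_nonneg hx1
    calc |C| * √x * (2 * Real.log x) ≤ √x * (Real.log x * (2 * (|C| + 1))) := by
          have : 0 ≤ √x * Real.log x := by positivity
          nlinarith
      _ ≤ √x * √x := by gcongr
      _ = x := hs
  filter_upwards [tendsto_natCast_atTop_atTop.eventually h1,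
    tendsto_natCast_atTop_atTop.eventually h2, eventually_ge_atTop 2] with n hn1 hn2 hn
  have hlog : 0 < Real.log n := Real.log_pos (by exact_mod_cast hn)
  have h3 : (n : ℝ) / (2 * Real.log n) ≤ ({q : ℕ | q.Prime ∧ q ≤ n}.ncard : ℝ) := by
    rw [hpi]
    refine le_trans ?_ (Chebyshev.pi_ge n)
    rw [div_le_div_iff₀ (by positivity) hlog]
    have := Real.log_two_gt_d9
    have hn0 : (0 : ℝ) ≤ n := n.cast_nonneg
    have h4 : (n : ℝ) / 2 ≤ n * Real.log 2 - Real.log (n + 1) := by nlinarith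
    nlinarith [mul_le_mul_of_nonneg_right h4 hlog.le]
  refine ⟨le_trans ?_ h3, h3⟩
  rw [le_div_iff₀ (by positivity)]
  refine le_trans ?_ hn2
  gcongr
  exact le_abs_self C

open Classical in
theorem eventually_ncard_le_mul_ncard_prime {A : Set ℕ} {c : ℝ} (hc : 0 ≤ c) {B : ℕ} {x₀ : ℝ}
    (hsum : ∀ x, x₀ ≤ x → ∑ q ∈ Icc 0 ⌊x⌋₊ with B < q ∧ q ∈ A, Real.log q ≤ c * x)
    {ε : ℝ} (hε : 0 < ε) :
    ∀ᶠ n : ℕ in atTop, ({q : ℕ | q ∈ A ∧ q ≤ n}.ncard : ℝ) ≤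
      (4 * c + ε) * ({q : ℕ | q.Prime ∧ q ≤ n}.ncard : ℝ) := by
  filter_upwards [eventually_mul_sqrt_le_ncard_prime (2 / ε),
    tendsto_natCast_atTop_atTop.eventually (eventually_ge_atTop (max x₀ 1)),
    eventually_ge_atTop (max 2 (B ^ 2))] with n hn1 hn2 hn3
  obtain ⟨hsqrt, hpi⟩ := hn1
  have hB : (B : ℝ) ≤ √n := Real.le_sqrt_of_sq_le
    (by exact_mod_cast (le_max_right _ _).trans hn3)
  have hn : (2 : ℝ) ≤ n := by exact_mod_cast (le_max_left _ _).trans hn3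
  have hlog : 0 < Real.log n := Real.log_pos (by linarith)
  set U := {q ∈ Icc 0 n | √(n : ℝ) < (q : ℕ) ∧ q ∈ A} with hU
  have h1 : {q : ℕ | q ∈ A ∧ q ≤ n}.ncard ≤ (⌊√n⌋₊ + 1) + #U := by
    calc {q : ℕ | q ∈ A ∧ q ≤ n}.ncard ≤ (↑(Icc 0 ⌊√n⌋₊ ∪ U) : Set ℕ).ncard := by
          refine Set.ncard_le_ncard (fun q hq ↦ ?_) (finite_toSet _)
          obtain ⟨hqA, hqn⟩ := hq
          rw [mem_coe, mem_union]
          rcases le_or_gt (q : ℝ) √n with h | h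
          · exact Or.inl (mem_Icc.mpr ⟨Nat.zero_le _, Nat.le_floor h⟩)
          · exact Or.inr (mem_filter.mpr ⟨mem_Icc.mpr ⟨Nat.zero_le _, hqn⟩, h, hqA⟩)
      _ ≤ _ := by
          rw [Set.ncard_coe_finset]
          exact (card_union_le _ _).trans (by simp)
  have h2 : #U * (Real.log n / 2) ≤ c * n := by
    have h3 := hsum n ((le_max_left _ _).trans hn2)
    rw [Nat.floor_natCast] at h3
    refine le_trans ?_ h3
    rw [← nsmul_eq_mul]
    refine (card_nsmul_le_sum U (fun q : ℕ ↦ Real.log q) _ fun q hq ↦ ?_).trans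
      (sum_le_sum_of_subset_of_nonneg (monotone_filter_right _ fun q _ hq ↦ ?_)
        fun q _ _ ↦ Real.log_natCast_nonneg q)
    · rw [← Real.log_sqrt (by linarith)]
      exact Real.log_le_log (by positivity) (mem_filter.mp hq).2.1.le
    · exact ⟨by exact_mod_cast hB.trans_lt hq.1, hq.2⟩
  have h3 : (#U : ℝ) ≤ 4 * c * (n / (2 * Real.log n)) := by
    rw [← mul_div_assoc, le_div_iff₀ (by positivity)]
    nlinarith
  have h4 : ({q : ℕ | q ∈ A ∧ q ≤ n}.ncard : ℝ) ≤ (⌊√n⌋₊ + 1) + #U := by exact_mod_cast h1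
  have h5 : (⌊√n⌋₊ : ℝ) ≤ √n := Nat.floor_le (Real.sqrt_nonneg _)
  have h6 : 1 ≤ √(n : ℝ) := Real.one_le_sqrt.mpr (by linarith)
  have h7 : 2 * √n ≤ ε * ({q : ℕ | q.Prime ∧ q ≤ n}.ncard : ℝ) := by
    calc 2 * √n = ε * (2 / ε * √n) := by field_simp
      _ ≤ _ := by gcongr
  have h8 := mul_le_mul_of_nonneg_left hpi (show 0 ≤ 4 * c by positivity)
  linarith

end

section

open Finset Equiv

namespace FiberAction

variable {G X : Type*} [Group G] [MulAction G X]

/-- The permutations of `X` that agree on the stable set `T` with an element of `G`. -/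
def realized {T : Finset X} (hT : ∀ g : G, ∀ x ∈ T, g • x ∈ T) : Subgroup (Perm X) where
  carrier := {π | ∃ g : G, ∀ w ∈ T, g • w = π w}
  one_mem' := ⟨1, fun w _ ↦ one_smul G w⟩
  mul_mem' := by
    rintro π ρ ⟨g, hg⟩ ⟨h, hh⟩
    refine ⟨g * h, fun w hw ↦ ?_⟩
    rw [mul_smul, hg _ (hT h w hw), hh w hw, Perm.mul_apply]
  inv_mem' := by
    rintro π ⟨g, hg⟩
    refine ⟨g⁻¹, fun w hw ↦ ?_⟩
    rw [Perm.eq_inv_iff_eq, ← hg _ (hT _ w hw), smul_inv_smul]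

theorem mem_realized {T : Finset X} {hT : ∀ g : G, ∀ x ∈ T, g • x ∈ T} {π : Perm X} :
    π ∈ realized hT ↔ ∃ g : G, ∀ w ∈ T, g • w = π w := Iff.rfl

variable [DecidableEq X]

theorem swap_smul_mem_realized {T : Finset X} {hT : ∀ g : G, ∀ x ∈ T, g • x ∈ T} {x y : X}
    (h : swap x y ∈ realized hT) (g : G) : swap (g • x) (g • y) ∈ realized hT := by
  have hg : MulAction.toPerm g ∈ realized hT := ⟨g, fun w _ ↦ rfl⟩
  have := mul_mem (mul_mem hg h) (inv_mem hg)
  rwa [← swap_apply_apply] at this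

/-- If `G` acts transitively on `T`, compatibly with `F`, the fibers of `F` on `T` have prime
cardinality `p`, and some transposition of two elements of the same fiber is realized by `G`, then
so are all of them. -/
theorem swap_mem_realized_of_eq {F : X → X} (hF : ∀ (g : G) x, F (g • x) = g • F x)
    {T : Finset X} (hT : ∀ g : G, ∀ x ∈ T, g • x ∈ T)
    (htrans : ∀ x ∈ T, ∀ y ∈ T, ∃ g : G, g • x = y) {p : ℕ} (hp : p.Prime)
    (hfib : ∀ x ∈ T, #{w ∈ T | F w = F x} = p) {a b : X} (ha : a ∈ T) (hb : b ∈ T) (hab : a ≠ b)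
    (hFab : F a = F b) (hswap : swap a b ∈ realized hT) {x y : X} (hx : x ∈ T) (hy : y ∈ T)
    (hxy : F x = F y) : swap x y ∈ realized hT := by
  classical
  set c : X → Finset X := fun x ↦ {w ∈ T | F w = F x ∧ swap x w ∈ realized hT} with hc
  have hself (z) (hz : z ∈ T) : z ∈ c z := by
    simp only [hc, mem_filter]
    exact ⟨hz, trivial, by rw [swap_self]; exact one_mem _⟩
  have hle (g : G) (z : X) : #(c z) ≤ #(c (g • z)) := by
    refine card_le_card_of_injOn (g • ·) (fun w hw ↦ ?_) (MulAction.injective g).injOn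
    simp only [hc, coe_filter, Set.mem_ofPred_eq] at hw ⊢
    exact ⟨hT g w hw.1, by rw [hF, hF, hw.2.1], swap_smul_mem_realized hw.2.2 g⟩
  have hcard (z) (hz : z ∈ T) : #(c z) = #(c a) := by
    obtain ⟨g, hg⟩ := htrans z hz a ha
    refine le_antisymm (hg ▸ hle g z) ?_
    have := hle g⁻¹ a
    rwa [← hg, inv_smul_smul, hg] at this
  have hcc {z w : X} (hw : w ∈ c z) : c w = c z := by
    simp only [hc, mem_filter] at hw
    ext v
    simp only [hc, mem_filter, hw.2.1, and_congr_right_iff]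
    intro _ _
    refine ⟨fun h ↦ SubmonoidClass.swap_mem_trans _ hw.2.2 h,
      fun h ↦ SubmonoidClass.swap_mem_trans _ ?_ h⟩
    rw [swap_comm]
    exact hw.2.2
  have hdvd : #(c a) ∣ p := by
    rw [← hfib x hx, card_eq_sum_card_image c {w ∈ T | F w = F x}]
    refine dvd_sum fun C hC ↦ ?_
    obtain ⟨z, hz, rfl⟩ := mem_image.mp hC
    obtain ⟨hzT, hzF⟩ := mem_filter.mp hz
    rw [← hcard z hzT]
    refine dvd_of_eq (congrArg card (Subset.antisymm (fun w hw ↦ ?_) fun w hw ↦ ?_))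
    · have hw' := mem_filter.mp hw
      exact mem_filter.mpr ⟨mem_filter.mpr ⟨hw'.1, hw'.2.1.trans hzF⟩, hcc hw⟩
    · have hw' := mem_filter.mp hw
      rw [← hw'.2]
      exact hself w (mem_filter.mp hw'.1).1
  have htwo : 1 < #(c a) := by
    rw [one_lt_card_iff]
    exact ⟨a, b, hself a ha, mem_filter.mpr ⟨hb, hFab.symm, hswap⟩, hab⟩
  have hcp : #(c x) = p := (hcard x hx).trans
    ((hp.eq_one_or_self_of_dvd _ hdvd).resolve_left htwo.ne')
  have hsub : c x ⊆ {w ∈ T | F w = F x} := monotone_filter_right _ fun w _ h ↦ h.1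
  have heq := eq_of_subset_of_card_le hsub (by rw [hcp, hfib x hx])
  have hyc : y ∈ c x := by
    rw [heq]
    exact mem_filter.mpr ⟨hy, hxy.symm⟩
  exact (mem_filter.mp hyc).2.2

/-- The generating function `(1 / p!) ∑ u ^ (number of fixed points)` of `Perm (Fin p)`. -/
noncomputable def fixPoly (p : ℕ) (u : ℝ) : ℝ :=
  (∑ π : Perm (Fin p), u ^ #{i | π i = i}) / p.factorial

theorem sum_pow_card_fixed {E : Type*} [Fintype E] [DecidableEq E] (u : ℝ) :
    ∑ π : Perm E, u ^ #{i | π i = i} =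
      (Fintype.card E).factorial * fixPoly (Fintype.card E) u := by
  rw [fixPoly, mul_div_cancel₀ _ (by positivity)]
  set e := Fintype.equivFin E
  refine Fintype.sum_equiv e.permCongr _ _ fun π ↦ ?_
  congr 1
  refine card_equiv e fun i ↦ ?_
  rw [mem_filter, mem_filter, permCongr_apply, symm_apply_apply, e.injective.eq_iff]
  simp

theorem ofSubtype_mem_realized {T : Finset X} {hT : ∀ g : G, ∀ x ∈ T, g • x ∈ T}
    {P : X → Prop} [DecidablePred P] [Finite {x // P x}]
    (h : ∀ x y, P x → P y → swap x y ∈ realized hT) (π : Perm {x // P x}) :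
    Perm.ofSubtype π ∈ realized hT := by
  induction π using Perm.swap_induction_on with
  | one => rw [map_one]; exact one_mem _
  | swap_mul f x y _ ih =>
    rw [map_mul, Perm.ofSubtype_swap_eq]
    exact mul_mem (h _ _ x.2 y.2) ih

end FiberAction

end

section

open Finset Equiv

namespace FiberAction

variable {G X : Type*} [Group G] [MulAction G X] [DecidableEq X]

theorem sum_pow_card_fixedPoints_eq [Fintype G] {F : X → X}
    (hF : ∀ (g : G) x, F (g • x) = g • F x) {T T' : Finset X}
    (hT' : ∀ g : G, ∀ x ∈ T', g • x ∈ T') (hFT : ∀ x ∈ T', F x ∈ T) {p : ℕ} (hp : 0 < p)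
    (hfib : ∀ y ∈ T, #{w ∈ T' | F w = y} = p)
    (hswap : ∀ x ∈ T', ∀ y ∈ T', F x = F y → swap x y ∈ realized hT') (u : ℝ) :
    ∑ g : G, u ^ #{x ∈ T' | g • x = x} = ∑ g : G, fixPoly p u ^ #{y ∈ T | g • y = y} := by
  set W : Finset X → G → ℝ := fun U g ↦ ∏ y ∈ T, if g • y = y then
    (if y ∈ U then fixPoly p u else u ^ #{x ∈ T' | F x = y ∧ g • x = x}) else 1 with hW
  have hempty (g : G) : W ∅ g = u ^ #{x ∈ T' | g • x = x} := by
    simp only [hW, notMem_empty, if_false]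
    rw [← prod_filter, prod_pow_eq_pow_sum]
    congr 1
    rw [card_eq_sum_card_fiberwise (f := F) (t := {y ∈ T | g • y = y})]
    · simp_rw [filter_filter, and_comm]
    · intro x hx
      obtain ⟨h1, h2⟩ := mem_filter.mp hx
      exact mem_filter.mpr ⟨hFT x h1, by rw [← hF, h2]⟩
  have hfull (g : G) : W T g = fixPoly p u ^ #{y ∈ T | g • y = y} := by
    rw [hW, ← prod_const, prod_filter]
    exact prod_congr rfl fun y hy ↦ by rw [if_pos hy]
  suffices h : ∀ U ⊆ T, ∑ g : G, W U g = ∑ g : G, W ∅ g by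
    simp_rw [← hempty, ← hfull, h T subset_rfl]
  intro U
  induction U using Finset.induction_on with
  | empty => exact fun _ ↦ rfl
  | insert y₀ U hy₀ ih =>
    intro hU
    rw [← ih ((subset_insert _ _).trans hU)]
    have hyT : y₀ ∈ T := hU (mem_insert_self _ _)
    set P : X → Prop := fun x ↦ x ∈ T' ∧ F x = y₀ with hP
    let _ : Fintype {x // P x} := Fintype.subtype {x ∈ T' | F x = y₀} fun x ↦ mem_filter
    have hcard : Fintype.card {x // P x} = p := by
      rw [Fintype.card_of_subtype {x ∈ T' | F x = y₀} fun x ↦ mem_filter, hfib y₀ hyT]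
    choose h hh using fun π : Perm {x // P x} ↦ mem_realized.mp <|
      ofSubtype_mem_realized (hT := hT')
        (fun x y hx hy ↦ hswap x hx.1 y hy.1 (hx.2.trans hy.2.symm)) π
    have hFh (π : Perm {x // P x}) (x : X) (hx : x ∈ T') : F (h π • x) = F x := by
      rw [hh π x hx]
      by_cases hPx : P x
      · rw [Perm.ofSubtype_apply_of_mem π hPx, (π ⟨x, hPx⟩).2.2, hPx.2]
      · rw [Perm.ofSubtype_apply_of_not_mem π hPx]
    have hfix (π : Perm {x // P x}) (y : X) (hy : y ∈ T) : h π • y = y := by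
      obtain ⟨x, hx⟩ := card_pos.mp ((hfib y hy).symm ▸ hp)
      obtain ⟨hxT, rfl⟩ := mem_filter.mp hx
      rw [← hF, hFh π x hxT]
    have key (g : G) : ∑ π, W U (g * h π) = p.factorial * W (insert y₀ U) g := by
      simp only [hW]
      simp_rw [← mul_prod_erase T _ hyT]
      have hother (π : Perm {x // P x}) (y : X) (hy : y ∈ T.erase y₀) :
          (if (g * h π) • y = y then (if y ∈ U then fixPoly p u else
            u ^ #{x ∈ T' | F x = y ∧ (g * h π) • x = x}) else 1) =
          if g • y = y then (if y ∈ insert y₀ U then fixPoly p u else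
            u ^ #{x ∈ T' | F x = y ∧ g • x = x}) else 1 := by
        have hne := ne_of_mem_erase hy
        rw [mul_smul, hfix π y (mem_of_mem_erase hy)]
        simp only [mem_insert, hne, false_or]
        congr 3
        congr 1
        refine filter_congr fun x hx ↦ and_congr_right fun hxy ↦ ?_
        rw [mul_smul, hh π x hx, Perm.ofSubtype_apply_of_not_mem π]
        exact fun hPx ↦ hne (hxy.symm.trans hPx.2)
      simp_rw [prod_congr rfl (hother _)]
      rw [← sum_mul, ← mul_assoc]
      congr 1
      simp only [mem_insert_self, if_true, if_neg hy₀, mul_smul, hfix _ y₀ hyT]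
      by_cases hg : g • y₀ = y₀
      · simp only [if_pos hg]
        have hstab (x : X) : P (MulAction.toPerm g x) ↔ P x := by
          refine ⟨fun hx ↦ ⟨?_, ?_⟩, fun hx ↦ ⟨hT' g x hx.1, ?_⟩⟩
          · have := hT' g⁻¹ _ hx.1
            rwa [MulAction.toPerm_apply, inv_smul_smul] at this
          · have := hx.2
            rw [MulAction.toPerm_apply, hF] at this
            exact MulAction.injective g (this.trans hg.symm)
          · rw [MulAction.toPerm_apply, hF, hx.2, hg]
        set γ : Perm {x // P x} := (MulAction.toPerm g : Perm X).subtypePerm hstab with hγ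
        rw [← hcard, ← sum_pow_card_fixed]
        refine Fintype.sum_equiv (Equiv.mulLeft γ) _ _ fun π ↦ ?_
        congr 1
        refine (card_bij (fun x _ ↦ x.1) (fun x hx ↦ ?_) (fun x _ y _ ↦ Subtype.ext)
          fun x hx ↦ ?_).symm
        · have hx' := congrArg Subtype.val (mem_filter.mp hx).2
          refine mem_filter.mpr ⟨x.2.1, x.2.2, ?_⟩
          rw [hh π x x.2.1, Perm.ofSubtype_apply_coe]
          exact hx'
        · obtain ⟨h1, h2, h3⟩ := mem_filter.mp hx
          refine ⟨⟨x, h1, h2⟩, mem_filter.mpr ⟨mem_univ _, Subtype.ext ?_⟩, rfl⟩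
          rw [hh π x h1, Perm.ofSubtype_apply_of_mem π (show P x from ⟨h1, h2⟩)] at h3
          exact h3
      · simp only [if_neg hg, sum_const, card_univ, Fintype.card_perm, hcard, nsmul_eq_mul]
    have hsum : ∑ π : Perm {x // P x}, ∑ g : G, W U (g * h π) =
        p.factorial * ∑ g : G, W U g := by
      rw [sum_congr rfl fun π _ ↦ Fintype.sum_equiv (Equiv.mulRight (h π))
        (fun g ↦ W U (g * h π)) (W U) fun g ↦ rfl]
      rw [sum_const, card_univ, Fintype.card_perm, hcard, nsmul_eq_mul]
    rw [sum_comm] at hsum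
    simp_rw [key, ← mul_sum] at hsum
    exact mul_left_cancel₀ (by positivity) hsum

end FiberAction

end

section

open Finset Equiv Filter Topology

namespace FiberAction

section

variable {p : ℕ}

theorem fixPoly_one : fixPoly p 1 = 1 := by
  simp [fixPoly, Fintype.card_perm, Nat.factorial_ne_zero]

theorem continuous_fixPoly : Continuous (fixPoly p) := by
  unfold fixPoly
  fun_prop

theorem fixPoly_nonneg {u : ℝ} (hu : 0 ≤ u) : 0 ≤ fixPoly p u := by
  unfold fixPoly
  positivity

theorem fixPoly_le_fixPoly {u v : ℝ} (hu : 0 ≤ u) (huv : u ≤ v) : fixPoly p u ≤ fixPoly p v := by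
  unfold fixPoly
  gcongr

theorem sum_card_fixed (hp : 0 < p) : ∑ π : Perm (Fin p), #{i | π i = i} = p.factorial := by
  classical
  have : NeZero p := ⟨hp.ne'⟩
  have h := MulAction.sum_card_fixedBy_eq_card_orbits_mul_card_group (Perm (Fin p)) (Fin p)
  have h1 : Fintype.card (Quotient (MulAction.orbitRel (Perm (Fin p)) (Fin p))) = 1 := by
    rw [Fintype.card_eq_one_iff_nonempty_unique]
    have := (MulAction.pretransitive_iff_unique_quotient_of_nonempty (Perm (Fin p)) (Fin p)).mp
      inferInstance
    exact this
  rw [h1, one_mul, Fintype.card_perm, Fintype.card_fin] at h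
  rw [← h]
  refine sum_congr rfl fun π _ ↦ ?_
  rw [Fintype.card_of_subtype]
  simp

theorem lt_fixPoly (hp : 2 ≤ p) {u : ℝ} (hu : 0 ≤ u) (hu1 : u < 1) : u < fixPoly p u := by
  have hfac : (0 : ℝ) < p.factorial := by positivity
  rw [fixPoly, lt_div_iff₀ hfac]
  have hsum : ∑ π : Perm (Fin p), (1 + (#{i | π i = i} : ℝ) * (u - 1)) = u * p.factorial := by
    rw [sum_add_distrib, ← sum_mul, ← Nat.cast_sum, sum_card_fixed (by lia)]
    simp [Fintype.card_perm]
    ring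
  rw [← hsum]
  refine sum_lt_sum (fun π _ ↦ ?_) ⟨1, mem_univ _, ?_⟩
  · have := one_add_mul_le_pow (show -2 ≤ u - 1 by linarith) #{i | π i = i}
    rwa [add_sub_cancel] at this
  · obtain ⟨m, rfl⟩ := Nat.exists_eq_add_of_le' (Nat.one_le_of_lt hp)
    have h1 := one_add_mul_le_pow (show -2 ≤ u - 1 by linarith) m
    have hm : (1 : ℝ) ≤ m := by exact_mod_cast Nat.le_of_succ_le_succ hp
    have h2 := mul_le_mul_of_nonneg_left h1 hu
    have h3 : 0 < (1 - u) ^ 2 := pow_pos (by linarith) 2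
    simp only [Perm.coe_one, id_eq, filter_true, card_univ, Fintype.card_fin, pow_succ']
    rw [add_sub_cancel] at h2
    push_cast
    nlinarith

theorem tendsto_iterate_fixPoly (hp : 2 ≤ p) :
    Tendsto (fun n ↦ (fixPoly p)^[n] 0) atTop (𝓝 1) := by
  have h01 (n : ℕ) : 0 ≤ (fixPoly p)^[n] 0 ∧ (fixPoly p)^[n] 0 ≤ 1 := by
    induction n with
    | zero => simp
    | succ n ih =>
      rw [Function.iterate_succ_apply']
      exact ⟨fixPoly_nonneg ih.1, (fixPoly_le_fixPoly ih.1 ih.2).trans_eq fixPoly_one⟩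
  have hmono : Monotone fun n ↦ (fixPoly p)^[n] 0 := by
    refine monotone_nat_of_le_succ fun n ↦ ?_
    rw [Function.iterate_succ_apply']
    rcases (h01 n).2.lt_or_eq with h | h
    · exact (lt_fixPoly hp (h01 n).1 h).le
    · rw [h, fixPoly_one]
  have hbdd : BddAbove (Set.range fun n ↦ (fixPoly p)^[n] 0) :=
    ⟨1, by rintro _ ⟨n, rfl⟩; exact (h01 n).2⟩
  have hlim := tendsto_atTop_ciSup hmono hbdd
  set L := ⨆ n, (fixPoly p)^[n] 0
  have hfix := isFixedPt_of_tendsto_iterate hlim continuous_fixPoly.continuousAt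
  have hL0 : 0 ≤ L := ge_of_tendsto' hlim fun n ↦ (h01 n).1
  have hL1 : L ≤ 1 := le_of_tendsto' hlim fun n ↦ (h01 n).2
  rcases hL1.lt_or_eq with h | h
  · exact absurd hfix (lt_fixPoly hp hL0 h).ne'
  · rwa [h] at hlim

end

variable {G X : Type*} [Group G] [MulAction G X] [DecidableEq X]

theorem card_exists_fixedPoint_eq [Fintype G] {F : X → X}
    (hF : ∀ (g : G) x, F (g • x) = g • F x) {R : ℕ → Finset X} {N p : ℕ} (hp : 0 < p)
    (hR : ∀ n, ∀ g : G, ∀ x ∈ R n, g • x ∈ R n) (hFR : ∀ n < N, ∀ x ∈ R (n + 1), F x ∈ R n)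
    (hR0 : ∀ g : G, ∀ x ∈ R 0, g • x = x) (hcard0 : #(R 0) = 1)
    (hfib : ∀ n < N, ∀ y ∈ R n, #{w ∈ R (n + 1) | F w = y} = p)
    (hswap : ∀ n < N, ∀ x ∈ R (n + 1), ∀ y ∈ R (n + 1), F x = F y →
      swap x y ∈ realized (hR (n + 1))) :
    (#{g : G | ∃ x ∈ R N, g • x = x} : ℝ) = Fintype.card G * (1 - (fixPoly p)^[N] 0) := by
  have key (n : ℕ) (hn : n ≤ N) : ∀ u : ℝ, ∑ g : G, u ^ #{x ∈ R n | g • x = x} =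
      Fintype.card G * (fixPoly p)^[n] u := by
    induction n with
    | zero =>
      intro u
      have h0 (g : G) : {x ∈ R 0 | g • x = x} = R 0 := filter_true_of_mem (hR0 g)
      simp [h0, hcard0]
    | succ n ih =>
      intro u
      rw [sum_pow_card_fixedPoints_eq hF (hR (n + 1)) (hFR n hn) hp (hfib n hn) (hswap n hn),
        ih (Nat.le_of_succ_le hn), Function.iterate_succ_apply]
  have h1 := key N le_rfl 0
  have h2 (g : G) : (0 : ℝ) ^ #{x ∈ R N | g • x = x} =
      1 - if ∃ x ∈ R N, g • x = x then 1 else 0 := by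
    split_ifs with h
    · obtain ⟨x, hx, hgx⟩ := h
      rw [zero_pow, sub_self]
      exact card_ne_zero_of_mem (mem_filter.mpr ⟨hx, hgx⟩)
    · rw [card_eq_zero.mpr (filter_eq_empty_iff.mpr fun x hx hgx ↦ h ⟨x, hx, hgx⟩)]
      simp
  simp_rw [h2] at h1
  rw [sum_sub_distrib, sum_boole, sum_const, card_univ, nsmul_one] at h1
  linarith

theorem smul_eq_of_pow_factorial_pow {F : X → X}
    (hF : ∀ (g : G) x, F (g • x) = g • F x) {R : ℕ → Finset X} {N p : ℕ}
    (hR : ∀ n, ∀ g : G, ∀ x ∈ R n, g • x ∈ R n) (hFR : ∀ n < N, ∀ x ∈ R (n + 1), F x ∈ R n)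
    (hR0 : ∀ g : G, ∀ x ∈ R 0, g • x = x)
    (hfib : ∀ n < N, ∀ y ∈ R n, #{w ∈ R (n + 1) | F w = y} = p) (σ : G) {n : ℕ} (hn : n ≤ N) :
    ∀ x ∈ R n, σ ^ p.factorial ^ n • x = x := by
  induction n with
  | zero => exact hR0 _
  | succ n ih =>
    intro x hx
    have ih' := ih (Nat.le_of_succ_le hn)
    rw [pow_succ, pow_mul]
    set τ := σ ^ p.factorial ^ n
    have hfix := ih' (F x) (hFR n hn x hx)
    set P : X → Prop := fun w ↦ w ∈ R (n + 1) ∧ F w = F x with hP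
    let _ : Fintype {x // P x} :=
      Fintype.subtype {w ∈ R (n + 1) | F w = F x} fun x ↦ mem_filter
    have hcard : Fintype.card {x // P x} = p := by
      rw [Fintype.card_of_subtype {w ∈ R (n + 1) | F w = F x} fun x ↦ mem_filter,
        hfib n hn _ (hFR n hn x hx)]
    have hstab (w : X) : P (MulAction.toPerm τ w) ↔ P w := by
      refine ⟨fun hw ↦ ⟨?_, ?_⟩, fun hw ↦ ⟨hR _ τ w hw.1, ?_⟩⟩
      · have := hR _ τ⁻¹ _ hw.1
        rwa [MulAction.toPerm_apply, inv_smul_smul] at this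
      · have := hw.2
        rw [MulAction.toPerm_apply, hF] at this
        exact MulAction.injective τ (this.trans hfix.symm)
      · rw [MulAction.toPerm_apply, hF, hw.2, hfix]
    set γ : Perm {x // P x} := (MulAction.toPerm τ : Perm X).subtypePerm hstab with hγ
    have hγ1 : γ ^ p.factorial = 1 := by
      rw [← hcard, ← Fintype.card_perm]
      exact pow_card_eq_one
    have h1 := congrArg Subtype.val (Equiv.congr_fun hγ1 ⟨x, hx, rfl⟩)
    rw [hγ, Perm.subtypePerm_pow] at h1
    have h2 : (MulAction.toPerm τ ^ p.factorial : Perm X) = MulAction.toPerm (τ ^ p.factorial) :=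
      (map_pow (MulAction.toPermHom G X) τ _).symm
    simpa [h2] using h1

end FiberAction

theorem Nat.le_factorial_mul_totient {n p N : ℕ} (hn : n ∣ p.factorial ^ N) :
    n ≤ p.factorial * n.totient := by
  have h1 := Nat.totient_mul_prod_primeFactors n
  have hdvd : ∏ q ∈ n.primeFactors, q ∣ p.factorial :=
    Finset.prod_primes_dvd _ (fun q hq ↦ (Nat.prime_of_mem_primeFactors hq).prime) fun q hq ↦
      (Nat.prime_of_mem_primeFactors hq).dvd_of_dvd_pow
        ((Nat.dvd_of_mem_primeFactors hq).trans hn)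
  have hpos : 0 < ∏ q ∈ n.primeFactors, (q - 1) :=
    Finset.prod_pos fun q hq ↦ Nat.sub_pos_of_lt (Nat.prime_of_mem_primeFactors hq).one_lt
  calc n ≤ n * ∏ q ∈ n.primeFactors, (q - 1) := Nat.le_mul_of_pos_right n hpos
    _ = (∏ q ∈ n.primeFactors, q) * n.totient := by rw [← h1, mul_comm]
    _ ≤ _ := Nat.mul_le_mul_right _ (Nat.le_of_dvd p.factorial_pos hdvd)

end

section

/-- The polynomial `x ^ p + k p x ^ (p - 1) - k p`. -/
noncomputable def phi (p k : ℕ) : ℤ[X] :=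
  X ^ p + C ((k : ℤ) * p) * X ^ (p - 1) - C ((k : ℤ) * p)

/-- The function defined by `phi p k` on a commutative ring. -/
def phiMap (p k : ℕ) {A : Type*} [CommRing A] (x : A) : A :=
  x ^ p + k * p * x ^ (p - 1) - k * p

section

variable {p k : ℕ} {A B : Type*} [CommRing A] [CommRing B]

theorem aeval_phi (x : A) : aeval x (phi p k) = phiMap p k x := by
  simp [phi, phiMap]

theorem aeval_polyIter_phi (n : ℕ) (x : A) :
    aeval x (polyIter (phi p k) n) = (phiMap p k)^[n] x := by
  induction n with
  | zero => simp [polyIter]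
  | succ n ih => rw [polyIter, aeval_comp, ih, aeval_phi, Function.iterate_succ_apply']

theorem map_phiMap (f : A →+* B) (x : A) : f (phiMap p k x) = phiMap p k (f x) := by
  simp [phiMap]

theorem map_iterate_phiMap (f : A →+* B) (n : ℕ) (x : A) :
    f ((phiMap p k)^[n] x) = (phiMap p k)^[n] (f x) :=
  (Function.Semiconj.iterate_right (f := f) (map_phiMap f) n) x

theorem phiMap_zero (hp : 2 ≤ p) : phiMap p k (0 : A) = -(k * p) := by
  simp [phiMap, show p ≠ 0 by lia, show p - 1 ≠ 0 by lia]

theorem phiMap_neg_mul (hp : 2 ≤ p) (hodd : Odd p) : phiMap p k (-(k * p) : A) = -(k * p) := by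
  obtain ⟨m, rfl⟩ := Nat.exists_eq_add_of_le' (Nat.one_le_of_lt hp)
  simp only [phiMap, Nat.add_sub_cancel, pow_succ]
  ring

theorem iterate_phiMap_zero (hp : 2 ≤ p) (hodd : Odd p) {n : ℕ} (hn : n ≠ 0) :
    (phiMap p k)^[n] (0 : A) = -(k * p) := by
  obtain ⟨n, rfl⟩ := Nat.exists_eq_succ_of_ne_zero hn
  rw [Function.iterate_succ_apply, phiMap_zero hp]
  exact Function.iterate_fixed (phiMap_neg_mul hp hodd) n

theorem natDegree_phi (hp : 2 ≤ p) : (phi p k).natDegree = p := by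
  unfold phi
  compute_degree!
  simp [show p ≠ 0 by lia]

theorem monic_phi (hp : 2 ≤ p) : (phi p k).Monic := by
  rw [Monic, leadingCoeff, natDegree_phi hp]
  rw [phi, coeff_sub, coeff_add, coeff_C_mul, coeff_X_pow, coeff_X_pow, coeff_C, if_pos rfl,
    if_neg (by lia), if_neg (by lia)]
  simp

theorem natDegree_polyIter {φ : ℤ[X]} (n : ℕ) : (polyIter φ n).natDegree = φ.natDegree ^ n := by
  induction n with
  | zero => simp [polyIter]
  | succ n ih => rw [polyIter, natDegree_comp, ih, pow_succ']

theorem monic_polyIter {φ : ℤ[X]} (hφ : φ.Monic) (h0 : φ.natDegree ≠ 0) (n : ℕ) :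
    (polyIter φ n).Monic := by
  induction n with
  | zero => exact monic_X
  | succ n ih =>
    refine hφ.comp ih ?_
    rw [natDegree_polyIter]
    exact pow_ne_zero n h0

theorem map_polyIter {R S : Type*} [CommRing R] [CommRing S] (f : R →+* S) (φ : R[X]) (n : ℕ) :
    (polyIter φ n).map f = polyIter (φ.map f) n := by
  induction n with
  | zero => simp [polyIter]
  | succ n ih => rw [polyIter, map_comp, ih, polyIter]

theorem polyIter_X_pow {R : Type*} [CommRing R] (p n : ℕ) :
    polyIter (X ^ p : R[X]) n = X ^ p ^ n := by
  induction n with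
  | zero => simp [polyIter]
  | succ n ih => rw [polyIter, ih, X_pow_comp, ← pow_mul, pow_succ]

theorem irreducible_polyIter_phi (hp : p.Prime) (hodd : Odd p) (hpk : ¬ p ∣ k) (n : ℕ) :
    Irreducible ((polyIter (phi p k) n).map (Int.castRingHom ℚ)) := by
  rcases eq_or_ne n 0 with rfl | hn
  · simpa [polyIter] using irreducible_X
  have hmonic : (polyIter (phi p k) n).Monic :=
    monic_polyIter (monic_phi hp.two_le) (by rw [natDegree_phi hp.two_le]; exact hp.ne_zero) n
  have hdeg : (polyIter (phi p k) n).natDegree = p ^ n := by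
    rw [natDegree_polyIter, natDegree_phi hp.two_le]
  refine (hmonic.irreducible_iff_irreducible_map_fraction_map (K := ℚ)).mp ?_
  have hpZ : Prime (p : ℤ) := Nat.prime_iff_prime_int.mp hp
  have hP : (Ideal.span {(p : ℤ)}).IsPrime := (Ideal.span_singleton_prime hpZ.ne_zero).mpr hpZ
  refine irreducible_of_eisenstein_criterion hP ?_ ?_ ?_ ?_ hmonic.isPrimitive
  · rw [hmonic.leadingCoeff, ← Ideal.eq_top_iff_one]
    exact hP.ne_top
  · intro m hm
    have hm' : m ≠ p ^ n := by
      rintro rfl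
      rw [← hdeg] at hm
      exact absurd degree_le_natDegree (not_le.mpr hm)
    have hmod : (polyIter (phi p k) n).map (Int.castRingHom (ZMod p)) = X ^ p ^ n := by
      rw [map_polyIter, ← polyIter_X_pow]
      simp [phi]
    have hcoeff := congrArg (coeff · m) hmod
    rw [coeff_map, coeff_X_pow, if_neg hm', eq_intCast] at hcoeff
    rw [Ideal.mem_span_singleton]
    exact (ZMod.intCast_zmod_eq_zero_iff_dvd _ _).mp hcoeff
  · rw [← natDegree_pos_iff_degree_pos, hdeg]
    exact pow_pos hp.pos n
  · rw [coeff_zero_eq_aeval_zero, aeval_polyIter_phi, iterate_phiMap_zero hp.two_le hodd hn,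
      Ideal.span_singleton_pow, Ideal.mem_span_singleton, dvd_neg, sq,
      mul_dvd_mul_iff_right hpZ.ne_zero]
    exact_mod_cast hpk

theorem derivative_polyIter {φ : ℤ[X]} (n : ℕ) : derivative (polyIter φ n) =
    ∏ i ∈ Finset.range n, (derivative φ).comp (polyIter φ i) := by
  induction n with
  | zero => simp [polyIter]
  | succ n ih => rw [polyIter, derivative_comp, ih, Finset.prod_range_succ]

theorem derivative_phi (hp : 2 ≤ p) :
    derivative (phi p k) = C (p : ℤ) * X ^ (p - 2) * (X + C ((k : ℤ) * (p - 1 : ℕ))) := by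
  obtain ⟨m, rfl⟩ := Nat.exists_eq_add_of_le' hp
  simp [phi]
  ring

end

end

section

variable {p k : ℕ} {A : Type*} [CommRing A]

theorem aeval_derivative_polyIter_phi (hp : 2 ≤ p) (n : ℕ) (x : A) :
    aeval x (derivative (polyIter (phi p k) n)) = ∏ i ∈ Finset.range n,
      ((p : A) * (phiMap p k)^[i] x ^ (p - 2) * ((phiMap p k)^[i] x - -(k * (p - 1 : ℕ)))) := by
  rw [derivative_polyIter, map_prod]
  refine Finset.prod_congr rfl fun i _ ↦ ?_
  rw [aeval_comp, aeval_polyIter_phi, derivative_phi hp]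
  simp

theorem aeval_derivative_polyIter_phi_critical (hp : 2 ≤ p) {n : ℕ} (hn : n ≠ 0) :
    aeval (-(k * (p - 1 : ℕ)) : A) (derivative (polyIter (phi p k) n)) = 0 := by
  rw [aeval_derivative_polyIter_phi hp]
  exact Finset.prod_eq_zero (Finset.mem_range.mpr (Nat.pos_of_ne_zero hn)) (by simp)

section

variable [IsDomain A]

theorem iterate_phiMap_ne_zero (hp : 2 ≤ p) (hodd : Odd p) (hpA : (p : A) ≠ 0) (hkA : (k : A) ≠ 0)
    {n i : ℕ} (hi : i < n) {x : A} (hx : (phiMap p k)^[n] x = 0) : (phiMap p k)^[i] x ≠ 0 := by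
  intro h
  obtain ⟨m, rfl⟩ := Nat.exists_eq_add_of_lt hi
  rw [show i + m + 1 = (m + 1) + i by ring, Function.iterate_add_apply, h,
    iterate_phiMap_zero hp hodd (Nat.succ_ne_zero m)] at hx
  exact mul_ne_zero hkA hpA (neg_eq_zero.mp hx)

theorem iterate_phiMap_ne_critical (hp : 2 ≤ p) (hodd : Odd p) (hpA : (p : A) ≠ 0)
    (hkA : (k : A) ≠ 0) {n i : ℕ} (hi0 : i ≠ 0) (hi : i < n) {x : A}
    (hγ : (phiMap p k)^[n] (-(k * (p - 1 : ℕ)) : A) = 0) (hx : (phiMap p k)^[n] x = 0) :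
    (phiMap p k)^[i] x ≠ -(k * (p - 1 : ℕ)) := by
  intro h
  refine iterate_phiMap_ne_zero hp hodd hpA hkA (i := n - i) (by lia) hγ ?_
  rw [← h, ← Function.iterate_add_apply, Nat.sub_add_cancel hi.le, hx]

theorem aeval_derivative_polyIter_phi_ne_zero (hp : 2 ≤ p) (hodd : Odd p) (hpA : (p : A) ≠ 0)
    (hkA : (k : A) ≠ 0) {n : ℕ} {x : A} (hγ : (phiMap p k)^[n] (-(k * (p - 1 : ℕ)) : A) = 0)
    (hx : (phiMap p k)^[n] x = 0) (hxγ : x ≠ -(k * (p - 1 : ℕ))) :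
    aeval x (derivative (polyIter (phi p k) n)) ≠ 0 := by
  rw [aeval_derivative_polyIter_phi hp, Finset.prod_ne_zero_iff]
  intro i hi
  rw [Finset.mem_range] at hi
  refine mul_ne_zero (mul_ne_zero hpA (pow_ne_zero _ ?_)) (sub_ne_zero.mpr ?_)
  · exact iterate_phiMap_ne_zero hp hodd hpA hkA hi hx
  · rcases eq_or_ne i 0 with rfl | hi0
    · exact hxγ
    · exact iterate_phiMap_ne_critical hp hodd hpA hkA hi0 hi hγ hx

theorem aeval_derivative_derivative_polyIter_phi_ne_zero (hp : 2 ≤ p) (hodd : Odd p)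
    (hpA : (p : A) ≠ 0) (hkA : (k : A) ≠ 0) {n : ℕ} (hn : n ≠ 0)
    (hγ : (phiMap p k)^[n] (-(k * (p - 1 : ℕ)) : A) = 0) :
    aeval (-(k * (p - 1 : ℕ)) : A) (derivative (derivative (polyIter (phi p k) n))) ≠ 0 := by
  obtain ⟨n, rfl⟩ := Nat.exists_eq_succ_of_ne_zero hn
  have hfactor : derivative (polyIter (phi p k) (n + 1)) = (X + C ((k : ℤ) * (p - 1 : ℕ))) *
      (C (p : ℤ) * X ^ (p - 2) *
        ∏ i ∈ Finset.range n, (derivative (phi p k)).comp (polyIter (phi p k) (i + 1))) := by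
    rw [derivative_polyIter, Finset.prod_range_succ', polyIter, comp_X, derivative_phi hp]
    ring
  have hvalue :
      aeval (-(k * (p - 1 : ℕ)) : A) (derivative (derivative (polyIter (phi p k) (n + 1)))) =
        p * (-(k * (p - 1 : ℕ)) : A) ^ (p - 2) * ∏ i ∈ Finset.range n,
        ((p : A) * (phiMap p k)^[i + 1] (-(k * (p - 1 : ℕ)) : A) ^ (p - 2) *
          ((phiMap p k)^[i + 1] (-(k * (p - 1 : ℕ)) : A) - -(k * (p - 1 : ℕ)))) := by
    rw [hfactor, derivative_mul, map_add, map_mul, map_mul, map_mul, map_prod]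
    simp only [aeval_comp, aeval_polyIter_phi, derivative_phi hp]
    simp
  rw [hvalue]
  refine mul_ne_zero (mul_ne_zero hpA (pow_ne_zero _ ?_))
    (Finset.prod_ne_zero_iff.mpr fun i hi ↦ ?_)
  · exact iterate_phiMap_ne_zero hp hodd hpA hkA (i := 0) (by lia) hγ
  · rw [Finset.mem_range] at hi
    refine mul_ne_zero (mul_ne_zero hpA (pow_ne_zero _ ?_)) (sub_ne_zero.mpr ?_)
    · exact iterate_phiMap_ne_zero hp hodd hpA hkA (by lia) hγ
    · exact iterate_phiMap_ne_critical hp hodd hpA hkA (by lia) (by lia) hγ hγ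

end

end

theorem Nat.exists_prime_odd_pow_mul_of_not_isSquare {n : ℕ} (hn : ¬ IsSquare n) :
    ∃ ℓ m u : ℕ, ℓ.Prime ∧ Odd m ∧ n = ℓ ^ m * u ∧ ¬ ℓ ∣ u := by
  obtain ⟨a, b, hab, ha⟩ := Nat.sq_mul_squarefree n
  have hn0 : n ≠ 0 := by
    rintro rfl
    exact hn ⟨0, rfl⟩
  have hb0 : b ≠ 0 := by
    rintro rfl
    simp at hab
    exact hn0 hab.symm
  have ha1 : a ≠ 1 := by
    rintro rfl
    exact hn ⟨b, by rw [← hab]; ring⟩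
  have hℓ : a.minFac.Prime := Nat.minFac_prime ha1
  obtain ⟨a', ha'⟩ := Nat.minFac_dvd a
  generalize a.minFac = ℓ at hℓ ha'
  obtain ⟨j, b', hb', hbj⟩ := Nat.exists_eq_pow_mul_and_not_dvd hb0 ℓ hℓ.ne_one
  refine ⟨ℓ, 2 * j + 1, b' ^ 2 * a', hℓ, ⟨j, rfl⟩, ?_, ?_⟩
  · rw [← hab, ha', hbj]
    ring
  · intro h
    rcases hℓ.dvd_mul.mp h with h | h
    · exact hb' (hℓ.dvd_of_dvd_pow h)
    · obtain ⟨w, rfl⟩ := h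
      exact hℓ.not_isUnit (ha ℓ ⟨w, by rw [ha']; ring⟩)

section

variable {p k : ℕ}

/-- The value of `phi p k` at `k c`, divided by `k`. -/
def quotStep (p k : ℕ) (c : ℤ) : ℤ := (k * c) ^ (p - 1) * (c + p) - p

theorem phiMap_mul (hp : 2 ≤ p) (c : ℤ) : phiMap p k (k * c : ℤ) = k * quotStep p k c := by
  obtain ⟨m, rfl⟩ := Nat.exists_eq_add_of_le' (Nat.one_le_of_lt hp)
  simp only [phiMap, quotStep, Nat.add_sub_cancel, pow_succ]
  ring

theorem iterate_phiMap_mul (hp : 2 ≤ p) (n : ℕ) (c : ℤ) :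
    (phiMap p k)^[n] (k * c : ℤ) = k * (quotStep p k)^[n] c :=
  ((Function.Semiconj.iterate_right (f := fun c : ℤ ↦ (k * c : ℤ))
    (fun c ↦ (phiMap_mul hp c).symm) n) c).symm

theorem quotStep_pos (hk : 0 < k) {c : ℤ} (hc : 0 < c) : 0 < quotStep p k c := by
  have h : (1 : ℤ) ≤ (k * c) ^ (p - 1) := by
    have : (0 : ℤ) < (k * c) ^ (p - 1) := by positivity
    lia
  unfold quotStep
  nlinarith

theorem dvd_quotStep_add (hp : 2 ≤ p) (c : ℤ) : (k : ℤ) ∣ quotStep p k c + p := by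
  rw [quotStep, sub_add_cancel]
  exact ((dvd_mul_right _ _).trans (dvd_pow_self _ (by lia))).mul_right _

theorem dvd_quotStep_sub_one (hp : p.Prime) (hpk : ¬ p ∣ k) {c : ℤ} (hc : (p : ℤ) ∣ c - 1) :
    (p : ℤ) ∣ quotStep p k c - 1 := by
  have := Fact.mk hp
  rw [← ZMod.intCast_zmod_eq_zero_iff_dvd] at hc ⊢
  have hk : (k : ZMod p) ≠ 0 := by rwa [Ne, ZMod.natCast_eq_zero_iff]
  push_cast [sub_eq_zero] at hc
  simp [quotStep, hc, ZMod.pow_card_sub_one_eq_one hk]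

theorem quotStep_cast_zmod_three (hp : 2 ≤ p) (hodd : Odd p) (hk : (k : ZMod 3) = 1) {c : ℤ}
    (hc : (c : ZMod 3) = 2 ∨ (c : ZMod 3) = 0 ∧ (p : ZMod 3) = 1) :
    (quotStep p k c : ZMod 3) = 2 := by
  obtain ⟨m, rfl⟩ := hodd
  have hm : m ≠ 0 := by lia
  rcases hc with hc | ⟨hc, hp1⟩
  · have h4 : (2 : ZMod 3) ^ 2 = 1 := by decide
    simp [quotStep, hc, hk, pow_mul, h4]
  · push_cast at hp1
    simp only [quotStep, Int.cast_sub, Int.cast_mul, Int.cast_pow, hc, mul_zero, Nat.add_sub_cancel,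
      zero_pow (mul_ne_zero two_ne_zero hm), zero_mul, Int.cast_natCast]
    push_cast
    rw [hp1]
    decide

theorem iterate_quotStep_cast_zmod_three (hp : 2 ≤ p) (hodd : Odd p) (hp3 : ¬ 3 ∣ p)
    (hk : (k : ZMod 3) = 1) {n : ℕ} (hn : n ≠ 0) :
    ((quotStep p k)^[n] (1 - p) : ZMod 3) = 2 := by
  obtain ⟨n, rfl⟩ := Nat.exists_eq_succ_of_ne_zero hn
  induction n with
  | zero =>
    refine quotStep_cast_zmod_three hp hodd hk ?_
    rw [← ZMod.natCast_eq_zero_iff] at hp3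
    push_cast
    generalize (p : ZMod 3) = x at hp3
    decide +revert
  | succ n ih =>
    rw [Function.iterate_succ_apply']
    exact quotStep_cast_zmod_three hp hodd hk (Or.inl (ih n.succ_ne_zero))

theorem iterate_quotStep_cast_zmod_five (n : ℕ) :
    (((quotStep 3 2)^[n] (-2) : ℤ) : ZMod 5) = 3 := by
  induction n with
  | zero => decide
  | succ n ih =>
    rw [Function.iterate_succ_apply', quotStep]
    push_cast
    rw [ih]
    decide

theorem iterate_quotStep_pos (hp : 3 ≤ p) (hodd : Odd p) (hk : 0 < k) {n : ℕ} (hn : n ≠ 0) :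
    0 < (quotStep p k)^[n] (1 - p) := by
  obtain ⟨n, rfl⟩ := Nat.exists_eq_succ_of_ne_zero hn
  induction n with
  | zero =>
    obtain ⟨m, rfl⟩ := hodd
    simp only [Function.iterate_one, quotStep, Nat.add_sub_cancel]
    have hm : m ≠ 0 := by lia
    have hsq : (1 : ℤ) ≤ (k * (1 - (2 * m + 1 : ℕ))) ^ 2 := by
      have : (k * (1 - (2 * m + 1 : ℕ)) : ℤ) ≠ 0 := by
        refine mul_ne_zero (by lia) (by lia)
      have := sq_pos_of_ne_zero this
      lia
    have hle : ((k * (1 - (2 * m + 1 : ℕ))) ^ 2 : ℤ) ≤ (k * (1 - (2 * m + 1 : ℕ))) ^ (2 * m) :=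
      by
      rw [pow_mul]
      exact le_self_pow₀ hsq hm
    have hk1 : (1 : ℤ) ≤ k := by lia
    have hm1 : (1 : ℤ) ≤ m := by lia
    push_cast at hle ⊢
    nlinarith [mul_le_mul hk1 hk1 zero_le_one (by lia), sq_nonneg (m : ℤ)]
  | succ n ih =>
    rw [Function.iterate_succ_apply']
    exact quotStep_pos hk (ih n.succ_ne_zero)

theorem not_isSquare_iterate_quotStep (hp : p.Prime)
    (hcase : (5 ≤ p ∧ k % 3 = 1) ∨ (p = 3 ∧ k = 2)) {n : ℕ} (hn : n ≠ 0) :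
    ¬ IsSquare ((quotStep p k)^[n] (1 - p)) := by
  rintro ⟨b, hb⟩
  rcases hcase with ⟨hp5, hk⟩ | ⟨rfl, rfl⟩
  · have h := iterate_quotStep_cast_zmod_three hp.two_le (hp.odd_of_ne_two (by lia)) (k := k)
      (fun h ↦ by rw [Nat.prime_dvd_prime_iff_eq Nat.prime_three hp] at h; lia)
      (by rw [← Nat.cast_one, ZMod.natCast_eq_natCast_iff]; exact hk) hn
    rw [hb, Int.cast_mul] at h
    generalize (b : ZMod 3) = x at h
    revert x
    decide
  · have h := iterate_quotStep_cast_zmod_five n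
    norm_num at hb
    rw [hb, Int.cast_mul] at h
    generalize (b : ZMod 5) = x at h
    revert x
    decide

theorem exists_prime_odd_pow_iterate_phiMap_critical (hp : p.Prime) (hk : 0 < k) (hpk : ¬ p ∣ k)
    (hcase : (5 ≤ p ∧ k % 3 = 1) ∨ (p = 3 ∧ k = 2)) {n : ℕ} (hn : n ≠ 0) :
    ∃ (ℓ m : ℕ) (u : ℤ), ℓ.Prime ∧ ¬ ℓ ∣ k ∧ ¬ ℓ ∣ p ∧ Odd m ∧
      (phiMap p k)^[n] (-(k * (p - 1 : ℕ)) : ℤ) = ℓ ^ m * u ∧ ¬ (ℓ : ℤ) ∣ u := by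
  have hp3 : 3 ≤ p := by lia
  have hpos := iterate_quotStep_pos hp3 (hp.odd_of_ne_two (by lia)) hk hn
  have hsq := not_isSquare_iterate_quotStep hp hcase hn
  have hvalue : (phiMap p k)^[n] (-(k * (p - 1 : ℕ)) : ℤ) = k * (quotStep p k)^[n] (1 - p) := by
    rw [← iterate_phiMap_mul hp.two_le]
    push_cast [hp.one_le]
    ring_nf
  have hmodk : (k : ℤ) ∣ (quotStep p k)^[n] (1 - p) + p := by
    obtain ⟨n, rfl⟩ := Nat.exists_eq_succ_of_ne_zero hn
    rw [Function.iterate_succ_apply']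
    exact dvd_quotStep_add hp.two_le _
  have hmodp : (p : ℤ) ∣ (quotStep p k)^[n] (1 - p) - 1 :=
    Function.Iterate.rec (fun c ↦ (p : ℤ) ∣ c - 1) (by simp)
      (fun _ h ↦ dvd_quotStep_sub_one hp hpk h) n
  lift (quotStep p k)^[n] (1 - p) to ℕ using hpos.le with c
  obtain ⟨ℓ, m, u, hℓ, hm, hc, hu⟩ := Nat.exists_prime_odd_pow_mul_of_not_isSquare
    (fun h : IsSquare c ↦ hsq (h.map (Nat.castRingHom ℤ)))
  have hℓc : (ℓ : ℤ) ∣ c := by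
    rw [hc]
    exact_mod_cast (dvd_pow_self _ hm.pos.ne').mul_right _
  have hℓp : ¬ ℓ ∣ p := by
    intro h
    rw [Nat.prime_dvd_prime_iff_eq hℓ hp] at h
    subst h
    have := (dvd_sub_right hℓc).mp hmodp
    exact hℓ.not_dvd_one (by exact_mod_cast this)
  have hℓk : ¬ ℓ ∣ k := by
    intro h
    have := (dvd_add_right hℓc).mp ((Int.natCast_dvd_natCast.mpr h).trans hmodk)
    exact hℓp (by exact_mod_cast this)
  refine ⟨ℓ, m, k * u, hℓ, hℓk, hℓp, hm, ?_, ?_⟩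
  · rw [hvalue, hc]
    push_cast
    ring
  · intro h
    rcases hℓ.dvd_mul.mp (by exact_mod_cast h) with h | h
    · exact hℓk h
    · exact hu h

end

section

open Polynomial NumberField IsDedekindDomain

theorem IsDedekindDomain.HeightOneSpectrum.intValuation_eq_of_add_mul_add_mul_eq_zero
    {A : Type*} [CommRing A] [IsDedekindDomain A] (v : HeightOneSpectrum A) {a b c d : A}
    (ha : a ∈ v.asIdeal) (hb : b ∈ v.asIdeal) (hc : c ∉ v.asIdeal)
    (h : (a + b) * c + a * b * d = 0) : v.intValuation a = v.intValuation b := by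
  by_contra hne
  rw [← v.intValuation_lt_one_iff_mem] at ha hb hc
  have hc1 : v.intValuation c = 1 := le_antisymm (v.intValuation_le_one c) (not_lt.mp hc)
  have hmax := v.intValuation.map_add_of_distinct_val hne
  have heq : v.intValuation (a + b) = v.intValuation a * v.intValuation b * v.intValuation d := by
    rw [← map_mul, ← map_mul, ← Valuation.map_neg _ (a * b * d),
      ← eq_neg_of_add_eq_zero_left h, map_mul, hc1, mul_one]
  have hle : max (v.intValuation a) (v.intValuation b) ≤ v.intValuation a * v.intValuation b := by
    rw [← hmax, heq]
    exact mul_le_of_le_one_right' (v.intValuation_le_one d)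
  rcases lt_or_gt_of_ne hne with hlt | hlt
  · rw [max_eq_right hlt.le] at hle
    exact absurd hle (not_le.mpr (mul_lt_of_lt_one_left (zero_le.trans_lt hlt) ha))
  · rw [max_eq_left hlt.le] at hle
    exact absurd hle (not_le.mpr (mul_lt_of_lt_one_right (zero_le.trans_lt hlt) hb))

theorem IsDedekindDomain.HeightOneSpectrum.even_of_mul_mul_eq_pow_mul {A : Type*} [CommRing A]
    [IsDedekindDomain A] (v : HeightOneSpectrum A) {a b c u ℓ : A} {m : ℕ}
    (hab : v.intValuation a = v.intValuation b) (hc : c ∉ v.asIdeal) (hu : u ∉ v.asIdeal)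
    (hℓ : ℓ ∈ v.asIdeal) (hℓ2 : ℓ ∉ v.asIdeal ^ 2) (h : a * b * c = ℓ ^ m * u) : Even m := by
  have hc1 : v.intValuation c = 1 := v.intValuation_eq_one_iff_mem_primeCompl c |>.mpr hc
  have hu1 : v.intValuation u = 1 := v.intValuation_eq_one_iff_mem_primeCompl u |>.mpr hu
  have hℓ0 : ℓ ≠ 0 := fun h ↦ hℓ2 (h ▸ zero_mem _)
  have hlog : WithZero.log (v.intValuation ℓ) = -1 := by
    have hne := v.intValuation_ne_zero ℓ hℓ0
    rw [← pow_one v.asIdeal, ← v.intValuation_le_pow_iff_mem,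
      ← WithZero.log_le_iff_le_exp hne] at hℓ
    rw [← v.intValuation_le_pow_iff_mem, ← WithZero.log_le_iff_le_exp hne] at hℓ2
    push_cast at hℓ hℓ2
    lia
  have h1 := congrArg (fun x ↦ WithZero.log (v.intValuation x)) h
  simp only [map_mul, map_pow, hc1, hu1, mul_one, ← hab] at h1
  rw [← sq, WithZero.log_pow, WithZero.log_pow, hlog] at h1
  simp only [nsmul_eq_mul] at h1
  push_cast at h1
  rw [Nat.even_iff]
  lia

variable {L : Type*} [Field L] [NumberField L] [IsGalois ℚ L]

theorem notMem_sq_of_inertia_eq_bot {ℓ : ℕ} (hℓ : ℓ.Prime) {Q : Ideal (𝓞 L)} [Q.IsPrime]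
    (hQ : (ℓ : 𝓞 L) ∈ Q) (hI : Q.inertia Gal(L/ℚ) = ⊥) : (ℓ : 𝓞 L) ∉ Q ^ 2 := by
  have hℓ0 : (ℓ : ℤ) ≠ 0 := by exact_mod_cast hℓ.ne_zero
  have hprime : (Ideal.span {(ℓ : ℤ)}).IsPrime :=
    (Ideal.span_singleton_prime hℓ0).mpr (Nat.prime_iff_prime_int.mp hℓ)
  have hlies : Q.LiesOver (Ideal.span {(ℓ : ℤ)}) :=
    (Ideal.liesOver_span_iff Ideal.IsPrime.ne_top' (Nat.prime_iff_prime_int.mp hℓ)).mpr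
      (by simpa using hQ)
  have hmax : (Ideal.span {(ℓ : ℤ)}).IsMaximal :=
    hprime.isMaximal (by simpa using hℓ.ne_zero)
  have : PerfectField (Ideal.span {(ℓ : ℤ)}).ResidueField := inferInstance
  have hmap : (Ideal.span {(ℓ : ℤ)}).map (algebraMap ℤ (𝓞 L)) ≠ ⊥ := by
    simpa [Ideal.map_span] using hℓ.ne_zero
  have hQ0 : Q ≠ ⊥ := by
    rintro rfl
    simp [hℓ.ne_zero] at hQ
  have h := Ideal.card_inertia_eq_ramificationIdxIn (G := Gal(L/ℚ)) (Ideal.span {(ℓ : ℤ)}) Q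
  rw [hI, Ideal.ramificationIdxIn_eq_ramificationIdx _ Q Gal(L/ℚ),
    Ideal.IsDedekindDomain.ramificationIdx_eq_multiplicity (Ideal.span {(ℓ : ℤ)}) Q hmap,
    Subgroup.card_bot] at h
  intro hsq
  have hfin : FiniteMultiplicity Q ((Ideal.span {(ℓ : ℤ)}).map (algebraMap ℤ (𝓞 L))) :=
    FiniteMultiplicity.of_prime_left (Ideal.prime_of_isPrime hQ0 inferInstance) hmap
  have hle := hfin.le_multiplicity_of_pow_dvd (k := 2) (by
    rw [Ideal.dvd_iff_le, Ideal.map_span, Set.image_singleton, Ideal.span_singleton_le_iff_mem]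
    simpa using hsq)
  lia

theorem exists_smul_eq_swap {f : ℤ[X]} {R : Finset (𝓞 L)} [DecidableEq (𝓞 L)]
    (hf : f.map (algebraMap ℤ (𝓞 L)) = ∏ β ∈ R, (X - C β))
    (hfaith : ∀ g : Gal(L/ℚ), (∀ β ∈ R, g • β = β) → g = 1)
    {ℓ : ℕ} (hℓ : ℓ.Prime) {Q : Ideal (𝓞 L)} [Q.IsPrime] (hQ : (ℓ : 𝓞 L) ∈ Q)
    {γ u : 𝓞 L} {m : ℕ} (hm : Odd m) (hγ : aeval γ f = ℓ ^ m * u) (hu : u ∉ Q)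
    (hd : aeval γ (derivative f) = 0) (hdd : aeval γ (derivative (derivative f)) ∉ Q)
    (hsep : ∀ β ∈ R, γ - β ∉ Q → aeval β (derivative f) ∉ Q) :
    ∃ β₁ ∈ R, ∃ β₂ ∈ R, β₁ ≠ β₂ ∧ ∃ g : Gal(L/ℚ), ∀ w ∈ R, g • w = Equiv.swap β₁ β₂ w := by
  have hQ0 : Q ≠ ⊥ := by
    rintro rfl
    simp [hℓ.ne_zero] at hQ
  have haeval (x : 𝓞 L) (F : ℤ[X]) : aeval x F = (F.map (algebraMap ℤ (𝓞 L))).eval x := by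
    rw [eval_map_algebraMap]
  simp only [haeval, ← derivative_map, hf] at hγ hd hdd hsep
  obtain ⟨β₁, hβ₁, hγβ₁⟩ : ∃ β ∈ R, γ - β ∈ Q := by
    have h : ∏ β ∈ R, (γ - β) ∈ Q := by
      have : (∏ β ∈ R, (X - C β)).eval γ = ∏ β ∈ R, (γ - β) := by simp [eval_prod]
      rw [← this, hγ]
      exact Q.mul_mem_right _ (Ideal.pow_mem_of_mem Q hQ m hm.pos)
    exact Ideal.IsPrime.prod_mem_iff.mp h
  rw [← Finset.mul_prod_erase R _ hβ₁] at hγ hd hdd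
  obtain ⟨β₂, hβ₂, hγβ₂⟩ : ∃ β ∈ R.erase β₁, γ - β ∈ Q := by
    have h : ∏ β ∈ R.erase β₁, (γ - β) ∈ Q := by
      have : (∏ β ∈ R.erase β₁, (X - C β)).eval γ = ∏ β ∈ R.erase β₁, (γ - β) := by simp [eval_prod]
      rw [← this]
      rw [derivative_mul, eval_add, eval_mul, eval_mul, derivative_X_sub_C, eval_one, one_mul,
        eval_sub, eval_X, eval_C] at hd
      rw [eq_neg_of_add_eq_zero_left hd]
      exact Q.neg_mem (Q.mul_mem_right _ hγβ₁)
    exact Ideal.IsPrime.prod_mem_iff.mp h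
  have hne : β₁ ≠ β₂ := (Finset.ne_of_mem_erase hβ₂).symm
  have hβ₂R : β₂ ∈ R := Finset.mem_of_mem_erase hβ₂
  rw [← Finset.mul_prod_erase (R.erase β₁) _ hβ₂] at hγ hd hdd
  set H : (𝓞 L)[X] := ∏ β ∈ (R.erase β₁).erase β₂, (X - C β) with hH
  simp only [derivative_mul, derivative_add, eval_add, eval_mul, eval_sub, eval_X, eval_C,
    derivative_X_sub_C, one_mul] at hγ hd hdd
  have hHγ : H.eval γ ∉ Q := by
    intro h
    apply hdd
    have hsum := Q.add_mem h (Q.mul_mem_right (eval γ (derivative H)) hγβ₂)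
    exact Q.add_mem hsum (Q.add_mem hsum (Q.mul_mem_right _ hγβ₁))
  have hother : ∀ β ∈ R, γ - β ∈ Q → β = β₁ ∨ β = β₂ := by
    intro β hβ hγβ
    by_contra! hcon
    apply hHγ
    rw [hH, eval_prod]
    refine Ideal.IsPrime.prod_mem_iff.mpr ⟨β, by simp [hβ, hcon], by simpa using hγβ⟩
  have hstab (g : Gal(L/ℚ)) {β : 𝓞 L} (hβ : β ∈ R) : g • β ∈ R := by
    have hroot (x : 𝓞 L) : x ∈ R ↔ aeval x f = 0 := by
      rw [haeval, hf, eval_prod, Finset.prod_eq_zero_iff]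
      simp [sub_eq_zero]
    rw [hroot] at hβ ⊢
    have := aeval_algHom_apply (MulSemiringAction.toAlgHom ℤ (𝓞 L) g) β f
    rwa [hβ, map_zero, MulSemiringAction.toAlgHom_apply] at this
  have hI : Q.inertia Gal(L/ℚ) ≠ ⊥ := by
    intro hI
    have hℓ2 := notMem_sq_of_inertia_eq_bot hℓ hQ hI
    let v : HeightOneSpectrum (𝓞 L) := ⟨Q, inferInstance, hQ0⟩
    refine Nat.not_even_iff_odd.mpr hm (v.even_of_mul_mul_eq_pow_mul (a := γ - β₁)
      (b := γ - β₂) (c := H.eval γ) (u := u) (ℓ := ℓ) ?_ hHγ hu hQ hℓ2 ?_)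
    · refine v.intValuation_eq_of_add_mul_add_mul_eq_zero (c := H.eval γ)
        (d := (derivative H).eval γ) hγβ₁ hγβ₂ hHγ ?_
      rw [← hd]
      ring
    · rw [← hγ]
      ring
  obtain ⟨g, hg, hg1⟩ := (Subgroup.bot_or_exists_ne_one _).resolve_left hI
  have hgQ (y : 𝓞 L) : g • y - y ∈ Q := hg y
  have hfix : ∀ β ∈ R, γ - β ∉ Q → g • β = β := by
    intro β hβ hγβ
    by_contra hcon
    apply hsep β hβ hγβ
    have : (derivative (∏ β ∈ R, (X - C β))).eval β = ∏ β' ∈ R.erase β, (β - β') := by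
      rw [← Finset.mul_prod_erase R _ hβ]
      simp [derivative_mul, eval_prod]
    rw [this]
    refine Ideal.IsPrime.prod_mem_iff.mpr ⟨g • β, Finset.mem_erase.mpr ⟨hcon, hstab g hβ⟩, ?_⟩
    rw [← neg_sub]
    exact Q.neg_mem (hgQ β)
  have hmove : ∀ β ∈ R, γ - β ∈ Q → g • β = β₁ ∨ g • β = β₂ := fun β hβ hγβ ↦
    hother _ (hstab g hβ) (by
      have := Q.sub_mem hγβ (hgQ β)
      rwa [sub_sub_sub_cancel_right] at this)
  refine ⟨β₁, hβ₁, β₂, hβ₂R, hne, g, fun w hw ↦ ?_⟩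
  have h₁ : g • β₁ = β₂ := by
    refine (hmove β₁ hβ₁ hγβ₁).resolve_left fun h₁ ↦ hg1 (hfaith g fun β hβ ↦ ?_)
    by_cases hγβ : γ - β ∈ Q
    · rcases hother β hβ hγβ with rfl | rfl
      · exact h₁
      · refine (hmove β hβ hγβ).resolve_left fun h₂ ↦ hne ?_
        exact MulAction.injective g (h₁.trans h₂.symm)
    · exact hfix β hβ hγβ
  have h₂ : g • β₂ = β₁ :=
    (hmove β₂ hβ₂R hγβ₂).resolve_right fun h₂ ↦ hne (MulAction.injective g (h₁.trans h₂.symm))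
  rcases eq_or_ne w β₁ with rfl | hw₁
  · rw [h₁, Equiv.swap_apply_left]
  rcases eq_or_ne w β₂ with rfl | hw₂
  · rw [h₂, Equiv.swap_apply_right]
  rw [Equiv.swap_apply_of_ne_of_ne hw₁ hw₂]
  exact hfix w hw fun h ↦ (hother w hw h).elim hw₁ hw₂

end

section

open Polynomial NumberField

section IntegralRoots

variable (K : Type*) [Field K]

open Classical in
/-- The roots of an integral polynomial in the ring of integers of `K`. -/
noncomputable def integralRoots (f : ℤ[X]) : Finset (𝓞 K) := (f.aroots (𝓞 K)).toFinset

variable {K} {f : ℤ[X]}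

theorem mem_integralRoots [CharZero K] (hf : f ≠ 0) {x : 𝓞 K} :
    x ∈ integralRoots K f ↔ aeval x f = 0 := by
  classical
  rw [integralRoots, Multiset.mem_toFinset, mem_aroots]
  exact and_iff_right hf

theorem splits_map_ringOfIntegers (hf : f.Monic) (hs : (f.map (algebraMap ℤ K)).Splits) :
    (f.map (algebraMap ℤ (𝓞 K))).Splits := by
  refine Splits.of_splits_map_of_injective (i := algebraMap (𝓞 K) K)
    (FaithfulSMul.algebraMap_injective _ _) ?_ ?_
  · rwa [map_map, ← IsScalarTower.algebraMap_eq]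
  · intro a ha
    rw [map_map, ← IsScalarTower.algebraMap_eq] at ha
    have hint : IsIntegral ℤ a := ⟨f, hf, by rw [← eval_map]; exact (mem_roots'.mp ha).2⟩
    exact ⟨⟨a, hint⟩, rfl⟩

variable [NumberField K]

theorem nodup_aroots_ringOfIntegers (hirr : Irreducible (f.map (Int.castRingHom ℚ))) :
    (f.aroots (𝓞 K)).Nodup := by
  have hsep : (f.map (algebraMap ℤ K)).Separable := by
    have h := hirr.separable.map (f := algebraMap ℚ K)
    rwa [map_map, RingHom.ext_int ((algebraMap ℚ K).comp (Int.castRingHom ℚ)) (algebraMap ℤ K)] at h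
  have hle := map_roots_le_of_injective (f.map (algebraMap ℤ (𝓞 K)))
    (FaithfulSMul.algebraMap_injective (𝓞 K) K)
  rw [map_map, ← IsScalarTower.algebraMap_eq] at hle
  exact (Multiset.nodup_of_le hle (nodup_roots hsep)).of_map _

theorem map_eq_prod_integralRoots (hf : f.Monic) (hirr : Irreducible (f.map (Int.castRingHom ℚ)))
    (hs : (f.map (algebraMap ℤ K)).Splits) :
    f.map (algebraMap ℤ (𝓞 K)) = ∏ β ∈ integralRoots K f, (X - C β) := by
  classical
  rw [(splits_map_ringOfIntegers hf hs).eq_prod_roots_of_monic (hf.map _), Finset.prod,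
    integralRoots, Multiset.toFinset_val, aroots,
    Multiset.dedup_eq_self.mpr]
  exact nodup_aroots_ringOfIntegers hirr

theorem card_integralRoots (hf : f.Monic) (hirr : Irreducible (f.map (Int.castRingHom ℚ)))
    (hs : (f.map (algebraMap ℤ K)).Splits) : (integralRoots K f).card = f.natDegree := by
  classical
  rw [integralRoots, Multiset.toFinset_card_of_nodup (nodup_aroots_ringOfIntegers hirr), aroots,
    ← (splits_map_ringOfIntegers hf hs).natDegree_eq_card_roots, hf.natDegree_map]

theorem aeval_smul_eq_zero (g : Gal(K/ℚ)) {x : 𝓞 K} (hx : aeval x f = 0) :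
    aeval (g • x) f = 0 := by
  have h := aeval_algHom_apply (MulSemiringAction.toAlgHom ℤ (𝓞 K) g) x f
  rwa [hx, map_zero, MulSemiringAction.toAlgHom_apply] at h

theorem smul_mem_integralRoots (hf : f ≠ 0) (g : Gal(K/ℚ)) {x : 𝓞 K} (hx : x ∈ integralRoots K f) :
    g • x ∈ integralRoots K f := by
  rw [mem_integralRoots hf] at hx ⊢
  exact aeval_smul_eq_zero g hx

theorem exists_smul_eq_of_mem_integralRoots [IsGalois ℚ K] (hf : f.Monic)
    (hirr : Irreducible (f.map (Int.castRingHom ℚ))) {x y : 𝓞 K}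
    (hx : x ∈ integralRoots K f) (hy : y ∈ integralRoots K f) : ∃ g : Gal(K/ℚ), g • x = y := by
  rw [mem_integralRoots hf.ne_zero] at hx hy
  have haeval {z : 𝓞 K} (hz : aeval z f = 0) : aeval (z : K) (f.map (Int.castRingHom ℚ)) = 0 := by
    rw [← algebraMap_int_eq, aeval_map_algebraMap, aeval_algebraMap_apply, hz, map_zero]
  have hmin := minpoly.eq_of_irreducible_of_monic hirr (haeval hy) (hf.map _)
  obtain ⟨σ, hσ⟩ := minpoly.exists_algEquiv_of_root (K := ℚ) (x := (x : K)) (y := (y : K))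
    (Algebra.IsAlgebraic.isAlgebraic _) (by rw [← hmin]; exact haeval hx)
  exact ⟨σ, RingOfIntegers.ext hσ⟩

end IntegralRoots

end

section

open Polynomial NumberField

variable {p k : ℕ}

theorem exists_isPrime_natCast_mem (L : Type*) [Field L] [NumberField L] {ℓ : ℕ} (hℓ : ℓ.Prime) :
    ∃ Q : Ideal (𝓞 L), Q.IsPrime ∧ (ℓ : 𝓞 L) ∈ Q := by
  have hprime : (Ideal.span {(ℓ : ℤ)}).IsPrime :=
    (Ideal.span_singleton_prime (by exact_mod_cast hℓ.ne_zero)).mpr (Nat.prime_iff_prime_int.mp hℓ)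
  obtain ⟨⟨Q, hQ, hover⟩⟩ := Ideal.nonempty_primesOver (S := 𝓞 L) (Ideal.span {(ℓ : ℤ)})
  refine ⟨Q, hQ, ?_⟩
  have h := (Q.mem_of_liesOver (Ideal.span {(ℓ : ℤ)}) ℓ).mp (Ideal.mem_span_singleton_self _)
  simpa using h

theorem intCast_notMem_of_not_dvd {A : Type*} [CommRing A] {Q : Ideal A} [hQ : Q.IsPrime] {ℓ : ℕ}
    (hℓ : ℓ.Prime) (hℓQ : (ℓ : A) ∈ Q) {z : ℤ} (hz : ¬ (ℓ : ℤ) ∣ z) : (z : A) ∉ Q := by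
  intro h
  obtain ⟨a, b, hab⟩ := (Nat.prime_iff_prime_int.mp hℓ).coprime_iff_not_dvd.mpr hz
  refine hQ.ne_top ((Ideal.eq_top_iff_one _).mpr ?_)
  have h1 : ((a * ℓ + b * z : ℤ) : A) ∈ Q := by
    push_cast
    exact Q.add_mem (Q.mul_mem_left _ hℓQ) (Q.mul_mem_left _ h)
  rwa [hab, Int.cast_one] at h1

theorem eq_one_of_forall_smul_eq {L : Type*} [Field L] [NumberField L] {f : ℤ[X]} (hf : f.Monic)
    (hL : Algebra.adjoin ℚ ((f.map (algebraMap ℤ ℚ)).rootSet L) = ⊤) {g : Gal(L/ℚ)}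
    (hg : ∀ β ∈ integralRoots L f, g • β = β) : g = 1 := by
  have hroot : ∀ y ∈ Algebra.adjoin ℚ ((f.map (algebraMap ℤ ℚ)).rootSet L), g y = y := by
    intro y hy
    induction hy using Algebra.adjoin_induction with
    | mem y hy =>
      have hy0 : aeval y f = 0 := by
        have := aeval_eq_zero_of_mem_rootSet hy
        rwa [aeval_map_algebraMap] at this
      have hint : IsIntegral ℤ y := ⟨f, hf, hy0⟩
      obtain ⟨z, rfl⟩ : ∃ z : 𝓞 L, (z : L) = y := ⟨⟨y, hint⟩, rfl⟩
      have hz : z ∈ integralRoots L f := by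
        rw [mem_integralRoots hf.ne_zero]
        refine RingOfIntegers.ext ?_
        rwa [aeval_algebraMap_apply] at hy0
      exact congrArg (algebraMap (𝓞 L) L) (hg _ hz)
    | algebraMap r => exact g.commutes r
    | add a b _ _ ha hb => rw [map_add, ha, hb]
    | mul a b _ _ ha hb => rw [map_mul, ha, hb]
  ext y
  refine hroot y ?_
  rw [hL]
  trivial

theorem exists_smul_eq_swap_integralRoots_phi_of_faithful {L : Type*} [Field L] [NumberField L]
    [IsGalois ℚ L] [DecidableEq (𝓞 L)] (hp : p.Prime) (hk : 0 < k) (hpk : ¬ p ∣ k)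
    (hcase : (5 ≤ p ∧ k % 3 = 1) ∨ (p = 3 ∧ k = 2)) {n : ℕ} (hn : n ≠ 0)
    (hs : ((polyIter (phi p k) n).map (algebraMap ℤ L)).Splits)
    (hfaith : ∀ g : Gal(L/ℚ), (∀ β ∈ integralRoots L (polyIter (phi p k) n), g • β = β) → g = 1) :
    ∃ β₁ ∈ integralRoots L (polyIter (phi p k) n), ∃ β₂ ∈ integralRoots L (polyIter (phi p k) n),
      β₁ ≠ β₂ ∧ ∃ g : Gal(L/ℚ), ∀ w ∈ integralRoots L (polyIter (phi p k) n),
        g • w = Equiv.swap β₁ β₂ w := by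
  have hodd : Odd p := hp.odd_of_ne_two (by lia)
  have hmonic : (polyIter (phi p k) n).Monic :=
    monic_polyIter (monic_phi hp.two_le) (by rw [natDegree_phi hp.two_le]; exact hp.ne_zero) n
  obtain ⟨ℓ, m, u, hℓ, hℓk, hℓp, hm, hval, hu⟩ :=
    exists_prime_odd_pow_iterate_phiMap_critical hp hk hpk hcase hn
  obtain ⟨Q, hQ, hℓQ⟩ := exists_isPrime_natCast_mem L hℓ
  obtain ⟨A, _, _, π, hπ⟩ : ∃ (A : Type _) (_ : CommRing A) (_ : IsDomain A) (π : 𝓞 L →+* A),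
      ∀ x, x ∈ Q ↔ π x = 0 :=
    ⟨𝓞 L ⧸ Q, inferInstance, inferInstance, Ideal.Quotient.mk Q,
      fun x ↦ Ideal.Quotient.eq_zero_iff_mem.symm⟩
  have hnat (z : ℕ) (hz : ¬ ℓ ∣ z) : (z : A) ≠ 0 := by
    rw [← map_natCast π, Ne, ← hπ]
    exact_mod_cast intCast_notMem_of_not_dvd hℓ hℓQ (z := z) (by exact_mod_cast hz)
  have hvalL : aeval (-(k * (p - 1 : ℕ)) : 𝓞 L) (polyIter (phi p k) n) = ℓ ^ m * (u : 𝓞 L) := by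
    have h := congrArg (Int.castRingHom (𝓞 L)) hval
    rw [map_iterate_phiMap] at h
    rw [aeval_polyIter_phi]
    simpa using h
  have hred (x : 𝓞 L) (F : ℤ[X]) : aeval x F ∈ Q ↔ aeval (π x) F = 0 := by
    rw [hπ]
    exact iff_of_eq (congrArg (· = 0) (aeval_algHom_apply π.toIntAlgHom x F).symm)
  have hγ : (phiMap p k)^[n] (-(k * (p - 1 : ℕ)) : A) = 0 := by
    have h : aeval (-(k * (p - 1 : ℕ)) : 𝓞 L) (polyIter (phi p k) n) ∈ Q := by
      rw [hvalL]
      exact Q.mul_mem_right _ (Ideal.pow_mem_of_mem Q hℓQ m hm.pos)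
    rw [hred, aeval_polyIter_phi] at h
    simpa using h
  refine exists_smul_eq_swap
    (map_eq_prod_integralRoots hmonic (irreducible_polyIter_phi hp hodd hpk n) hs) hfaith hℓ hℓQ hm
    hvalL (intCast_notMem_of_not_dvd hℓ hℓQ hu)
    (aeval_derivative_polyIter_phi_critical hp.two_le hn) ?_ ?_
  · rw [hred]
    simpa using aeval_derivative_derivative_polyIter_phi_ne_zero hp.two_le hodd (hnat p hℓp)
      (hnat k hℓk) hn hγ
  · intro β hβ hγβ
    rw [hred]
    rw [mem_integralRoots hmonic.ne_zero, aeval_polyIter_phi] at hβ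
    refine aeval_derivative_polyIter_phi_ne_zero hp.two_le hodd (hnat p hℓp) (hnat k hℓk) hγ ?_ ?_
    · rw [← map_iterate_phiMap, hβ, map_zero]
    · intro h
      apply hγβ
      rw [hπ, map_sub, h]
      simp

theorem exists_smul_eq_swap_integralRoots_phi {K : Type*} [Field K] [NumberField K]
    [IsGalois ℚ K] [DecidableEq (𝓞 K)] (hp : p.Prime) (hk : 0 < k) (hpk : ¬ p ∣ k)
    (hcase : (5 ≤ p ∧ k % 3 = 1) ∨ (p = 3 ∧ k = 2)) {n : ℕ} (hn : n ≠ 0)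
    (hs : ((polyIter (phi p k) n).map (algebraMap ℤ K)).Splits) :
    ∃ β₁ ∈ integralRoots K (polyIter (phi p k) n), ∃ β₂ ∈ integralRoots K (polyIter (phi p k) n),
      β₁ ≠ β₂ ∧ ∃ g : Gal(K/ℚ), ∀ w ∈ integralRoots K (polyIter (phi p k) n),
        g • w = Equiv.swap β₁ β₂ w := by
  classical
  have hodd : Odd p := hp.odd_of_ne_two (by lia)
  set f := polyIter (phi p k) n
  have hmonic : f.Monic := monic_polyIter (monic_phi hp.two_le)
    (by rw [natDegree_phi hp.two_le]; exact hp.ne_zero) n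
  have hf : f ≠ 0 := hmonic.ne_zero
  set fQ := f.map (algebraMap ℤ ℚ) with hfQ
  have hsQ : (fQ.map (algebraMap ℚ K)).Splits := by
    rwa [hfQ, map_map, ← IsScalarTower.algebraMap_eq]
  let L := IntermediateField.adjoin ℚ (fQ.rootSet K)
  have hL : fQ.IsSplittingField ℚ L := IntermediateField.adjoin_rootSet_isSplittingField hsQ
  have hLG : IsGalois ℚ L :=
    IsGalois.of_separable_splitting_field (irreducible_polyIter_phi hp hodd hpk n).separable
  have hsL : (f.map (algebraMap ℤ L)).Splits := by
    have := hL.splits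
    rwa [hfQ, map_map, ← IsScalarTower.algebraMap_eq] at this
  have hfaith (g : Gal(L/ℚ)) (hg : ∀ β ∈ integralRoots L f, g • β = β) : g = 1 := by
    exact eq_one_of_forall_smul_eq hmonic hL.adjoin_rootSet hg
  obtain ⟨β₁, hβ₁, β₂, hβ₂, hne, g, hg⟩ :=
    exists_smul_eq_swap_integralRoots_phi_of_faithful hp hk hpk hcase hn hsL hfaith
  have hinj : Function.Injective (algebraMap (𝓞 L) (𝓞 K)) := FaithfulSMul.algebraMap_injective _ _
  have hmem {x : 𝓞 L} : algebraMap (𝓞 L) (𝓞 K) x ∈ integralRoots K f ↔ x ∈ integralRoots L f := by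
    rw [mem_integralRoots hf, mem_integralRoots hf, aeval_algebraMap_apply]
    exact map_eq_zero_iff _ hinj
  have hlift {w : 𝓞 K} (hw : w ∈ integralRoots K f) : ∃ x, algebraMap (𝓞 L) (𝓞 K) x = w := by
    have hw0 : aeval (w : K) f = 0 := by
      rw [aeval_algebraMap_apply, (mem_integralRoots hf).mp hw, map_zero]
    have hwL : (w : K) ∈ L := by
      refine IntermediateField.subset_adjoin _ _ ((mem_rootSet_of_ne ?_).mpr ?_)
      · exact (hmonic.map _).ne_zero
      · rwa [hfQ, aeval_map_algebraMap]
    have hint : IsIntegral ℤ (⟨w, hwL⟩ : L) :=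
      (isIntegral_algebraMap_iff (FaithfulSMul.algebraMap_injective L K)).mp
        (RingOfIntegers.isIntegral_coe w)
    exact ⟨⟨_, hint⟩, RingOfIntegers.ext rfl⟩
  refine ⟨_, hmem.mpr hβ₁, _, hmem.mpr hβ₂, hinj.ne hne, g.liftNormal K, fun w hw ↦ ?_⟩
  obtain ⟨x, rfl⟩ := hlift hw
  have hcomm : g.liftNormal K • algebraMap (𝓞 L) (𝓞 K) x = algebraMap (𝓞 L) (𝓞 K) (g • x) := by
    refine RingOfIntegers.ext ?_
    exact g.liftNormal_commutes K x
  rw [hcomm, hg x (hmem.mp hw), hinj.map_swap]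

end

section

open Polynomial NumberField FiberAction

section IterateRoots

variable {p k : ℕ}

theorem monic_polyIter_phi (hp : 2 ≤ p) (n : ℕ) : (polyIter (phi p k) n).Monic :=
  monic_polyIter (monic_phi hp) (by rw [natDegree_phi hp]; lia) n

theorem card_filter_phiMap_eq_le {A : Type*} [CommRing A] [IsDomain A] [DecidableEq A]
    (hp : 2 ≤ p) (S : Finset A) (y : A) :
    (S.filter (phiMap p k · = y)).card ≤ p := by
  have hmonic : ((phi p k).map (algebraMap ℤ A)).Monic := (monic_phi hp).map _
  have hdeg : ((phi p k).map (algebraMap ℤ A)).natDegree = p := by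
    rw [(monic_phi hp).natDegree_map, natDegree_phi hp]
  set f := (phi p k).map (algebraMap ℤ A) - C y
  have hfdeg : f.natDegree = p := by rw [natDegree_sub_C, hdeg]
  have hf : f ≠ 0 := by
    intro h
    rw [h, natDegree_zero] at hfdeg
    lia
  calc (S.filter (phiMap p k · = y)).card ≤ f.roots.toFinset.card := by
        refine Finset.card_le_card fun x hx ↦ ?_
        rw [Multiset.mem_toFinset, mem_roots hf, IsRoot, eval_sub, eval_C, eval_map_algebraMap,
          aeval_phi, (Finset.mem_filter.mp hx).2, sub_self]
    _ ≤ f.roots.card := f.roots.toFinset_card_le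
    _ ≤ p := hfdeg ▸ f.card_roots'

variable {K : Type*} [Field K] [NumberField K]

theorem mem_integralRoots_polyIter_phi (hp : 2 ≤ p) {n : ℕ} {x : 𝓞 K} :
    x ∈ integralRoots K (polyIter (phi p k) n) ↔ (phiMap p k)^[n] x = 0 := by
  rw [mem_integralRoots (monic_polyIter_phi hp n).ne_zero, aeval_polyIter_phi]

theorem smul_phiMap (g : Gal(K/ℚ)) (x : 𝓞 K) : phiMap p k (g • x) = g • phiMap p k x :=
  (map_phiMap (MulSemiringAction.toRingHom _ (𝓞 K) g) x).symm

theorem phiMap_mem_integralRoots (hp : 2 ≤ p) {n : ℕ} {x : 𝓞 K}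
    (hx : x ∈ integralRoots K (polyIter (phi p k) (n + 1))) :
    phiMap p k x ∈ integralRoots K (polyIter (phi p k) n) := by
  rwa [mem_integralRoots_polyIter_phi hp, ← Function.iterate_succ_apply,
    ← mem_integralRoots_polyIter_phi hp]

theorem integralRoots_polyIter_phi_zero (hp : 2 ≤ p) :
    integralRoots K (polyIter (phi p k) 0) = {0} := by
  ext x
  rw [mem_integralRoots_polyIter_phi hp, Function.iterate_zero_apply, Finset.mem_singleton]

theorem card_integralRoots_polyIter_phi (hp : p.Prime) (hodd : Odd p) (hpk : ¬ p ∣ k) {n : ℕ}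
    (hs : ((polyIter (phi p k) n).map (algebraMap ℤ K)).Splits) :
    (integralRoots K (polyIter (phi p k) n)).card = p ^ n := by
  rw [card_integralRoots (monic_polyIter_phi hp.two_le n) (irreducible_polyIter_phi hp hodd hpk n)
    hs, natDegree_polyIter, natDegree_phi hp.two_le]

theorem card_filter_phiMap_eq [DecidableEq (𝓞 K)] (hp : p.Prime) (hodd : Odd p) (hpk : ¬ p ∣ k)
    {n : ℕ} (hs : ((polyIter (phi p k) n).map (algebraMap ℤ K)).Splits)
    (hs' : ((polyIter (phi p k) (n + 1)).map (algebraMap ℤ K)).Splits) {y : 𝓞 K}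
    (hy : y ∈ integralRoots K (polyIter (phi p k) n)) :
    ((integralRoots K (polyIter (phi p k) (n + 1))).filter (phiMap p k · = y)).card = p := by
  refine (Finset.sum_eq_sum_iff_of_le
    (s := integralRoots K (polyIter (phi p k) n)) (g := fun _ ↦ p)
    fun y _ ↦ card_filter_phiMap_eq_le hp.two_le _ y).mp ?_ y hy
  rw [← Finset.card_eq_sum_card_fiberwise fun x hx ↦ phiMap_mem_integralRoots hp.two_le hx,
    Finset.sum_const, card_integralRoots_polyIter_phi hp hodd hpk hs,
    card_integralRoots_polyIter_phi hp hodd hpk hs', smul_eq_mul, pow_succ]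

theorem swap_mem_realized_integralRoots_phi [IsGalois ℚ K] [DecidableEq (𝓞 K)] (hp : p.Prime)
    (hk : 0 < k) (hpk : ¬ p ∣ k) (hcase : (5 ≤ p ∧ k % 3 = 1) ∨ (p = 3 ∧ k = 2)) {n : ℕ}
    (hs : ((polyIter (phi p k) n).map (algebraMap ℤ K)).Splits)
    (hs' : ((polyIter (phi p k) (n + 1)).map (algebraMap ℤ K)).Splits)
    (hR : ∀ g : Gal(K/ℚ), ∀ x ∈ integralRoots K (polyIter (phi p k) (n + 1)),
      g • x ∈ integralRoots K (polyIter (phi p k) (n + 1))) {x y : 𝓞 K}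
    (hx : x ∈ integralRoots K (polyIter (phi p k) (n + 1)))
    (hy : y ∈ integralRoots K (polyIter (phi p k) (n + 1))) (hxy : phiMap p k x = phiMap p k y) :
    Equiv.swap x y ∈ realized hR := by
  have hodd : Odd p := hp.odd_of_ne_two (by lia)
  have hfib (x) (hx : x ∈ integralRoots K (polyIter (phi p k) (n + 1))) :=
    card_filter_phiMap_eq hp hodd hpk hs hs' (phiMap_mem_integralRoots hp.two_le hx)
  obtain ⟨a, ha, b, hb, hab, g, hg⟩ :=
    exists_smul_eq_swap_integralRoots_phi hp hk hpk hcase n.succ_ne_zero hs'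
  have hFab : phiMap p k a = phiMap p k b := by
    have hcard := hfib a ha
    obtain ⟨c, hc, hca⟩ : ∃ c ∈ (integralRoots K (polyIter (phi p k) (n + 1))).filter
        (phiMap p k · = phiMap p k a), c ≠ a :=
      Finset.exists_mem_ne (by rw [hcard]; exact hp.one_lt) a
    rw [Finset.mem_filter] at hc
    by_cases hcb : c = b
    · rw [← hcb, hc.2]
    · have h1 : g • c = c := by rw [hg c hc.1, Equiv.swap_apply_of_ne_of_ne hca hcb]
      have h2 : g • a = b := by rw [hg a ha, Equiv.swap_apply_left]
      rw [← h2, smul_phiMap, ← hc.2, ← smul_phiMap, h1]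
  exact swap_mem_realized_of_eq smul_phiMap hR
    (fun x hx y hy ↦ exists_smul_eq_of_mem_integralRoots (monic_polyIter_phi hp.two_le _)
      (irreducible_polyIter_phi hp hodd hpk _) hx hy) hp hfib ha hb hab hFab
    (mem_realized.mpr ⟨g, hg⟩) hx hy hxy

open Classical in
theorem card_exists_smul_eq_integralRoots_phi [IsGalois ℚ K] (hp : p.Prime)
    (hk : 0 < k) (hpk : ¬ p ∣ k) (hcase : (5 ≤ p ∧ k % 3 = 1) ∨ (p = 3 ∧ k = 2)) {N : ℕ}
    (hs : ∀ n ≤ N, ((polyIter (phi p k) n).map (algebraMap ℤ K)).Splits) :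
    ((Finset.univ.filter fun g : Gal(K/ℚ) ↦
      ∃ x ∈ integralRoots K (polyIter (phi p k) N), g • x = x).card : ℝ) =
      Fintype.card Gal(K/ℚ) * (1 - (fixPoly p)^[N] 0) := by
  have hodd : Odd p := hp.odd_of_ne_two (by lia)
  refine card_exists_fixedPoint_eq (smul_phiMap (p := p) (k := k))
    (R := fun n ↦ integralRoots K (polyIter (phi p k) n)) hp.pos
    (fun n g x hx ↦ smul_mem_integralRoots (monic_polyIter_phi hp.two_le n).ne_zero g hx)
    (fun n _ x hx ↦ phiMap_mem_integralRoots hp.two_le hx) ?_ ?_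
    (fun n hn y hy ↦ card_filter_phiMap_eq hp hodd hpk (hs n hn.le) (hs (n + 1) hn) hy)
    (fun n hn x hx y hy hxy ↦ swap_mem_realized_integralRoots_phi hp hk hpk hcase (hs n hn.le)
      (hs (n + 1) hn) _ hx hy hxy)
  · intro g x hx
    rw [integralRoots_polyIter_phi_zero hp.two_le, Finset.mem_singleton] at hx
    rw [hx, smul_zero]
  · rw [integralRoots_polyIter_phi_zero hp.two_le, Finset.card_singleton]

theorem smul_eq_of_mem_integralRoots_phi (hp : p.Prime) (hodd : Odd p) (hpk : ¬ p ∣ k) {N : ℕ}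
    (hs : ∀ n ≤ N, ((polyIter (phi p k) n).map (algebraMap ℤ K)).Splits) (σ : Gal(K/ℚ)) {n : ℕ}
    (hn : n ≤ N) {x : 𝓞 K} (hx : x ∈ integralRoots K (polyIter (phi p k) n)) :
    σ ^ p.factorial ^ N • x = x := by
  classical
  have h := smul_eq_of_pow_factorial_pow (smul_phiMap (p := p) (k := k))
    (R := fun n ↦ integralRoots K (polyIter (phi p k) n)) (N := N) (p := p)
    (fun n g x hx ↦ smul_mem_integralRoots (monic_polyIter_phi hp.two_le n).ne_zero g hx)
    (fun n _ x hx ↦ phiMap_mem_integralRoots hp.two_le hx)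
    (fun g x hx ↦ by
      rw [integralRoots_polyIter_phi_zero hp.two_le, Finset.mem_singleton] at hx
      rw [hx, smul_zero])
    (fun n hn y hy ↦ card_filter_phiMap_eq hp hodd hpk (hs n hn.le) (hs (n + 1) hn) hy)
    (σ ^ p.factorial ^ (N - n)) hn x hx
  rwa [← pow_mul, ← pow_add, Nat.sub_add_cancel hn] at h

end IterateRoots

end

section

open Polynomial NumberField

section Frobenius

variable {K : Type*} [Field K] [NumberField K]

theorem exists_forall_notMem_of_forall_ne_zero (T : Finset (𝓞 K)) (hT : ∀ x ∈ T, x ≠ 0) :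
    ∃ B : ℕ, ∀ q : ℕ, q.Prime → B < q → ∀ Q : Ideal (𝓞 K), Q.IsPrime → (q : 𝓞 K) ∈ Q →
      ∀ x ∈ T, x ∉ Q := by
  refine ⟨Ideal.absNorm (Ideal.span {∏ x ∈ T, x}), fun q hq hBq Q hQ hqQ x hx hxQ ↦ ?_⟩
  have hprod : ∏ x ∈ T, x ≠ 0 := Finset.prod_ne_zero_iff.mpr hT
  have hpos : 0 < Ideal.absNorm (Ideal.span {∏ x ∈ T, x}) := by
    rw [Nat.pos_iff_ne_zero, Ne, Ideal.absNorm_eq_zero_iff, Ideal.span_singleton_eq_bot]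
    exact hprod
  refine intCast_notMem_of_not_dvd hq hqQ (z := Ideal.absNorm (Ideal.span {∏ x ∈ T, x})) ?_ ?_
  · rw [Int.natCast_dvd_natCast]
    exact Nat.not_dvd_of_pos_of_lt hpos hBq
  · rw [Int.cast_natCast]
    have hle : Ideal.span {∏ x ∈ T, x} ≤ Q := by
      rw [Ideal.span_singleton_le_iff_mem]
      exact Q.mem_of_dvd (Finset.dvd_prod_of_mem _ hx) hxQ
    exact hle (Ideal.absNorm_mem _)

variable [IsGalois ℚ K]

theorem exists_isFrobeniusAt {q : ℕ} (hq : q.Prime) {Q : Ideal (𝓞 K)} [Q.IsPrime]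
    (hQ : (q : 𝓞 K) ∈ Q) : ∃ τ : Gal(K/ℚ), IsFrobeniusAt q Q τ := by
  have hQ0 : Q ≠ ⊥ := by
    rintro rfl
    simp [hq.ne_zero] at hQ
  have : Finite (𝓞 K ⧸ Q) := Ring.HasFiniteQuotients.finiteQuotient hQ0
  obtain ⟨τ, hτ⟩ := IsArithFrobAt.exists_of_isInvariant (R := ℤ) (G := Gal(K/ℚ)) (Q := Q)
  have hlies : Q.LiesOver (Ideal.span {(q : ℤ)}) :=
    (Ideal.liesOver_span_iff Ideal.IsPrime.ne_top' (Nat.prime_iff_prime_int.mp hq)).mpr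
      (by simpa using hQ)
  have hcard : Nat.card (ℤ ⧸ Q.under ℤ) = q := by
    rw [← hlies.over, Int.card_ideal_quot]
  refine ⟨τ, fun y ↦ ?_⟩
  have := hτ y
  rwa [hcard] at this

theorem exists_hasFrobeniusIn_of_dvd_eval {f : ℤ[X]} (hf : f.Monic)
    (hirr : Irreducible (f.map (Int.castRingHom ℚ))) (hs : (f.map (algebraMap ℤ K)).Splits)
    {S : Finset Gal(K/ℚ)} (hS : ∀ g : Gal(K/ℚ), ∀ x ∈ integralRoots K f, g • x = x → g ∈ S) :
    ∃ B : ℕ, ∀ q : ℕ, q.Prime → B < q → ∀ z : ℤ, (q : ℤ) ∣ f.eval z → HasFrobeniusIn S q := by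
  classical
  obtain ⟨B, hB⟩ := exists_forall_notMem_of_forall_ne_zero
    ((integralRoots K f).offDiag.image fun x ↦ x.1 - x.2) (by
      intro x hx
      obtain ⟨y, hy, rfl⟩ := Finset.mem_image.mp hx
      exact sub_ne_zero.mpr (Finset.mem_offDiag.mp hy).2.2)
  refine ⟨B, fun q hq hBq z hz ↦ ?_⟩
  obtain ⟨Q, hQ, hqQ⟩ := exists_isPrime_natCast_mem K hq
  obtain ⟨τ, hτ⟩ := exists_isFrobeniusAt hq hqQ
  have hint {w : ℤ} (hw : (q : ℤ) ∣ w) : (w : 𝓞 K) ∈ Q := by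
    obtain ⟨c, rfl⟩ := hw
    push_cast
    exact Q.mul_mem_right _ hqQ
  obtain ⟨β, hβ, hβQ⟩ : ∃ β ∈ integralRoots K f, (z : 𝓞 K) - β ∈ Q := by
    have h : ((f.eval z : ℤ) : 𝓞 K) = ∏ β ∈ integralRoots K f, ((z : 𝓞 K) - β) := by
      rw [← eq_intCast (algebraMap ℤ (𝓞 K)), ← eval_map_apply, map_eq_prod_integralRoots hf hirr hs,
        eval_prod]
      simp
    exact Ideal.IsPrime.prod_mem_iff.mp (h ▸ hint hz)
  refine ⟨Q, hQ, hqQ, τ, hS τ β hβ ?_, hτ⟩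
  by_contra hne
  refine hB q hq hBq Q hQ hqQ (τ • β - β) (Finset.mem_image.mpr ⟨(τ • β, β), ?_, rfl⟩) ?_
  · exact Finset.mem_offDiag.mpr ⟨smul_mem_integralRoots hf.ne_zero τ hβ, hβ, hne⟩
  · have hzq : ((z : 𝓞 K)) ^ q - z ∈ Q := by
      have := Fact.mk hq
      have h : (q : ℤ) ∣ z ^ q - z := by
        rw [← ZMod.intCast_zmod_eq_zero_iff_dvd]
        push_cast
        rw [ZMod.pow_card, sub_self]
      exact_mod_cast hint h
    have hpow : (z : 𝓞 K) ^ q - β ^ q ∈ Q := Q.mem_of_dvd (sub_dvd_pow_sub_pow _ _ _) hβQ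
    have h := Q.add_mem (Q.sub_mem (Q.add_mem (hτ β) hzq) hpow) hβQ
    convert h using 1
    ring

end Frobenius

end

section

open Polynomial NumberField FiberAction

section Density

variable {p k : ℕ}

theorem exists_numberField_splits (p k N : ℕ) (hp : 2 ≤ p) :
    ∃ (K : Type) (_ : Field K) (_ : NumberField K) (_ : IsGalois ℚ K),
      (∀ n ≤ N, ((polyIter (phi p k) n).map (algebraMap ℤ K)).Splits) ∧
      ∀ g : Gal(K/ℚ), (∀ n ≤ N, ∀ x ∈ integralRoots K (polyIter (phi p k) n), g • x = x) →
        g = 1 := by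
  set f := ∏ n ∈ Finset.range (N + 1), polyIter (phi p k) n with hf
  have hmonic : f.Monic := monic_prod_of_monic _ _ fun n _ ↦ monic_polyIter_phi hp n
  set fQ := f.map (algebraMap ℤ ℚ) with hfQ
  let K := IntermediateField.adjoin ℚ (fQ.rootSet ℂ)
  have hK : fQ.IsSplittingField ℚ K :=
    IntermediateField.adjoin_rootSet_isSplittingField (IsAlgClosed.splits _)
  have hfin : FiniteDimensional ℚ K := IsSplittingField.finiteDimensional K fQ
  have hnormal : Normal ℚ K := Normal.of_isSplittingField fQ
  have hnf : NumberField K := { to_charZero := inferInstance, to_finiteDimensional := hfin }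
  refine ⟨K, inferInstance, hnf, ⟨⟩, fun n hn ↦ ?_, fun g hg ↦ ?_⟩
  · have h := hK.splits
    rw [hfQ, map_map, ← IsScalarTower.algebraMap_eq] at h
    refine h.of_dvd (hmonic.map _).ne_zero (Polynomial.map_dvd _ ?_)
    exact Finset.dvd_prod_of_mem _ (Finset.mem_range_succ_iff.mpr hn)
  · refine eq_one_of_forall_smul_eq hmonic hK.adjoin_rootSet fun β hβ ↦ ?_
    rw [mem_integralRoots hmonic.ne_zero, hf, map_prod, Finset.prod_eq_zero_iff] at hβ
    obtain ⟨n, hn, hβ⟩ := hβ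
    exact hg n (Finset.mem_range_succ_iff.mp hn) β
      ((mem_integralRoots (monic_polyIter_phi hp n).ne_zero).mpr hβ)

open Classical in
theorem exists_sum_log_dvd_eval_le (hp : p.Prime) (hk : 0 < k) (hpk : ¬ p ∣ k)
    (hcase : (5 ≤ p ∧ k % 3 = 1) ∨ (p = 3 ∧ k = 2)) (N : ℕ) :
    0 ≤ 1 - (fixPoly p)^[N] 0 ∧ ∃ (B : ℕ) (x₀ : ℝ), ∀ x, x₀ ≤ x →
      ∑ q ∈ Finset.Icc 0 ⌊x⌋₊ with
        q.Prime ∧ B < q ∧ ∃ z : ℤ, (q : ℤ) ∣ (polyIter (phi p k) N).eval z, Real.log q ≤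
      8 * p.factorial * (1 - (fixPoly p)^[N] 0) * x := by
  have hodd : Odd p := hp.odd_of_ne_two (by lia)
  obtain ⟨K, _, _, _, hs, hfaith⟩ := exists_numberField_splits p k N hp.two_le
  have hcard := card_exists_smul_eq_integralRoots_phi (K := K) hp hk hpk hcase hs
  set S := Finset.univ.filter fun g : Gal(K/ℚ) ↦
    ∃ x ∈ integralRoots K (polyIter (phi p k) N), g • x = x
  have hmem {g : Gal(K/ℚ)} :
      g ∈ S ↔ ∃ x ∈ integralRoots K (polyIter (phi p k) N), g • x = x :=
    Finset.mem_filter_univ g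
  have hG : (0 : ℝ) < Fintype.card Gal(K/ℚ) := by exact_mod_cast Fintype.card_pos
  have hratio : 1 - (fixPoly p)^[N] 0 = S.card / (Fintype.card Gal(K/ℚ) : ℝ) := by
    rw [hcard, mul_div_cancel_left₀ _ hG.ne']
  obtain ⟨B₁, hB₁⟩ := exists_hasFrobeniusIn_of_dvd_eval (monic_polyIter_phi hp.two_le N)
    (irreducible_polyIter_phi hp hodd hpk N) (hs N le_rfl) (S := S)
    fun g x hx hgx ↦ hmem.mpr ⟨x, hx, hgx⟩
  have hconj : ∀ g, ∀ τ ∈ S, g⁻¹ * τ * g ∈ S := by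
    intro g τ hτ
    obtain ⟨x, hx, hτx⟩ := hmem.mp hτ
    refine hmem.mpr ⟨g⁻¹ • x, smul_mem_integralRoots (monic_polyIter_phi hp.two_le N).ne_zero _ hx,
      ?_⟩
    rw [mul_smul, mul_smul, smul_inv_smul, hτx]
  have hgen : ∀ τ ∈ S, ∀ σ, Subgroup.zpowers σ = Subgroup.zpowers τ → σ ∈ S := by
    intro τ hτ σ hσ
    obtain ⟨x, hx, hτx⟩ := hmem.mp hτ
    refine hmem.mpr ⟨x, hx, ?_⟩
    have h1 : Subgroup.zpowers τ ≤ MulAction.stabilizer Gal(K/ℚ) x :=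
      Subgroup.zpowers_le_of_mem hτx
    exact h1 (hσ ▸ Subgroup.mem_zpowers σ)
  have hM : ∀ σ ∈ S, (orderOf σ : ℝ) ≤ (p.factorial : ℝ) * (orderOf σ).totient := by
    intro σ _
    have hord : orderOf σ ∣ p.factorial ^ N := orderOf_dvd_of_pow_eq_one <|
      hfaith _ fun n hn x hx ↦ smul_eq_of_mem_integralRoots_phi hp hodd hpk hs σ hn hx
    rw [← Nat.cast_mul]
    exact Nat.cast_le.mpr (Nat.le_factorial_mul_totient hord)
  obtain ⟨B₂, x₀, hx₀⟩ :=
    exists_sum_log_hasFrobeniusIn_le hconj hgen (Nat.cast_nonneg _) hM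
  refine ⟨hratio ▸ div_nonneg (Nat.cast_nonneg _) hG.le, max B₁ B₂, x₀, fun x hx ↦ ?_⟩
  rw [hratio]
  refine le_trans (Finset.sum_le_sum_of_subset_of_nonneg ?_ ?_) (hx₀ x hx)
  · intro q hq
    rw [Finset.mem_filter] at hq ⊢
    obtain ⟨hq1, hq2, hq3, z, hz⟩ := hq
    exact ⟨hq1, hq2, (le_max_right _ _).trans_lt hq3,
      hB₁ q hq2 ((le_max_left _ _).trans_lt hq3) z hz⟩
  · exact fun q _ _ ↦ Real.log_natCast_nonneg q

theorem dvd_num_of_padicValRat_pos {q : ℕ} {x : ℚ} (hx : 0 < padicValRat q x) :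
    x ≠ 0 ∧ (q : ℤ) ∣ x.num := by
  refine ⟨by rintro rfl; simp at hx, ?_⟩
  by_contra h
  rw [padicValRat, padicValInt.eq_zero_of_not_dvd h] at hx
  lia

theorem exists_dvd_eval_of_padicValRat_pos {q : ℕ} (hq : q.Prime) {a : ℚ} (ha : ¬ q ∣ a.den)
    {N i : ℕ} (hi : N ≤ i) (hx : 0 < padicValRat q ((phiMap p k)^[i] a)) :
    ∃ z : ℤ, (q : ℤ) ∣ (polyIter (phi p k) N).eval z := by
  have := Fact.mk hq
  obtain ⟨y, hya⟩ : ∃ y : ℤ_[q], PadicInt.Coe.ringHom y = Rat.castHom ℚ_[q] a :=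
    ⟨⟨(a : ℚ_[q]), Padic.norm_rat_le_one ha⟩, rfl⟩
  have hy : (((phiMap p k)^[i] y : ℤ_[q]) : ℚ_[q]) = (((phiMap p k)^[i] a : ℚ) : ℚ_[q]) := by
    have h := map_iterate_phiMap (p := p) (k := k) PadicInt.Coe.ringHom i y
    rwa [hya, ← map_iterate_phiMap] at h
  have hnorm : ‖(phiMap p k)^[i] y‖ < 1 := by
    rw [PadicInt.norm_def, hy, Padic.eq_padicNorm,
      padicNorm.eq_zpow_of_nonzero (dvd_num_of_padicValRat_pos hx).1]
    push_cast
    exact zpow_lt_one_of_neg₀ (by exact_mod_cast hq.one_lt) (by lia)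
  have hzero : (phiMap p k)^[i] (PadicInt.toZMod y) = 0 := by
    rw [← map_iterate_phiMap, ← RingHom.mem_ker, PadicInt.ker_toZMod,
      IsLocalRing.mem_maximalIdeal, PadicInt.mem_nonunits]
    exact hnorm
  obtain ⟨z, hz⟩ := ZMod.intCast_surjective ((phiMap p k)^[i - N] (PadicInt.toZMod y))
  refine ⟨z, (ZMod.intCast_zmod_eq_zero_iff_dvd _ _).mp ?_⟩
  rw [← coe_aeval_eq_eval, aeval_polyIter_phi, ← eq_intCast (Int.castRingHom _),
    map_iterate_phiMap, eq_intCast, hz, ← Function.iterate_add_apply, Nat.add_sub_cancel' hi, hzero]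

open Filter in
theorem tendsto_ncard_div_ncard_prime (hp : p.Prime) (hk : 0 < k) (hpk : ¬ p ∣ k)
    (hcase : (5 ≤ p ∧ k % 3 = 1) ∨ (p = 3 ∧ k = 2)) (a : ℚ) :
    Tendsto (fun n : ℕ ↦
      (({q : ℕ | (q.Prime ∧ ∃ i : ℕ, 0 < padicValRat q ((phiMap p k)^[i] a)) ∧ q ≤ n}.ncard : ℝ)
        / ({q : ℕ | q.Prime ∧ q ≤ n}.ncard : ℝ))) atTop (nhds 0) := by
  classical
  have hbound {A : Set ℕ} (hA : ∀ q ∈ A, q.Prime ∧ ∃ i, 0 < padicValRat q ((phiMap p k)^[i] a))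
      (N : ℕ) (ε : ℝ) (hε : 0 < ε) : ∀ᶠ n : ℕ in atTop,
      ({q : ℕ | q ∈ A ∧ q ≤ n}.ncard : ℝ) ≤
        (4 * (8 * p.factorial * (1 - (fixPoly p)^[N] 0)) + ε) *
          ({q : ℕ | q.Prime ∧ q ≤ n}.ncard : ℝ) := by
    obtain ⟨hnonneg, B, x₀, hx₀⟩ := exists_sum_log_dvd_eval_le hp hk hpk hcase N
    refine eventually_ncard_le_mul_ncard_prime (A := A) (by positivity) (x₀ := x₀)
      (B := B + a.den + ∑ i ∈ Finset.range N, ((phiMap p k)^[i] a).num.natAbs) ?_ hε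
    intro x hx
    refine le_trans (Finset.sum_le_sum_of_subset_of_nonneg ?_ ?_) (hx₀ x hx)
    · intro q hq
      rw [Finset.mem_filter] at hq ⊢
      obtain ⟨hqx, hBq, hqA⟩ := hq
      obtain ⟨hqp, i, hi⟩ := hA q hqA
      refine ⟨hqx, hqp, by lia, ?_⟩
      have hden : ¬ q ∣ a.den := Nat.not_dvd_of_pos_of_lt a.den_pos (by lia)
      refine exists_dvd_eval_of_padicValRat_pos hqp hden (not_lt.mp fun hiN ↦ ?_) hi
      obtain ⟨hne, hdvd⟩ := dvd_num_of_padicValRat_pos hi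
      have h1 := Nat.le_of_dvd (Int.natAbs_pos.mpr (Rat.num_ne_zero.mpr hne))
        (Int.natCast_dvd.mp hdvd)
      have h2 := Finset.single_le_sum (f := fun i ↦ ((phiMap p k)^[i] a).num.natAbs)
        (fun _ _ ↦ Nat.zero_le _) (Finset.mem_range.mpr hiN)
      lia
    · exact fun q _ _ ↦ Real.log_natCast_nonneg q
  have hlim : Tendsto (fun N ↦ 4 * (8 * p.factorial * (1 - (fixPoly p)^[N] 0))) atTop (nhds 0) := by
    have h := ((tendsto_iterate_fixPoly hp.two_le).const_sub 1).const_mul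
      (4 * (8 * (p.factorial : ℝ)))
    rw [sub_self, mul_zero] at h
    exact h.congr fun N ↦ by ring
  rw [tendsto_order]
  refine ⟨fun r hr ↦ .of_forall fun n ↦ hr.trans_le (by positivity), fun r hr ↦ ?_⟩
  obtain ⟨N, hN⟩ := (hlim.eventually_lt_const (half_pos hr)).exists
  filter_upwards [hbound (fun _ h ↦ h) N (r / 2) (half_pos hr)] with n hn
  rcases (Nat.cast_nonneg (α := ℝ) {q : ℕ | q.Prime ∧ q ≤ n}.ncard).eq_or_lt with h0 | h0
  · rwa [← h0, div_zero]
  · rw [div_lt_iff₀ h0]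
    exact hn.trans_lt (mul_lt_mul_of_pos_right (by linarith) h0)

end Density

end

open Filter

/-- Let `p ≥ 5` be prime, `k ≥ 1` with `p ∤ k` and `k ≡ 1 (mod 3)`
(or `p = 3` and `k = 2`), and `φ(x) = x^p + kp·x^{p-1} - kp`. If `a₀ ∈ ℚ` has infinite
forward orbit under `φ`, then the set `P(a₀)` of primes `q` with `v_q(φ^i(a₀)) > 0` for some
`i ≥ 0` has natural density zero in the primes: the ratio
`#{q ∈ P(a₀) : q ≤ x} / #{q prime : q ≤ x}` tends to `0` as `x → ∞`. -/
theorem stmt_4 (p k : ℕ) (hp : p.Prime) (hk : 0 < k) (hpk : ¬ p ∣ k)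
    (hcase : (5 ≤ p ∧ k % 3 = 1) ∨ (p = 3 ∧ k = 2))
    (φ : Polynomial ℤ)
    (hφ : φ = X ^ p + C ((k : ℤ) * p) * X ^ (p - 1) - C ((k : ℤ) * p))
    (a₀ : ℚ)
    (horbit : ∀ i j : ℕ, Polynomial.aeval a₀ (polyIter φ i) =
      Polynomial.aeval a₀ (polyIter φ j) → i = j) :
    Tendsto (fun x : ℕ =>
      (({q : ℕ | (q.Prime ∧
          ∃ i : ℕ, 0 < padicValRat q (Polynomial.aeval a₀ (polyIter φ i))) ∧ q ≤ x}.ncard : ℝ)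
        / ({q : ℕ | q.Prime ∧ q ≤ x}.ncard : ℝ)))
      atTop (nhds 0) := by
  obtain rfl : φ = phi p k := hφ
  simp only [aeval_polyIter_phi]
  exact tendsto_ncard_div_ncard_prime hp hk hpk hcase a₀
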